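/- arXiv:1908.01432 — 3 statements merged into one kernel-verified Lean document; each statement's English description precedes it below -/
import Mathlib

section
/- Let G be a graph of order n ≥ 2. If G is not isomorphic to the 5-cycle C_5, then γ_ri2(G) + γ_ri2(Ḡ) ≤ n + 2, where Ḡ is the complement of G. -/
open scoped Classical

/-- A `k`-rainbow independent dominating function of `G`: values in `{0,...,k}`,
each nonzero colour class is independent, and every vertex of value `0` has,
for each `i ∈ {1,...,k}`, a neighbor of value `i`. -/
def IsKRiDF {V : Type*} (G : SimpleGraph V) (k : ℕ) (f : V → ℕ) : Prop :=
  (∀ v, f v ≤ k) ∧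
  (∀ i, 1 ≤ i → i ≤ k → ∀ u v, f u = i → f v = i → ¬ G.Adj u v) ∧
  (∀ v, f v = 0 → ∀ i, 1 ≤ i → i ≤ k → ∃ u, G.Adj v u ∧ f u = i)

/-- The weight of a labelling: the number of vertices with nonzero value. -/
noncomputable def riWeight {V : Type*} [Fintype V] (f : V → ℕ) : ℕ :=
  (Finset.univ.filter fun v => f v ≠ 0).card

/-- The `k`-rainbow independent domination number. -/
noncomputable def riNumber {V : Type*} [Fintype V] (G : SimpleGraph V) (k : ℕ) : ℕ :=
  sInf {w | ∃ f, IsKRiDF G k f ∧ riWeight f = w}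

/-- The star `S_m = K_{1,m}` on `Fin (m+1)` with centre `0`. -/
def starGraph (m : ℕ) : SimpleGraph (Fin (m + 1)) :=
  SimpleGraph.fromRel (fun a b => (a : ℕ) = 0 ∧ (b : ℕ) ≠ 0)

/-- The star `S_m` with one extra edge between the leaves `1` and `2`. -/
def starPlusGraph (m : ℕ) : SimpleGraph (Fin (m + 1)) :=
  SimpleGraph.fromRel (fun a b => ((a : ℕ) = 0 ∧ (b : ℕ) ≠ 0) ∨ ((a : ℕ) = 1 ∧ (b : ℕ) = 2))

/-- The double star `S(n,m)`: centres `0` (with leaves `2,...,n+1`) and `1`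
(with leaves `n+2,...,n+m+1`), joined by the bridge `01`. -/
def doubleStar (n m : ℕ) : SimpleGraph (Fin (n + m + 2)) :=
  SimpleGraph.fromRel (fun a b =>
    ((a : ℕ) = 0 ∧ (b : ℕ) = 1) ∨
    ((a : ℕ) = 0 ∧ 2 ≤ (b : ℕ) ∧ (b : ℕ) < n + 2) ∨
    ((a : ℕ) = 1 ∧ n + 2 ≤ (b : ℕ)))


section Colourings

variable {V : Type*}

/-- A labelling with values in `{0, 1, 2}` whose two nonzero classes are independent. -/
def IsPartialColouring (G : SimpleGraph V) (f : V → ℕ) : Prop :=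
  (∀ v, f v ≤ 2) ∧ ∀ u v, f u ≠ 0 → f u = f v → ¬ G.Adj u v

variable [Fintype V]

lemma IsPartialColouring.exists_extension {G : SimpleGraph V} {p : V → ℕ}
    (hp : IsPartialColouring G p) : ∃ f, IsKRiDF G 2 f ∧ ∀ v, p v ≠ 0 → f v = p v := by
  induction hm : (Finset.univ.filter fun v => p v = 0).card using Nat.strong_induction_on
    generalizing p with
  | _ m ih =>
    by_cases hdom : ∀ v, p v = 0 → ∀ i, 1 ≤ i → i ≤ 2 → ∃ u, G.Adj v u ∧ p u = i
    · exact ⟨p, ⟨hp.1, fun i hi _ u v hu hv => hp.2 u v (by omega) (by omega), hdom⟩,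
        fun _ _ => rfl⟩
    push Not at hdom
    obtain ⟨v, hv, i, hi, hi', hvi⟩ := hdom
    have hq : IsPartialColouring G (Function.update p v i) := by
      refine ⟨fun u => ?_, fun u w hu huw hadj => ?_⟩
      · by_cases huv : u = v
        · simpa [huv] using hi'
        · simpa [huv] using hp.1 u
      · by_cases huv : u = v
        · by_cases hwv : w = v
          · exact hadj.ne (huv.trans hwv.symm)
          · simp only [huv, Function.update_self, ne_eq, hwv, not_false_eq_true,
              Function.update_of_ne] at huw
            exact hvi w (huv ▸ hadj) huw.symm
        · by_cases hwv : w = v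
          · simp only [hwv, Function.update_self, ne_eq, huv, not_false_eq_true,
              Function.update_of_ne] at huw
            exact hvi u (hwv ▸ hadj.symm) huw
          · simp only [ne_eq, huv, not_false_eq_true, Function.update_of_ne, hwv] at hu huw
            exact hp.2 u w hu huw hadj
    have hlt : (Finset.univ.filter fun u => Function.update p v i u = 0).card < m := by
      rw [← hm]
      refine Finset.card_lt_card ⟨fun u hu => ?_, fun hsub => ?_⟩
      · by_cases huv : u = v
        · simpa [huv] using hv
        · simpa [huv] using hu
      · have := hsub (by simpa using hv : v ∈ _)
        simp only [Finset.mem_filter, Finset.mem_univ, Function.update_self, true_and] at this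
        omega
    obtain ⟨f, hf, hfp⟩ := ih _ hlt hq rfl
    refine ⟨f, hf, fun u hu => ?_⟩
    have huv : u ≠ v := fun h => hu (h ▸ hv)
    simpa [huv, hu] using hfp u

/-- Two disjoint independent sets are contained in the colour classes of a 2RiDF. -/
lemma exists_isKRiDF_of_sets (G : SimpleGraph V) (A B : Set V) (hAB : Disjoint A B)
    (hA : ∀ u ∈ A, ∀ v ∈ A, ¬ G.Adj u v) (hB : ∀ u ∈ B, ∀ v ∈ B, ¬ G.Adj u v) :
    ∃ f, IsKRiDF G 2 f ∧ (∀ v ∈ A, f v = 1) ∧ ∀ v ∈ B, f v = 2 := by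
  rw [Set.disjoint_left] at hAB
  have hp : IsPartialColouring G fun v => if v ∈ A then 1 else if v ∈ B then 2 else 0 := by
    refine ⟨fun v => ?_, fun u v hu huv => ?_⟩
    · dsimp only; split_ifs <;> simp
    · dsimp only at hu huv
      split_ifs at hu huv <;> simp_all
  obtain ⟨f, hf, hfp⟩ := hp.exists_extension
  refine ⟨f, hf, fun v hv => ?_, fun v hv => ?_⟩
  · simpa [hv] using hfp v
  · have : v ∉ A := fun h => hAB h hv
    simpa [hv, this] using hfp v

lemma riNumber_le {G : SimpleGraph V} {f : V → ℕ} (hf : IsKRiDF G 2 f) :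
    riNumber G 2 ≤ riWeight f :=
  Nat.sInf_le ⟨f, hf, rfl⟩

lemma riWeight_le_card {f : V → ℕ} (s : Finset V) (h : ∀ v ∉ s, f v = 0) :
    riWeight f ≤ s.card := by
  refine Finset.card_le_card fun v hv => ?_
  by_contra hvs
  simp [h v hvs] at hv

lemma riWeight_add_card_le {f : V → ℕ} (s : Finset V) (h : ∀ v ∈ s, f v = 0) :
    riWeight f + s.card ≤ Fintype.card V := by
  have := riWeight_le_card (f := f) sᶜ fun v hv => h v (by simpa using hv)
  have := s.card_add_card_compl
  omega

lemma riNumber_le_card (G : SimpleGraph V) : riNumber G 2 ≤ Fintype.card V := by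
  obtain ⟨f, hf, -⟩ := exists_isKRiDF_of_sets G ∅ ∅ (by simp) (by simp) (by simp)
  have h := riWeight_add_card_le (f := f) ∅ (by simp)
  exact (riNumber_le hf).trans (by simpa using h)

lemma riWeight_add_riWeight_le {f g : V → ℕ} (E Z : Finset V)
    (hE : ∀ v ∉ E, f v = 0 ∨ g v = 0) (hZ : ∀ v ∈ Z, f v = 0 ∧ g v = 0) :
    riWeight f + riWeight g + Z.card ≤ Fintype.card V + E.card := by
  unfold riWeight
  rw [← Finset.card_union_add_card_inter]
  have h1 : ((Finset.univ.filter fun v => f v ≠ 0) ∩ Finset.univ.filter fun v => g v ≠ 0).card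
      ≤ E.card := by
    refine Finset.card_le_card fun v hv => ?_
    by_contra hvE
    have := hE v hvE
    simp only [Finset.mem_inter, Finset.mem_filter, Finset.mem_univ, true_and] at hv
    tauto
  have h2 : ((Finset.univ.filter fun v => f v ≠ 0) ∪ Finset.univ.filter fun v => g v ≠ 0).card
      ≤ Zᶜ.card := by
    refine Finset.card_le_card fun v hv => ?_
    rw [Finset.mem_compl]
    intro hvZ
    have := hZ v hvZ
    simp [this] at hv
  have := Z.card_add_card_compl
  omega

/-- Labellings of a graph and of its complement whose supports meet in at most two more vertices
than their zero sets. -/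
lemma riNumber_add_riNumber_compl_le {G : SimpleGraph V} {f g : V → ℕ} (hf : IsKRiDF G 2 f)
    (hg : IsKRiDF Gᶜ 2 g) (E Z : Finset V) (hE : ∀ v ∉ E, f v = 0 ∨ g v = 0)
    (hZ : ∀ v ∈ Z, f v = 0 ∧ g v = 0) (hEZ : E.card ≤ Z.card + 2) :
    riNumber G 2 + riNumber Gᶜ 2 ≤ Fintype.card V + 2 := by
  have := riNumber_le hf
  have := riNumber_le hg
  have := riWeight_add_riWeight_le E Z hE hZ
  omega

end Colourings

section Twins

variable {V : Type*}

/-- `G` has no induced path on four vertices inside `X`. -/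
def P4FreeOn (G : SimpleGraph V) (X : Finset V) : Prop :=
  ∀ a ∈ X, ∀ b ∈ X, ∀ c ∈ X, ∀ d ∈ X, a ≠ c → a ≠ d → b ≠ d → G.Adj a b → G.Adj b c →
    G.Adj c d → G.Adj a c ∨ G.Adj a d ∨ G.Adj b d

lemma P4FreeOn.mono {G : SimpleGraph V} {X Y : Finset V} (h : P4FreeOn G X) (hYX : Y ⊆ X) :
    P4FreeOn G Y :=
  fun a ha b hb c hc d hd =>
    h a (hYX ha) b (hYX hb) c (hYX hc) d (hYX hd)

lemma P4FreeOn.compl {G : SimpleGraph V} {X : Finset V} (h : P4FreeOn G X) :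
    P4FreeOn Gᶜ X := by
  intro a ha b hb c hc d hd hac had hbd hab hbc hcd
  simp only [SimpleGraph.compl_adj] at *
  have := h c hc a ha d hd b hb
  have := G.adj_comm
  grind

/-- `X` is the union of two nonempty disjoint parts with no edges between them. -/
def IsSplit (G : SimpleGraph V) (X : Finset V) : Prop :=
  ∃ A B : Finset V, A.Nonempty ∧ B.Nonempty ∧ Disjoint A B ∧ A ∪ B = X ∧
    ∀ a ∈ A, ∀ b ∈ B, ¬ G.Adj a b

lemma isSplit_insert_of_isSplit {G : SimpleGraph V} {X : Finset V} {v : V} (hv : v ∉ X)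
    (hX : P4FreeOn G (insert v X)) (h : IsSplit G X) :
    IsSplit G (insert v X) ∨ IsSplit Gᶜ (insert v X) := by
  obtain ⟨A, B, hA, hB, hAB, rfl, hno⟩ := h
  have key : ∀ A B : Finset V, A.Nonempty → B.Nonempty → Disjoint A B → v ∉ A → v ∉ B →
      P4FreeOn G (insert v (A ∪ B)) → (∀ a ∈ A, ∀ b ∈ B, ¬ G.Adj a b) →
      (∃ y ∈ A, ¬ G.Adj v y) → IsSplit G (insert v (A ∪ B)) := by
    intro A B hA hB hAB hvA hvB hX hno ⟨y, hyA, hvy⟩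
    rw [Finset.disjoint_left] at hAB
    by_cases hw : ∃ w ∈ B, G.Adj v w
    · obtain ⟨w, hwB, hvw⟩ := hw
      refine ⟨A.filter (¬ G.Adj v ·), insert v (A.filter (G.Adj v ·) ∪ B), ⟨y, by simp [*]⟩,
        ⟨v, by simp⟩, ?_, ?_, ?_⟩
      · rw [Finset.disjoint_left]
        grind
      · ext u
        simp only [Finset.mem_union, Finset.mem_filter, Finset.mem_insert]
        tauto
      · intro a ha b hb hab
        simp only [Finset.mem_union, Finset.mem_filter, Finset.mem_insert] at ha hb
        rcases hb with rfl | hb | hb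
        · exact ha.2 hab.symm
        · rcases hX a (by simp [ha]) b (by simp [hb]) v (by simp) w (by simp [hwB])
            (by rintro rfl; exact hvA ha.1) (by rintro rfl; exact hAB ha.1 hwB)
            (by rintro rfl; exact hAB hb.1 hwB) hab hb.2.symm hvw with h | h | h
          · exact ha.2 h.symm
          · exact hno a ha.1 w hwB h
          · exact hno b hb.1 w hwB h
        · exact hno a ha.1 b hb hab
    · push Not at hw
      refine ⟨insert v A, B, ⟨v, by simp⟩, hB, ?_, by simp, ?_⟩
      · rw [Finset.disjoint_left]
        grind
      · grind
  simp only [Finset.mem_union, not_or] at hv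
  by_cases h1 : ∃ y ∈ A, ¬ G.Adj v y
  · exact .inl (key A B hA hB hAB hv.1 hv.2 hX hno h1)
  by_cases h2 : ∃ y ∈ B, ¬ G.Adj v y
  · rw [Finset.union_comm] at hX ⊢
    exact .inl (key B A hB hA hAB.symm hv.2 hv.1 hX
      (fun a ha b hb hab => hno b hb a ha hab.symm) h2)
  push Not at h1 h2
  refine .inr ⟨{v}, A ∪ B, by simp, by simp [hA], by simp [hv], rfl, ?_⟩
  simp only [SimpleGraph.compl_adj]
  grind

/-- Seinsche's theorem: a `P₄`-free set of at least two vertices, or its complement, is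
disconnected. -/
lemma P4FreeOn.isSplit {G : SimpleGraph V} {X : Finset V} (hX : P4FreeOn G X)
    (hcard : 2 ≤ X.card) : IsSplit G X ∨ IsSplit Gᶜ X := by
  induction X using Finset.induction_on with
  | empty => simp at hcard
  | insert v X hv ih =>
    rw [Finset.card_insert_of_notMem hv] at hcard
    by_cases h1 : X.card = 1
    · obtain ⟨u, rfl⟩ := Finset.card_eq_one.1 h1
      have hvu : v ≠ u := by simpa using hv
      by_cases hadj : G.Adj v u
      · exact .inr ⟨{v}, {u}, by simp, by simp, by simpa using hvu, rfl, by simp [hadj]⟩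
      · exact .inl ⟨{v}, {u}, by simp, by simp, by simpa using hvu, rfl, by simp [hadj]⟩
    · rcases ih (hX.mono (Finset.subset_insert v X)) (by omega) with h | h
      · exact isSplit_insert_of_isSplit hv hX h
      · simpa [or_comm] using isSplit_insert_of_isSplit hv hX.compl h

/-- A `P₄`-free set of at least two vertices contains a pair of twins. -/
lemma P4FreeOn.exists_twins {G : SimpleGraph V} {X : Finset V} (hX : P4FreeOn G X)
    (hcard : 2 ≤ X.card) :
    ∃ a ∈ X, ∃ b ∈ X, a ≠ b ∧ ∀ v ∈ X, v ≠ a → v ≠ b → (G.Adj v a ↔ G.Adj v b) := by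
  induction hm : X.card using Nat.strong_induction_on generalizing X with
  | _ m ih =>
    have hsplit : ∃ A B : Finset V, A.Nonempty ∧ B.Nonempty ∧ Disjoint A B ∧ A ∪ B = X ∧
        ∀ a ∈ A, ∀ a' ∈ A, ∀ b ∈ B, ∀ b' ∈ B, (G.Adj a b ↔ G.Adj a' b') := by
      rcases hX.isSplit hcard with ⟨A, B, hA, hB, hAB, hu, h⟩ | ⟨A, B, hA, hB, hAB, hu, h⟩
      · exact ⟨A, B, hA, hB, hAB, hu, by grind⟩
      · refine ⟨A, B, hA, hB, hAB, hu, ?_⟩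
        rw [Finset.disjoint_left] at hAB
        simp only [SimpleGraph.compl_adj] at h
        grind
    have hpart : ∀ A B : Finset V, B.Nonempty → Disjoint A B → A ∪ B = X →
        (∀ a ∈ A, ∀ a' ∈ A, ∀ b ∈ B, ∀ b' ∈ B, (G.Adj a b ↔ G.Adj a' b')) → 2 ≤ A.card →
        ∃ a ∈ X, ∃ b ∈ X, a ≠ b ∧ ∀ v ∈ X, v ≠ a → v ≠ b → (G.Adj v a ↔ G.Adj v b) := by
      intro A B hB hAB hu h h2
      have hc : A.card + B.card = X.card := by rw [← hu, Finset.card_union_of_disjoint hAB]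
      have := hB.card_pos
      obtain ⟨a, ha, b, hb, hab, hv⟩ :=
        ih A.card (by omega) (hX.mono (hu ▸ Finset.subset_union_left)) h2 rfl
      refine ⟨a, by simp [← hu, ha], b, by simp [← hu, hb], hab, fun v hvX hva hvb => ?_⟩
      rw [← hu, Finset.mem_union] at hvX
      rcases hvX with hvA | hvB
      · exact hv v hvA hva hvb
      · rw [G.adj_comm v a, G.adj_comm v b]
        exact h a ha b hb v hvB v hvB
    obtain ⟨A, B, hA, hB, hAB, hu, h⟩ := hsplit
    by_cases hA2 : 2 ≤ A.card
    · exact hpart A B hB hAB hu h hA2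
    by_cases hB2 : 2 ≤ B.card
    · refine hpart B A hA hAB.symm (by rw [Finset.union_comm, hu]) ?_ hB2
      intro b hb b' hb' a ha a' ha'
      rw [G.adj_comm b, G.adj_comm b']
      exact h a ha a' ha' b hb b' hb'
    obtain ⟨a, rfl⟩ := Finset.card_eq_one.1 (show A.card = 1 by have := hA.card_pos; omega)
    obtain ⟨b, rfl⟩ := Finset.card_eq_one.1 (show B.card = 1 by have := hB.card_pos; omega)
    refine ⟨a, by simp [← hu], b, by simp [← hu], by simpa using hAB, ?_⟩
    simp only [← hu, Finset.mem_union, Finset.mem_singleton]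
    tauto

end Twins

section MutualPairs

variable {V : Type*} {G : SimpleGraph V}

lemma IsKRiDF.eq_zero_of_ne {f : V → ℕ} (hf : IsKRiDF G 2 f) {v : V} (h1 : f v ≠ 1)
    (h2 : f v ≠ 2) : f v = 0 := by
  have := hf.1 v
  omega

lemma IsKRiDF.ne_one {f : V → ℕ} (hf : IsKRiDF G 2 f) {u v : V} (huv : G.Adj v u)
    (hu : f u = 1) : f v ≠ 1 :=
  fun hv => hf.2.1 1 le_rfl one_le_two v u hv hu huv

lemma IsKRiDF.ne_two {f : V → ℕ} (hf : IsKRiDF G 2 f) {u v : V} (huv : G.Adj v u)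
    (hu : f u = 2) : f v ≠ 2 :=
  fun hv => hf.2.1 2 one_le_two le_rfl v u hv hu huv

lemma IsKRiDF.eq_zero {f : V → ℕ} (hf : IsKRiDF G 2 f) {u w v : V} (huv : G.Adj v u)
    (hwv : G.Adj v w) (hu : f u = 1) (hw : f w = 2) : f v = 0 :=
  hf.eq_zero_of_ne (hf.ne_one huv hu) (hf.ne_two hwv hw)

/-- An independent set `S` and a disjoint clique `T` such that every vertex of `T` has a neighbour
in `S` and every vertex of `S` has a non-neighbour in `T`. -/
structure IsMutual (G : SimpleGraph V) (S T : Finset V) : Prop where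
  notMem : ∀ v ∈ S, v ∉ T
  indep : ∀ u ∈ S, ∀ v ∈ S, ¬ G.Adj u v
  clique : ∀ u ∈ T, ∀ v ∈ T, u ≠ v → G.Adj u v
  exists_adj : ∀ t ∈ T, ∃ s ∈ S, G.Adj t s
  exists_not_adj : ∀ s ∈ S, ∃ t ∈ T, ¬ G.Adj s t

lemma IsMutual.compl {S T : Finset V} (h : IsMutual G S T) : IsMutual Gᶜ T S where
  notMem v hvT hvS := h.notMem v hvS hvT
  indep u hu v hv huv := huv.2 (h.clique u hu v hv huv.1)
  clique u hu v hv huv := ⟨huv, h.indep u hu v hv⟩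
  exists_adj s hs := by
    obtain ⟨t, ht, hst⟩ := h.exists_not_adj s hs
    exact ⟨t, ht, by rintro rfl; exact h.notMem _ hs ht, hst⟩
  exists_not_adj t ht := by
    obtain ⟨s, hs, hst⟩ := h.exists_adj t ht
    exact ⟨s, hs, fun h => h.2 hst⟩

/-- A mutual pair such that moreover every other vertex has a neighbour in the independent set and
a non-neighbour in the clique. -/
structure IsCover (G : SimpleGraph V) (I K : Finset V) : Prop extends IsMutual G I K where
  exists_adj' : ∀ r ∉ I, r ∉ K → ∃ i ∈ I, G.Adj r i
  exists_not_adj' : ∀ r ∉ I, r ∉ K → ∃ k ∈ K, ¬ G.Adj r k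

lemma IsCover.compl {I K : Finset V} (h : IsCover G I K) : IsCover Gᶜ K I where
  toIsMutual := h.toIsMutual.compl
  exists_adj' r hrK hrI := by
    obtain ⟨t, ht, hrt⟩ := h.exists_not_adj' r hrI hrK
    exact ⟨t, ht, by rintro rfl; exact hrK ht, hrt⟩
  exists_not_adj' r hrK hrI := by
    obtain ⟨s, hs, hrs⟩ := h.exists_adj' r hrI hrK
    exact ⟨s, hs, fun h => h.2 hrs⟩

variable [Fintype V]

lemma riNumber_add_le_of_twins {S T : Finset V} (h : IsMutual G S T) {a b : V} (hab : a ≠ b)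
    (haS : ∀ s ∈ S, ¬ G.Adj a s) (hbS : ∀ s ∈ S, ¬ G.Adj b s)
    (haT : ∀ t ∈ T, G.Adj t a) (hbT : ∀ t ∈ T, G.Adj t b)
    (haS' : a ∉ S) (hbS' : b ∉ S) (haT' : a ∉ T) (hbT' : b ∉ T)
    (hR : ∀ v ∉ S, v ∉ T → v ≠ a → v ≠ b →
      ((∃ s ∈ S, G.Adj v s) ∧ ∃ t ∈ T, ¬ G.Adj v t) ∨ (G.Adj v a ↔ G.Adj v b)) :
    riNumber G 2 + riNumber Gᶜ 2 ≤ Fintype.card V + 2 := by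
  have key : ∀ {G : SimpleGraph V} {S T : Finset V}, IsMutual G S T → (∀ s ∈ S, ¬ G.Adj a s) →
      a ∉ S → b ∉ S → ∃ f, IsKRiDF G 2 f ∧ (∀ s ∈ S, f s = 1) ∧ f a = 1 ∧ f b = 2 := by
    intro G S T h haS haS' hbS'
    obtain ⟨f, hf, hf1, hf2⟩ := exists_isKRiDF_of_sets G (insert a (S : Set V)) {b}
      (by simpa using ⟨hab.symm, hbS'⟩) (by
        rintro u (rfl | hu) v (rfl | hv)
        · simp
        · exact haS v hv
        · exact fun huv => haS u hu huv.symm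
        · exact h.indep u hu v hv) (by simp)
    exact ⟨f, hf, fun s hs => hf1 s (.inr hs), hf1 a (.inl rfl), hf2 b rfl⟩
  obtain ⟨f, hf, hfS, hfa, hfb⟩ := key h haS haS' hbS'
  obtain ⟨g, hg, hgT, hga, hgb⟩ := key h.compl (fun t ht hat => hat.2 (haT t ht).symm) haT' hbT'
  refine riNumber_add_riNumber_compl_le hf hg {a, b} ∅ (fun v hv => ?_) (by simp)
    (by simpa using Finset.card_le_two)
  simp only [Finset.mem_insert, Finset.mem_singleton, not_or] at hv
  by_cases hvS : v ∈ S
  · exact .inr (hg.eq_zero ⟨hv.1, fun h => haS v hvS h.symm⟩ ⟨hv.2, fun h => hbS v hvS h.symm⟩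
      hga hgb)
  by_cases hvT : v ∈ T
  · exact .inl (hf.eq_zero (haT v hvT) (hbT v hvT) hfa hfb)
  rcases hR v hvS hvT hv.1 hv.2 with ⟨⟨s, hs, hvs⟩, t, ht, hvt⟩ | htw
  · by_cases hvb : G.Adj v b
    · exact .inl (hf.eq_zero hvs hvb (hfS s hs) hfb)
    · exact .inr (hg.eq_zero ⟨by rintro rfl; exact hvT ht, hvt⟩ ⟨hv.2, hvb⟩ (hgT t ht) hgb)
  · by_cases hvb : G.Adj v b
    · exact .inl (hf.eq_zero (htw.2 hvb) hvb hfa hfb)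
    · exact .inr (hg.eq_zero ⟨hv.1, fun h => hvb (htw.1 h)⟩ ⟨hv.2, hvb⟩ hga hgb)

lemma riNumber_add_le_of_unique {S T : Finset V} (h : IsMutual G S T) {x : V}
    (hxS : ∀ s ∈ S, ¬ G.Adj x s) (hxT : ∀ t ∈ T, G.Adj t x) (hxS' : x ∉ S) (hxT' : x ∉ T)
    (hR : ∀ v ∉ S, v ∉ T → v ≠ x → (∃ s ∈ S, G.Adj v s) ∧ ∃ t ∈ T, ¬ G.Adj v t) :
    riNumber G 2 + riNumber Gᶜ 2 ≤ Fintype.card V + 2 := by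
  have key : ∀ {G : SimpleGraph V} {S T : Finset V}, IsMutual G S T →
      x ∉ S → ∃ f, IsKRiDF G 2 f ∧ (∀ s ∈ S, f s = 1) ∧ f x = 2 := by
    intro G S T h hxS'
    obtain ⟨f, hf, hf1, hf2⟩ := exists_isKRiDF_of_sets G S {x} (by simpa using hxS')
      (fun u hu v hv => h.indep u hu v hv) (by simp)
    exact ⟨f, hf, fun s hs => hf1 s hs, hf2 x rfl⟩
  obtain ⟨f, hf, hfS, hfx⟩ := key h hxS'
  obtain ⟨g, hg, hgT, hgx⟩ := key h.compl hxT'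
  refine riNumber_add_riNumber_compl_le hf hg {x} ∅ (fun v hv => ?_) (by simp) (by simp)
  rw [Finset.mem_singleton] at hv
  by_cases hvS : v ∈ S
  · obtain ⟨t, ht, hvt⟩ := h.exists_not_adj v hvS
    exact .inr (hg.eq_zero ⟨by rintro rfl; exact h.notMem _ hvS ht, hvt⟩
      ⟨hv, fun h => hxS v hvS h.symm⟩ (hgT t ht) hgx)
  by_cases hvT : v ∈ T
  · obtain ⟨s, hs, hvs⟩ := h.exists_adj v hvT
    exact .inl (hf.eq_zero hvs (hxT v hvT) (hfS s hs) hfx)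
  obtain ⟨⟨s, hs, hvs⟩, t, ht, hvt⟩ := hR v hvS hvT hv
  by_cases hvx : G.Adj v x
  · exact .inl (hf.eq_zero hvs hvx (hfS s hs) hfx)
  · exact .inr (hg.eq_zero ⟨by rintro rfl; exact hvT ht, hvt⟩ ⟨hv, hvx⟩ (hgT t ht) hgx)

lemma exists_maximal_isMutual (G : SimpleGraph V) :
    ∃ S T : Finset V, IsMutual G S T ∧
      ∀ S' T', IsMutual G S' T' → S'.card + T'.card ≤ S.card + T.card := by
  obtain ⟨p, hp, hmax⟩ := (Finset.univ.filter fun p : Finset V × Finset V =>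
    IsMutual G p.1 p.2).exists_max_image (fun p => p.1.card + p.2.card)
      ⟨(∅, ∅), by simpa using ⟨by simp, by simp, by simp, by simp, by simp⟩⟩
  exact ⟨p.1, p.2, by simpa using hp, fun S' T' h => hmax (S', T') (by simpa using h)⟩

lemma riNumber_add_le_or_exists_isCover (G : SimpleGraph V) :
    riNumber G 2 + riNumber Gᶜ 2 ≤ Fintype.card V + 2 ∨ ∃ I K, IsCover G I K := by
  obtain ⟨S, T, h, hmax⟩ := exists_maximal_isMutual G
  set X := Finset.univ.filter fun x => x ∉ S ∧ x ∉ T ∧ (∀ s ∈ S, ¬ G.Adj x s) ∧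
    ∀ t ∈ T, G.Adj t x with hX
  have hmem : ∀ x, x ∈ X ↔ x ∉ S ∧ x ∉ T ∧ (∀ s ∈ S, ¬ G.Adj x s) ∧ ∀ t ∈ T, G.Adj t x := by
    simp [hX]
  have hR : ∀ v ∉ S, v ∉ T → v ∉ X → (∃ s ∈ S, G.Adj v s) ∧ ∃ t ∈ T, ¬ G.Adj v t := by
    intro v hvS hvT hvX
    have hor : (∃ s ∈ S, G.Adj v s) ∨ ∃ t ∈ T, ¬ G.Adj v t := by
      by_contra! hcon
      exact hvX ((hmem v).2 ⟨hvS, hvT, hcon.1, fun t ht => (hcon.2 t ht).symm⟩)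
    refine ⟨?_, ?_⟩
    · by_contra! hno
      have hT : ∃ t ∈ T, ¬ G.Adj v t := hor.resolve_left (by simpa using hno)
      have hnew : IsMutual G (insert v S) T := by
        refine ⟨?_, ?_, h.clique, ?_, ?_⟩
        · simpa using ⟨hvT, h.notMem⟩
        · intro u hu w hw huw
          rw [Finset.mem_insert] at hu hw
          rcases hu with rfl | hu <;> rcases hw with rfl | hw
          · exact huw.ne rfl
          · exact hno w hw huw
          · exact hno u hu huw.symm
          · exact h.indep u hu w hw huw
        · intro t ht
          obtain ⟨s, hs, hts⟩ := h.exists_adj t ht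
          exact ⟨s, by simp [hs], hts⟩
        · simpa using ⟨hT, h.exists_not_adj⟩
      have := hmax _ _ hnew
      rw [Finset.card_insert_of_notMem hvS] at this
      omega
    · by_contra! hno
      have hS : ∃ s ∈ S, G.Adj v s := hor.resolve_right (by simpa using hno)
      have hnew : IsMutual G S (insert v T) := by
        refine ⟨?_, h.indep, ?_, ?_, ?_⟩
        · intro u hu
          rw [Finset.mem_insert, not_or]
          exact ⟨by rintro rfl; exact hvS hu, h.notMem u hu⟩
        · intro u hu w hw huw
          rw [Finset.mem_insert] at hu hw
          rcases hu with rfl | hu <;> rcases hw with rfl | hw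
          · exact absurd rfl huw
          · exact hno w hw
          · exact (hno u hu).symm
          · exact h.clique u hu w hw huw
        · simpa using ⟨hS, h.exists_adj⟩
        · intro s hs
          obtain ⟨t, ht, hst⟩ := h.exists_not_adj s hs
          exact ⟨t, by simp [ht], hst⟩
      have := hmax _ _ hnew
      rw [Finset.card_insert_of_notMem hvT] at this
      omega
  have hP4 : P4FreeOn G X := by
    intro a ha b hb c hc d hd hac had hbd hab hbc hcd
    rw [hmem] at ha hb hc hd
    by_contra! hcon
    have hnew : IsMutual G (insert a (insert d S)) (insert b (insert c T)) := by
      refine ⟨?_, ?_, ?_, ?_, ?_⟩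
      · intro u hu
        simp only [Finset.mem_insert, not_or] at hu ⊢
        rcases hu with rfl | rfl | hu
        · exact ⟨hab.ne, hac, ha.2.1⟩
        · exact ⟨hbd.symm, hcd.ne.symm, hd.2.1⟩
        · exact ⟨by rintro rfl; exact hb.1 hu, by rintro rfl; exact hc.1 hu, h.notMem u hu⟩
      · intro u hu w hw huw
        simp only [Finset.mem_insert] at hu hw
        rcases hu with rfl | rfl | hu <;> rcases hw with rfl | rfl | hw
        · exact huw.ne rfl
        · exact hcon.2.1 huw
        · exact ha.2.2.1 w hw huw
        · exact hcon.2.1 huw.symm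
        · exact huw.ne rfl
        · exact hd.2.2.1 w hw huw
        · exact ha.2.2.1 u hu huw.symm
        · exact hd.2.2.1 u hu huw.symm
        · exact h.indep u hu w hw huw
      · intro u hu w hw huw
        simp only [Finset.mem_insert] at hu hw
        rcases hu with rfl | rfl | hu <;> rcases hw with rfl | rfl | hw
        · exact absurd rfl huw
        · exact hbc
        · exact (hb.2.2.2 w hw).symm
        · exact hbc.symm
        · exact absurd rfl huw
        · exact (hc.2.2.2 w hw).symm
        · exact hb.2.2.2 u hu
        · exact hc.2.2.2 u hu
        · exact h.clique u hu w hw huw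
      · intro t ht
        simp only [Finset.mem_insert] at ht
        rcases ht with rfl | rfl | ht
        · exact ⟨a, by simp, hab.symm⟩
        · exact ⟨d, by simp, hcd⟩
        · obtain ⟨s, hs, hts⟩ := h.exists_adj t ht
          exact ⟨s, by simp [hs], hts⟩
      · intro s hs
        simp only [Finset.mem_insert] at hs
        rcases hs with rfl | rfl | hs
        · exact ⟨c, by simp, hcon.1⟩
        · exact ⟨b, by simp, fun h => hcon.2.2 h.symm⟩
        · obtain ⟨t, ht, hst⟩ := h.exists_not_adj s hs
          exact ⟨t, by simp [ht], hst⟩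
    have := hmax _ _ hnew
    rw [Finset.card_insert_of_notMem (by simpa using ⟨had, ha.1⟩),
      Finset.card_insert_of_notMem hd.1,
      Finset.card_insert_of_notMem (by simpa using ⟨hbc.ne, hb.2.1⟩),
      Finset.card_insert_of_notMem hc.2.1] at this
    omega
  rcases Nat.lt_or_ge 1 X.card with hX2 | hX1
  · left
    obtain ⟨a, haX, b, hbX, hab, htw⟩ := hP4.exists_twins hX2
    have ha := (hmem a).1 haX
    have hb := (hmem b).1 hbX
    refine riNumber_add_le_of_twins h hab ha.2.2.1 hb.2.2.1 ha.2.2.2 hb.2.2.2 ha.1 hb.1 ha.2.1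
      hb.2.1 fun v hvS hvT hva hvb => ?_
    by_cases hvX : v ∈ X
    · exact .inr (htw v hvX hva hvb)
    · exact .inl (hR v hvS hvT hvX)
  rcases X.eq_empty_or_nonempty with hX0 | ⟨x, hxX⟩
  · right
    have hR' := fun r hrS hrT => hR r hrS hrT (by simp [hX0])
    exact ⟨S, T, h, fun r hrS hrT => (hR' r hrS hrT).1, fun r hrS hrT => (hR' r hrS hrT).2⟩
  · left
    have hx := (hmem x).1 hxX
    exact riNumber_add_le_of_unique h hx.2.2.1 hx.2.2.2 hx.1 hx.2.1 fun v hvS hvT hvx =>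
      hR v hvS hvT fun hvX => hvx (Finset.card_le_one.1 hX1 v hvX x hxX)

end MutualPairs

section Covers

variable {V : Type*} {G : SimpleGraph V} {I K : Finset V}

lemma IsMutual.ne_one {f : V → ℕ} (h : IsMutual G I K) (hf : IsKRiDF G 2 f)
    (hfI : ∀ i ∈ I, f i = 1) {k : V} (hk : k ∈ K) : f k ≠ 1 := by
  obtain ⟨i, hi, hki⟩ := h.exists_adj k hk
  exact hf.ne_one hki (hfI i hi)

lemma IsCover.ne_one {f : V → ℕ} (h : IsCover G I K) (hf : IsKRiDF G 2 f)
    (hfI : ∀ i ∈ I, f i = 1) {v : V} (hv : v ∉ I) : f v ≠ 1 := by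
  by_cases hvK : v ∈ K
  · exact h.toIsMutual.ne_one hf hfI hvK
  · obtain ⟨i, hi, hri⟩ := h.exists_adj' v hv hvK
    exact hf.ne_one hri (hfI i hi)

lemma IsMutual.card_filter_eq_le_one {f : V → ℕ} (h : IsMutual G I K) (hf : IsKRiDF G 2 f) {c : ℕ}
    (hc : 1 ≤ c) (hc' : c ≤ 2) : (K.filter fun k => f k = c).card ≤ 1 := by
  refine Finset.card_le_one.2 fun a ha b hb => ?_
  rw [Finset.mem_filter] at ha hb
  by_contra hab
  exact hf.2.1 c hc hc' a b ha.2 hb.2 (h.clique a ha.1 b hb.1 hab)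

lemma IsCover.nonempty [Nonempty V] (h : IsCover G I K) : I.Nonempty := by
  obtain ⟨v⟩ := ‹Nonempty V›
  by_cases hvI : v ∈ I
  · exact ⟨v, hvI⟩
  by_cases hvK : v ∈ K
  · obtain ⟨i, hi, -⟩ := h.exists_adj v hvK
    exact ⟨i, hi⟩
  · obtain ⟨i, hi, -⟩ := h.exists_adj' v hvI hvK
    exact ⟨i, hi⟩

lemma IsCover.two_le_card [Nonempty V] (h : IsCover G I K) : 2 ≤ I.card := by
  obtain ⟨i, hi⟩ := h.nonempty
  obtain ⟨k, hk, hik⟩ := h.exists_not_adj i hi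
  obtain ⟨j, hj, hkj⟩ := h.exists_adj k hk
  exact Finset.one_lt_card.2 ⟨i, hi, j, hj, by rintro rfl; exact hik hkj.symm⟩

variable [Fintype V]

lemma IsMutual.exists_isKRiDF (h : IsMutual G I K) : ∃ f, IsKRiDF G 2 f ∧ ∀ i ∈ I, f i = 1 := by
  obtain ⟨f, hf, hfI, -⟩ := exists_isKRiDF_of_sets G I ∅ (by simp) h.indep (by simp)
  exact ⟨f, hf, hfI⟩

lemma IsMutual.exists_isKRiDF_of_notMem (h : IsMutual G I K) {x : V} (hx : x ∉ I) :
    ∃ f, IsKRiDF G 2 f ∧ (∀ i ∈ I, f i = 1) ∧ f x = 2 := by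
  obtain ⟨f, hf, hfI, hfx⟩ := exists_isKRiDF_of_sets G I {x} (by simpa using hx) h.indep
    (by simp)
  exact ⟨f, hf, hfI, hfx x rfl⟩

lemma IsCover.riWeight_add_card_clique_le {f : V → ℕ} (h : IsCover G I K) (hf : IsKRiDF G 2 f)
    (hfI : ∀ i ∈ I, f i = 1) : riWeight f + K.card ≤ Fintype.card V + 1 := by
  have h1 := riWeight_add_card_le (f := f) (K.filter fun k => ¬ f k = 2) fun k hk => by
    rw [Finset.mem_filter] at hk
    exact hf.eq_zero_of_ne (h.ne_one hf hfI fun hkI => h.notMem k hkI hk.1) hk.2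
  have h2 := h.card_filter_eq_le_one hf one_le_two le_rfl
  have h3 := K.card_filter_add_card_filter_not fun k => f k = 2
  omega

lemma IsCover.riNumber_add_card_clique_le (h : IsCover G I K) :
    riNumber G 2 + K.card ≤ Fintype.card V + 1 := by
  obtain ⟨f, hf, hfI⟩ := h.exists_isKRiDF
  have := h.riWeight_add_card_clique_le hf hfI
  have := riNumber_le hf
  omega

/-- The labellings `f` and `g` have at most one common nonzero vertex in each of the three parts;
so the bound holds if there is a common zero or one of the parts has no such vertex. -/
lemma IsCover.riNumber_add_le {f g : V → ℕ} (h : IsCover G I K) (hf : IsKRiDF G 2 f)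
    (hfI : ∀ i ∈ I, f i = 1) (hg : IsKRiDF Gᶜ 2 g) (hgK : ∀ k ∈ K, g k = 1)
    (hor : (∃ v, f v = 0 ∧ g v = 0) ∨ (∀ k ∈ K, f k ≠ 2) ∨ (∀ i ∈ I, g i ≠ 2) ∨
      ∀ r ∉ I, r ∉ K → f r ≠ 2 ∨ g r ≠ 2) :
    riNumber G 2 + riNumber Gᶜ 2 ≤ Fintype.card V + 2 := by
  set P := K.filter fun k => f k = 2 with hP
  set Q := I.filter fun i => g i = 2 with hQ
  set D := Finset.univ.filter fun r => r ∉ I ∧ r ∉ K ∧ f r = 2 ∧ g r = 2 with hD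
  have hP1 : P.card ≤ 1 := h.card_filter_eq_le_one hf one_le_two le_rfl
  have hQ1 : Q.card ≤ 1 := h.compl.card_filter_eq_le_one hg one_le_two le_rfl
  have hD1 : D.card ≤ 1 := by
    refine Finset.card_le_one.2 fun a ha b hb => ?_
    simp only [hD, Finset.mem_filter, Finset.mem_univ, true_and] at ha hb
    by_contra hab
    have h1 := hf.2.1 2 one_le_two le_rfl a b ha.2.2.1 hb.2.2.1
    exact hg.2.1 2 one_le_two le_rfl a b ha.2.2.2 hb.2.2.2 ⟨hab, h1⟩
  have hE : ∀ v ∉ P ∪ Q ∪ D, f v = 0 ∨ g v = 0 := by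
    intro v hv
    simp only [hP, hQ, hD, Finset.mem_union, Finset.mem_filter, Finset.mem_univ, true_and,
      not_or] at hv
    have hf2 := hf.1 v
    have hg2 := hg.1 v
    by_cases hvI : v ∈ I
    · have := h.compl.ne_one hg hgK (h.notMem v hvI)
      have := mt (And.intro hvI) hv.1.2
      omega
    have := h.ne_one hf hfI hvI
    by_cases hvK : v ∈ K
    · have := mt (And.intro hvK) hv.1.1
      omega
    have := h.compl.ne_one hg hgK hvK
    have : ¬ (f v = 2 ∧ g v = 2) := fun h => hv.2 ⟨hvI, hvK, h⟩
    omega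
  have hcard : (P ∪ Q ∪ D).card ≤ P.card + Q.card + D.card :=
    (Finset.card_union_le _ _).trans (Nat.add_le_add_right (Finset.card_union_le _ _) _)
  rcases hor with ⟨v, hv⟩ | hor | hor | hor
  · exact riNumber_add_riNumber_compl_le hf hg _ {v} hE (by simpa using hv)
      (by rw [Finset.card_singleton]; omega)
  · have hP0 : P = ∅ := Finset.filter_eq_empty_iff.2 fun k hk => hor k hk
    rw [hP0, Finset.card_empty] at hcard
    exact riNumber_add_riNumber_compl_le hf hg _ ∅ hE (by simp) (by simp [hP0] at *; omega)
  · have hQ0 : Q = ∅ := Finset.filter_eq_empty_iff.2 fun i hi => hor i hi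
    rw [hQ0, Finset.card_empty] at hcard
    exact riNumber_add_riNumber_compl_le hf hg _ ∅ hE (by simp) (by simp [hQ0] at *; omega)
  · have hD0 : D = ∅ := Finset.filter_eq_empty_iff.2 fun r _ hr => by
      have := hor r hr.1 hr.2.1
      tauto
    rw [hD0, Finset.card_empty] at hcard
    exact riNumber_add_riNumber_compl_le hf hg _ ∅ hE (by simp) (by simp [hD0] at *; omega)

lemma IsCover.riNumber_add_le_of_path (h : IsCover G I K) {c x y : V} (hcI : c ∉ I) (hcK : c ∉ K)
    (hxK : x ∉ K) (hyI : y ∉ I) (hyK : y ∉ K) (hcx : G.Adj c x) (hcy : G.Adj c y)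
    (hxy : ¬ G.Adj x y) (hne : x ≠ y) :
    riNumber G 2 + riNumber Gᶜ 2 ≤ Fintype.card V + 2 := by
  obtain ⟨f, hf, hfI, hfc⟩ := h.exists_isKRiDF_of_notMem hcI
  obtain ⟨g, hg, hgK, hgcx⟩ := exists_isKRiDF_of_sets Gᶜ K {c, x} (by simp [hcK, hxK])
    h.compl.indep (by
      rintro u (rfl | rfl) v (rfl | rfl) huv <;> simp [hcx, hcx.symm] at huv)
  refine h.riNumber_add_le hf hfI hg hgK (.inl ⟨y, ?_, ?_⟩)
  · exact hf.eq_zero_of_ne (h.ne_one hf hfI hyI) (hf.ne_two hcy.symm hfc)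
  · exact hg.eq_zero_of_ne (h.compl.ne_one hg hgK hyK)
      (hg.ne_two ⟨hne.symm, fun h => hxy h.symm⟩ (hgcx x (.inr rfl)))

/-- Unless the bound holds, the remaining vertices form a clique or an independent set. -/
lemma IsCover.riNumber_add_le_or (h : IsCover G I K) :
    riNumber G 2 + riNumber Gᶜ 2 ≤ Fintype.card V + 2 ∨
      (∀ x ∉ I, x ∉ K → ∀ y ∉ I, y ∉ K → x ≠ y → G.Adj x y) ∨
      ∀ x ∉ I, x ∉ K → ∀ y ∉ I, y ∉ K → ¬ G.Adj x y := by
  by_contra! hcon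
  obtain ⟨hlt, ⟨x, hxI, hxK, y, hyI, hyK, hxy, hnxy⟩, a, haI, haK, b, hbI, hbK, hab⟩ := hcon
  have path : ∀ c ∉ I, c ∉ K → ∀ u ∉ I, u ∉ K → ∀ v ∉ I, v ∉ K → u ≠ v → G.Adj c u →
      G.Adj c v → G.Adj u v := by
    intro c hcI hcK u huI huK v hvI hvK huv hcu hcv
    by_contra hn
    have := h.riNumber_add_le_of_path hcI hcK huK hvI hvK hcu hcv hn huv
    omega
  have copath : ∀ c ∉ I, c ∉ K → ∀ u ∉ I, u ∉ K → ∀ v ∉ I, v ∉ K → u ≠ v → c ≠ u → c ≠ v →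
      ¬ G.Adj c u → ¬ G.Adj c v → ¬ G.Adj u v := by
    intro c hcI hcK u huI huK v hvI hvK huv hcu' hcv' hcu hcv hn
    have := h.compl.riNumber_add_le_of_path hcK hcI huI hvK hvI ⟨hcu', hcu⟩ ⟨hcv', hcv⟩
      (fun h => h.2 hn) huv
    rw [compl_compl] at this
    omega
  have hab' := hab.ne
  by_cases hxa : x = a
  · subst hxa
    have hby : b ≠ y := by rintro rfl; exact hnxy hab
    by_cases hbyA : G.Adj b y
    · exact hnxy (path b hbI hbK x hxI hxK y hyI hyK hxy hab.symm hbyA)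
    · exact copath y hyI hyK x hxI hxK b hbI hbK hab' hxy.symm hby.symm (fun h => hnxy h.symm)
        (fun h => hbyA h.symm) hab
  by_cases hxA : G.Adj x a
  · have hay : a ≠ y := by rintro rfl; exact hnxy hxA
    by_cases hayA : G.Adj a y
    · exact hnxy (path a haI haK x hxI hxK y hyI hyK hxy hxA.symm hayA)
    · exact copath y hyI hyK x hxI hxK a haI haK hxa hxy.symm hay.symm (fun h => hnxy h.symm)
        (fun h => hayA h.symm) hxA
  · by_cases hxb : x = b
    · exact hxA (hxb ▸ hab.symm)
    by_cases hxB : G.Adj x b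
    · exact hxA (path b hbI hbK x hxI hxK a haI haK hxa hxB.symm hab.symm)
    · exact copath x hxI hxK a haI haK b hbI hbK hab' hxa hxb hxA hxB hab

lemma IsCover.riNumber_add_le_of_not_adj (h : IsCover G I K)
    (hR : ∀ x ∉ I, x ∉ K → ∀ y ∉ I, y ∉ K → x ≠ y → G.Adj x y) {i r : V} (hi : i ∈ I)
    (hrI : r ∉ I) (hrK : r ∉ K) (hir : ¬ G.Adj r i) :
    riNumber G 2 + riNumber Gᶜ 2 ≤ Fintype.card V + 2 := by
  obtain ⟨f, hf, hfI⟩ := h.exists_isKRiDF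
  obtain ⟨g, hg, hgK, hgi⟩ := h.compl.exists_isKRiDF_of_notMem (h.notMem i hi)
  refine h.riNumber_add_le hf hfI hg hgK ?_
  have hgr : g r = 0 := hg.eq_zero_of_ne (h.compl.ne_one hg hgK hrK)
    (hg.ne_two ⟨by rintro rfl; exact hrI hi, hir⟩ hgi)
  by_cases hfr : f r = 2
  · refine .inr (.inr (.inr fun s hsI hsK => ?_))
    by_cases hsr : s = r
    · right
      rw [hsr]
      omega
    · exact .inl (hf.ne_two (hR s hsI hsK r hrI hrK hsr) hfr)
  · exact .inl ⟨r, hf.eq_zero_of_ne (h.ne_one hf hfI hrI) hfr, hgr⟩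

lemma IsCover.riNumber_add_le_of_forall_adj (h : IsCover G I K) {k : V} (hk : k ∈ K)
    (hkR : ∀ r ∉ I, r ∉ K → G.Adj k r) :
    riNumber G 2 + riNumber Gᶜ 2 ≤ Fintype.card V + 2 := by
  obtain ⟨f, hf, hfI, hfk⟩ := h.exists_isKRiDF_of_notMem fun hkI => h.notMem k hkI hk
  obtain ⟨g, hg, hgK⟩ := h.compl.exists_isKRiDF
  exact h.riNumber_add_le hf hfI hg hgK (.inr (.inr (.inr fun r hrI hrK =>
    .inl (hf.ne_two (hkR r hrI hrK).symm hfk))))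

end Covers

section Clique

variable {V : Type*} [Fintype V]

/-- In the complement of a cover by `{i, j}` and `K` whose other vertices form a clique `R`, either
some 2RiDF has two zeros or there is an isolated edge. -/
lemma exists_two_zeros_or_isolated_edge {H : SimpleGraph V} {i j r₁ r₂ : V}
    {K R : Set V} (hij : i ≠ j) (hiR : i ∉ R) (hjR : j ∉ R) (hKR : Disjoint K R)
    (huniv : ∀ v, v = i ∨ v = j ∨ v ∈ K ∨ v ∈ R) (hR : ∀ x ∈ R, ∀ y ∈ R, ¬ H.Adj x y)
    (hK : ∀ x ∈ K, ∀ y ∈ K, ¬ H.Adj x y) (hi : ∀ x ∈ R, ¬ H.Adj x i)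
    (hj : ∀ x ∈ R, ¬ H.Adj x j) (hRK : ∀ x ∈ R, ∃ k ∈ K, H.Adj x k)
    (hKR' : ∀ k ∈ K, ∃ x ∈ R, H.Adj k x) (hiK : ∃ k ∈ K, H.Adj k i) (hjK : ∃ k ∈ K, H.Adj k j)
    (hK' : ∀ k ∈ K, H.Adj k i → ¬ H.Adj k j) (hr₁ : r₁ ∈ R) (hr₂ : r₂ ∈ R) (hr : r₁ ≠ r₂) :
    (∃ g, IsKRiDF H 2 g ∧ ∃ u v, u ≠ v ∧ g u = 0 ∧ g v = 0) ∨
      ∃ r ∈ R, ∃ k ∈ K, (∀ v, v ≠ k → ¬ H.Adj r v) ∧ ∀ v, v ≠ r → ¬ H.Adj k v := by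
  rw [Set.disjoint_left] at hKR
  by_contra! hcon
  obtain ⟨hzero, hiso⟩ := hcon
  obtain ⟨ki, hki, hkii⟩ := hiK
  obtain ⟨kj, hkj, hkjj⟩ := hjK
  obtain ⟨r, hrR, hkir⟩ := hKR' ki hki
  have hkij : ki ≠ kj := by rintro rfl; exact hK' _ hki hkii hkjj
  have hsame : ∀ x ∈ R, ∀ y ∈ R, ∀ k ∈ K, ∀ l ∈ K, H.Adj k i → H.Adj l j → H.Adj k x →
      H.Adj l y → x = y := by
    intro x hx y hy k hk l hl hki' hlj hkx hly
    by_contra hxy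
    obtain ⟨g, hg, hg1, hg2⟩ := exists_isKRiDF_of_sets H {i, y} {j, x} (by
      rw [Set.disjoint_left]
      rintro u (rfl | rfl) (hu | hu)
      · exact hij hu
      · exact hiR (hu ▸ hx)
      · exact hjR (hu ▸ hy)
      · exact hxy hu.symm) (by
      rintro u (rfl | rfl) v (rfl | rfl) huv
      · exact huv.ne rfl
      · exact hi _ hy huv.symm
      · exact hi _ hy huv
      · exact huv.ne rfl) (by
      rintro u (rfl | rfl) v (rfl | rfl) huv
      · exact huv.ne rfl
      · exact hj _ hx huv.symm
      · exact hj _ hx huv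
      · exact huv.ne rfl)
    exact hzero g hg k l (by rintro rfl; exact hK' _ hk hki' hlj)
      (hg.eq_zero hki' hkx (hg1 i (.inl rfl)) (hg2 x (.inr rfl)))
      (hg.eq_zero hly hlj (hg1 y (.inr rfl)) (hg2 j (.inl rfl)))
  obtain ⟨s, hsR, hkjs⟩ := hKR' kj hkj
  obtain rfl := hsame r hrR s hsR ki hki kj hkj hkii hkjj hkir hkjs
  have hri : r ≠ i := by rintro rfl; exact hiR hrR
  have hfar : ∀ r' ∈ R, r' ≠ r → ∀ k ∈ K, H.Adj r' k → ¬ H.Adj k i ∧ ¬ H.Adj k j := by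
    intro r' hr' hne k hk hrk
    exact ⟨fun h => hne (hsame r' hr' r hrR k hk kj hkj h hkjj hrk.symm hkjs),
      fun h => hne (hsame r hrR r' hr' ki hki k hk hkii h hkir hrk.symm).symm⟩
  have honly : ∀ r' ∈ R, r' ≠ r → ∀ k ∈ K, H.Adj r' k → ∀ x ∈ R, H.Adj k x → x = r' := by
    intro r' hr' hne k hk hrk x hx hkx
    by_contra hxr'
    have hr'i : r' ≠ i := by rintro rfl; exact hiR hr'
    obtain ⟨g, hg, hg1, hg2⟩ := exists_isKRiDF_of_sets H {i, r'} {r, x} (by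
      rw [Set.disjoint_left]
      rintro u (rfl | rfl) (hu | hu)
      · exact hri hu.symm
      · exact hiR (hu ▸ hx)
      · exact hne hu
      · exact hxr' hu.symm) (by
      rintro u (rfl | rfl) v (rfl | rfl) huv
      · exact huv.ne rfl
      · exact hi _ hr' huv.symm
      · exact hi _ hr' huv
      · exact huv.ne rfl) (by
      rintro u (rfl | rfl) v (rfl | rfl) huv
      · exact huv.ne rfl
      · exact hR _ hrR _ hx huv
      · exact hR _ hx _ hrR huv
      · exact huv.ne rfl)
    exact hzero g hg ki k (by rintro rfl; exact (hfar r' hr' hne _ hk hrk).1 hkii)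
      (hg.eq_zero hkii hkir (hg1 i (.inl rfl)) (hg2 r (.inl rfl)))
      (hg.eq_zero hrk.symm hkx (hg1 r' (.inr rfl)) (hg2 x (.inr rfl)))
  obtain ⟨r', hr', hne⟩ : ∃ r' ∈ R, r' ≠ r := by
    by_cases h : r₁ = r
    · exact ⟨r₂, hr₂, h ▸ hr.symm⟩
    · exact ⟨r₁, hr₁, h⟩
  obtain ⟨k, hk, hrk⟩ := hRK r' hr'
  have huniq : ∀ l ∈ K, H.Adj r' l → l = k := by
    intro l hl hrl
    by_contra hlk
    have hki' : ∀ m ∈ K, m ≠ i := by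
      rintro m hm rfl
      exact hK _ hki _ hm hkii
    obtain ⟨g, hg, hg1, hg2⟩ := exists_isKRiDF_of_sets H {i, k} {r, l} (by
      rw [Set.disjoint_left]
      rintro u (rfl | rfl) (hu | hu)
      · exact hri hu.symm
      · exact hki' l hl hu.symm
      · exact hKR hk (hu ▸ hrR)
      · exact hlk hu.symm) (by
      rintro u (rfl | rfl) v (rfl | rfl) huv
      · exact huv.ne rfl
      · exact (hfar r' hr' hne _ hk hrk).1 huv.symm
      · exact (hfar r' hr' hne _ hk hrk).1 huv
      · exact huv.ne rfl) (by
      rintro u (rfl | rfl) v (rfl | rfl) huv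
      · exact huv.ne rfl
      · exact hne (honly r' hr' hne _ hl hrl _ hrR huv.symm).symm
      · exact hne (honly r' hr' hne _ hl hrl _ hrR huv).symm
      · exact huv.ne rfl)
    exact hzero g hg ki r' (by rintro rfl; exact hKR hki hr')
      (hg.eq_zero hkii hkir (hg1 i (.inl rfl)) (hg2 r (.inl rfl)))
      (hg.eq_zero hrk hrl (hg1 k (.inr rfl)) (hg2 l (.inr rfl)))
  obtain ⟨v, hv, hkv⟩ := hiso r' hr' k hk fun v hvk hrv => by
    rcases huniv v with rfl | rfl | hv | hv
    · exact hi _ hr' hrv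
    · exact hj _ hr' hrv
    · exact hvk (huniq v hv hrv)
    · exact hR _ hr' _ hv hrv
  rcases huniv v with rfl | rfl | hvK | hvR
  · exact (hfar r' hr' hne k hk hrk).1 hkv
  · exact (hfar r' hr' hne k hk hrk).2 hkv
  · exact hK _ hk _ hvK hkv
  · exact hv (honly r' hr' hne k hk hrk v hvR hkv)

variable {G : SimpleGraph V} {I K : Finset V}

lemma riWeight_le_two_of_forall_eq_zero {f : V → ℕ} (u v : V)
    (h : ∀ w, w ≠ u → w ≠ v → f w = 0) : riWeight f ≤ 2 := by
  refine (riWeight_le_card {u, v} fun w hw => ?_).trans Finset.card_le_two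
  simp only [Finset.mem_insert, Finset.mem_singleton, not_or] at hw
  exact h w hw.1 hw.2

lemma exists_isKRiDF_pair (G : SimpleGraph V) {u v : V} (huv : u ≠ v) :
    ∃ f, IsKRiDF G 2 f ∧ f u = 1 ∧ f v = 2 := by
  obtain ⟨f, hf, hf1, hf2⟩ := exists_isKRiDF_of_sets G {u} {v} (by simpa using huv) (by simp)
    (by simp)
  exact ⟨f, hf, hf1 u rfl, hf2 v rfl⟩

lemma IsCover.riNumber_le_four (h : IsCover G I K)
    (hR : ∀ x ∉ I, x ∉ K → ∀ y ∉ I, y ∉ K → x ≠ y → G.Adj x y)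
    (hRI : ∀ x ∉ I, x ∉ K → ∀ i ∈ I, G.Adj x i) {r s : V} (hrI : r ∉ I) (hrK : r ∉ K)
    (hsI : s ∉ I) (hsK : s ∉ K) (hrs : r ≠ s) : riNumber G 2 ≤ 4 := by
  obtain ⟨f, hf, hfr, hfs⟩ := exists_isKRiDF_pair G hrs
  refine (riNumber_le hf).trans ((riWeight_le_card ({r, s} ∪ ((K.filter fun k => f k = 1) ∪
    K.filter fun k => f k = 2)) fun v hv => ?_).trans ?_)
  · simp only [Finset.mem_union, Finset.mem_insert, Finset.mem_singleton, Finset.mem_filter,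
      not_or] at hv
    by_cases hvK : v ∈ K
    · exact hf.eq_zero_of_ne (fun h => hv.2.1 ⟨hvK, h⟩) fun h => hv.2.2 ⟨hvK, h⟩
    by_cases hvI : v ∈ I
    · exact hf.eq_zero (hRI r hrI hrK v hvI).symm (hRI s hsI hsK v hvI).symm hfr hfs
    · exact hf.eq_zero (hR v hvI hvK r hrI hrK hv.1.1) (hR v hvI hvK s hsI hsK hv.1.2) hfr hfs
  · have h1 := h.card_filter_eq_le_one hf le_rfl one_le_two
    have h2 := h.card_filter_eq_le_one hf one_le_two le_rfl
    have h3 : ({r, s} : Finset V).card ≤ 2 := Finset.card_le_two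
    have h4 := Finset.card_union_le {r, s} ((K.filter fun k => f k = 1) ∪
      K.filter fun k => f k = 2)
    have h5 := Finset.card_union_le (K.filter fun k => f k = 1) (K.filter fun k => f k = 2)
    omega

lemma IsCover.riNumber_add_le_of_clique [Nonempty V] (h : IsCover G I K)
    (hR : ∀ x ∉ I, x ∉ K → ∀ y ∉ I, y ∉ K → x ≠ y → G.Adj x y) {r s : V} (hrI : r ∉ I)
    (hrK : r ∉ K) (hsI : s ∉ I) (hsK : s ∉ K) (hrs : r ≠ s) :
    riNumber G 2 + riNumber Gᶜ 2 ≤ Fintype.card V + 2 := by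
  by_cases hRI : ∀ x ∉ I, x ∉ K → ∀ i ∈ I, G.Adj x i
  swap
  · push Not at hRI
    obtain ⟨x, hxI, hxK, i, hi, hxi⟩ := hRI
    exact h.riNumber_add_le_of_not_adj hR hi hxI hxK hxi
  by_cases hKR : ∃ k ∈ K, ∀ x ∉ I, x ∉ K → G.Adj k x
  · obtain ⟨k, hk, hkR⟩ := hKR
    exact h.riNumber_add_le_of_forall_adj hk hkR
  push Not at hKR
  have h4 := h.riNumber_le_four hR hRI hrI hrK hsI hsK hrs
  have hI2 := h.two_le_card
  have hcompl := h.compl.riNumber_add_card_clique_le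
  rcases hI2.lt_or_eq with hI3 | hI2
  · omega
  obtain ⟨i, j, hij, rfl⟩ := Finset.card_eq_two.1 hI2.symm
  have hiI : i ∈ ({i, j} : Finset V) := by simp
  have hjI : j ∈ ({i, j} : Finset V) := by simp
  have hR' : ∀ v, v ∈ {v | v ∉ ({i, j} : Finset V) ∧ v ∉ K} ↔
    v ∉ ({i, j} : Finset V) ∧ v ∉ K := fun v => Iff.rfl
  have hout : ∀ i' ∈ ({i, j} : Finset V), ∃ k ∈ (K : Set V), Gᶜ.Adj k i' := by
    intro i' hi'
    obtain ⟨k, hk, hik⟩ := h.exists_not_adj i' hi'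
    exact ⟨k, hk, by rintro rfl; exact h.notMem _ hi' hk, fun h => hik h.symm⟩
  rcases exists_two_zeros_or_isolated_edge (H := Gᶜ) (K := K)
    (R := {v | v ∉ ({i, j} : Finset V) ∧ v ∉ K}) hij (fun h => h.1 hiI) (fun h => h.1 hjI)
    (Set.disjoint_left.2 fun v hv hv' => hv'.2 hv)
    (fun v => by
      rw [hR', Finset.mem_coe, Finset.mem_insert, Finset.mem_singleton]
      tauto)
    (fun x hx y hy hxy => hxy.2 (hR x hx.1 hx.2 y hy.1 hy.2 hxy.1))
    (fun x hx y hy hxy => hxy.2 (h.clique x hx y hy hxy.1))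
    (fun x hx hxi => hxi.2 (hRI x hx.1 hx.2 i hiI))
    (fun x hx hxj => hxj.2 (hRI x hx.1 hx.2 j hjI))
    (fun x hx => h.compl.exists_adj' x hx.2 hx.1)
    (fun k hk => by
      obtain ⟨x, hxI, hxK, hkx⟩ := hKR k hk
      exact ⟨x, ⟨hxI, hxK⟩, by rintro rfl; exact hxK hk, hkx⟩)
    (hout i hiI) (hout j hjI)
    (fun k hk hki hkj => by
      obtain ⟨i', hi', hki'⟩ := h.exists_adj k hk
      rw [Finset.mem_insert, Finset.mem_singleton] at hi'
      rcases hi' with rfl | rfl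
      · exact hki.2 hki'
      · exact hkj.2 hki')
    (r₁ := r) (r₂ := s) ⟨hrI, hrK⟩ ⟨hsI, hsK⟩ hrs with ⟨g, hg, u, v, huv, hu, hv⟩ |
      ⟨x, hx, k, hk, hxk, hkx⟩
  · have h1 := riWeight_add_card_le (f := g) {u, v} (by simp [hu, hv])
    rw [Finset.card_pair huv] at h1
    have := riNumber_le hg
    omega
  · obtain ⟨f, hf, hfx, hfk⟩ := exists_isKRiDF_pair G
      (show x ≠ k by rintro rfl; exact hx.2 hk)
    have h2 := riWeight_le_two_of_forall_eq_zero (f := f) x k fun w hwx hwk =>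
      hf.eq_zero (by simpa [hwx, hwx.symm, G.adj_comm] using hxk w hwk)
        (by simpa [hwk, hwk.symm, G.adj_comm] using hkx w hwx) hfx hfk
    have := riNumber_le hf
    have := riNumber_le_card Gᶜ
    omega

end Clique

section Cycle

variable {V : Type*} {G : SimpleGraph V} {I K : Finset V}

lemma IsCover.card_le_two_of_unique (h : IsCover G I K) (hI : 2 ≤ I.card)
    (hK : ∀ i ∈ I, ∀ k ∈ K, ∀ l ∈ K, ¬ G.Adj i k → ¬ G.Adj i l → k = l)
    (hI' : ∀ k ∈ K, ∀ i ∈ I, ∀ j ∈ I, G.Adj k i → G.Adj k j → i = j) : K.card ≤ 2 := by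
  obtain ⟨i, hi, j, hj, hij⟩ := Finset.one_lt_card.1 hI
  obtain ⟨k, hk, hik⟩ := h.exists_not_adj i hi
  obtain ⟨l, hl, hjl⟩ := h.exists_not_adj j hj
  refine (Finset.card_le_card fun m hm => ?_).trans (Finset.card_le_two (a := k) (b := l))
  rw [Finset.mem_insert, Finset.mem_singleton]
  by_contra! hcon
  refine hij (hI' m hm i hi j hj ?_ ?_)
  · by_contra hmi
    exact hcon.1 (hK i hi m hm k hk (fun h => hmi h.symm) hik)
  · by_contra hmj
    exact hcon.2 (hK j hj m hm l hl (fun h => hmj h.symm) hjl)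

lemma nonempty_iso_cycleGraph_five {a b c d e : V}
    (huniv : ∀ v, v = a ∨ v = b ∨ v = c ∨ v = d ∨ v = e) (hab : G.Adj a b) (hbc : G.Adj b c)
    (hcd : G.Adj c d) (hde : G.Adj d e) (hea : G.Adj e a) (hac : ¬ G.Adj a c) (hbd : ¬ G.Adj b d)
    (hce : ¬ G.Adj c e) (hda : ¬ G.Adj d a) (heb : ¬ G.Adj e b) :
    Nonempty (G ≃g SimpleGraph.cycleGraph 5) := by
  have hadj : ∀ x y : Fin 5, G.Adj (![a, b, c, d, e] x) (![a, b, c, d, e] y) ↔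
      (SimpleGraph.cycleGraph 5).Adj x y := by
    intro x y
    rw [SimpleGraph.cycleGraph_adj]
    fin_cases x <;> fin_cases y <;>
      simp [hab, hbc, hcd, hde, hea, hac, hbd, hce, hda, heb, hab.symm, hbc.symm, hcd.symm,
        hde.symm, hea.symm, mt SimpleGraph.Adj.symm hac, mt SimpleGraph.Adj.symm hbd,
        mt SimpleGraph.Adj.symm hce, mt SimpleGraph.Adj.symm hda, mt SimpleGraph.Adj.symm heb] <;> decide
  have hinj : Function.Injective ![a, b, c, d, e] := by
    intro x y hxy
    have hC : ∀ x y : Fin 5, (∀ z, (SimpleGraph.cycleGraph 5).Adj x z ↔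
        (SimpleGraph.cycleGraph 5).Adj y z) → x = y := by decide
    exact hC x y fun z => by rw [← hadj, ← hadj, hxy]
  have hsurj : Function.Surjective ![a, b, c, d, e] := by
    intro v
    rcases huniv v with rfl | rfl | rfl | rfl | rfl
    exacts [⟨0, rfl⟩, ⟨1, rfl⟩, ⟨2, rfl⟩, ⟨3, rfl⟩, ⟨4, rfl⟩]
  exact ⟨(RelIso.mk (Equiv.ofBijective _ ⟨hinj, hsurj⟩) (hadj _ _)).symm⟩

variable [Fintype V]

lemma IsCover.riNumber_add_le_of_two_adj [Nonempty V] (h : IsCover G I K) {r k i j : V}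
    (hrI : r ∉ I) (hrK : r ∉ K) (hr : ∀ x ∉ I, x ∉ K → x = r) (hRI : ∀ i ∈ I, G.Adj r i)
    (hRK : ∀ k ∈ K, ¬ G.Adj r k) (hk : k ∈ K) (hi : i ∈ I) (hj : j ∈ I) (hij : i ≠ j)
    (hki : G.Adj k i) (hkj : G.Adj k j) :
    riNumber G 2 + riNumber Gᶜ 2 ≤ Fintype.card V + 2 := by
  obtain ⟨l, hl, hlk⟩ := Finset.exists_mem_ne h.compl.two_le_card k
  obtain ⟨f, hf, hf1, hf2⟩ := exists_isKRiDF_of_sets G {r, l} {k} (by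
      rw [Set.disjoint_singleton_right]
      rintro (rfl | rfl)
      · exact hrK hk
      · exact hlk rfl) (by
      rintro u (rfl | rfl) v (rfl | rfl) huv
      · exact huv.ne rfl
      · exact hRK _ hl huv
      · exact hRK _ hl huv.symm
      · exact huv.ne rfl) (by simp)
  have hf1' : ∀ v ∈ I, f v ≠ 1 := fun v hv => hf.ne_one (hRI v hv).symm (hf1 r (.inl rfl))
  have hfk : f k = 2 := hf2 k rfl
  have hzero : ∀ v ∉ ({r, l, k} : Finset V) ∪ (I \ {i, j}), f v = 0 := by
    intro v hv
    simp only [Finset.mem_union, Finset.mem_insert, Finset.mem_singleton, Finset.mem_sdiff,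
      not_or, not_and, not_not] at hv
    by_cases hvI : v ∈ I
    · refine hf.eq_zero_of_ne (hf1' v hvI) ?_
      rcases or_iff_not_imp_left.2 (hv.2 hvI) with rfl | rfl
      · exact hf.ne_two hki.symm hfk
      · exact hf.ne_two hkj.symm hfk
    by_cases hvK : v ∈ K
    · exact hf.eq_zero (h.clique v hvK l hl hv.1.2.1) (h.clique v hvK k hk hv.1.2.2)
        (hf1 l (.inr rfl)) hfk
    · exact absurd (hr v hvI hvK) hv.1.1
  have h1 := riWeight_le_card _ hzero
  have h2 := Finset.card_union_le {r, l, k} (I \ {i, j})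
  have h3 : ({r, l, k} : Finset V).card ≤ 3 := Finset.card_le_three
  have h4 : (I \ {i, j}).card + 2 = I.card := by
    rw [← Finset.card_pair hij]
    exact Finset.card_sdiff_add_card_eq_card (by simp [Finset.insert_subset_iff, hi, hj])
  have h5 := h.compl.riNumber_add_card_clique_le
  have h6 := riNumber_le hf
  omega

lemma IsCover.riNumber_add_le_of_unique [Nonempty V] (h : IsCover G I K)
    (hnc : ¬ Nonempty (G ≃g SimpleGraph.cycleGraph 5)) {r : V} (hrI : r ∉ I) (hrK : r ∉ K)
    (hr : ∀ x ∉ I, x ∉ K → x = r) :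
    riNumber G 2 + riNumber Gᶜ 2 ≤ Fintype.card V + 2 := by
  by_cases hRI : ∀ i ∈ I, G.Adj r i
  swap
  · push Not at hRI
    obtain ⟨i, hi, hri⟩ := hRI
    exact h.riNumber_add_le_of_not_adj
      (fun x hxI hxK y hyI hyK hxy => absurd ((hr x hxI hxK).trans (hr y hyI hyK).symm) hxy)
      hi hrI hrK hri
  by_cases hRK : ∀ k ∈ K, ¬ G.Adj r k
  swap
  · push Not at hRK
    obtain ⟨k, hk, hrk⟩ := hRK
    exact h.riNumber_add_le_of_forall_adj hk fun x hxI hxK => hr x hxI hxK ▸ hrk.symm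
  by_cases hI : ∀ k ∈ K, ∀ i ∈ I, ∀ j ∈ I, G.Adj k i → G.Adj k j → i = j
  swap
  · push Not at hI
    obtain ⟨k, hk, i, hi, j, hj, hki, hkj, hij⟩ := hI
    exact h.riNumber_add_le_of_two_adj hrI hrK hr hRI hRK hk hi hj hij hki hkj
  have hne : ∀ i ∈ I, ∀ k ∈ K, i ≠ k := by
    rintro i hi _ hk rfl
    exact h.notMem i hi hk
  by_cases hK : ∀ i ∈ I, ∀ k ∈ K, ∀ l ∈ K, ¬ G.Adj i k → ¬ G.Adj i l → k = l
  swap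
  · push Not at hK
    obtain ⟨i, hi, k, hk, l, hl, hik, hil, hkl⟩ := hK
    have := h.compl.riNumber_add_le_of_two_adj hrK hrI (fun x hxK hxI => hr x hxI hxK)
      (fun k hk => ⟨by rintro rfl; exact hrK hk, hRK k hk⟩) (fun i hi h => h.2 (hRI i hi))
      hi hk hl hkl ⟨hne i hi k hk, hik⟩ ⟨hne i hi l hl, hil⟩
    rw [compl_compl] at this
    omega
  have hI2 := h.two_le_card
  have hK2 := h.compl.two_le_card
  have hK2' := h.card_le_two_of_unique hI2 hK hI
  have hI2' := h.compl.card_le_two_of_unique hK2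
    (fun k hk i hi j hj hki hkj => hI k hk i hi j hj
      (by simpa [(hne i hi k hk).symm] using hki) (by simpa [(hne j hj k hk).symm] using hkj))
    (fun i hi k hk l hl hik hil => hK i hi k hk l hl hik.2 hil.2)
  obtain ⟨i, hi⟩ := h.nonempty
  obtain ⟨l, hl, hil⟩ := h.exists_not_adj i hi
  obtain ⟨j, hj, hji⟩ := Finset.exists_mem_ne hI2 i
  obtain ⟨k, hk, hkl⟩ := Finset.exists_mem_ne hK2 l
  have hIeq : {i, j} = I := Finset.eq_of_subset_of_card_le
    (by simp [Finset.insert_subset_iff, hi, hj]) (by rwa [Finset.card_pair hji.symm])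
  have hKeq : {k, l} = K := Finset.eq_of_subset_of_card_le
    (by simp [Finset.insert_subset_iff, hk, hl]) (by rwa [Finset.card_pair hkl])
  have hik : G.Adj i k := by
    by_contra hik
    exact hkl (hK i hi k hk l hl hik hil)
  have hkj : ¬ G.Adj k j := fun hkj => hji (hI k hk j hj i hi hkj hik.symm)
  have hlj : G.Adj l j := by
    by_contra hlj
    exact hkl (hK j hj k hk l hl (fun h => hkj h.symm) fun h => hlj h.symm)
  refine absurd (nonempty_iso_cycleGraph_five (fun v => ?_) (hRI i hi) hik
    (h.clique k hk l hl hkl) hlj (hRI j hj).symm (hRK k hk) hil hkj (fun h => hRK l hl h.symm)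
    (h.indep j hj i hi)) hnc
  by_cases hvI : v ∈ I
  · rw [← hIeq, Finset.mem_insert, Finset.mem_singleton] at hvI
    tauto
  by_cases hvK : v ∈ K
  · rw [← hKeq, Finset.mem_insert, Finset.mem_singleton] at hvK
    tauto
  · exact .inl (hr v hvI hvK)

end Cycle

theorem stmt_9 {V : Type*} [Fintype V] (G : SimpleGraph V) (n : ℕ)
    (hcard : Fintype.card V = n) (hn : 2 ≤ n)
    (hnc : ¬ Nonempty (G ≃g SimpleGraph.cycleGraph 5)) :
    riNumber G 2 + riNumber Gᶜ 2 ≤ n + 2 := by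
  subst hcard
  have : Nonempty V := Fintype.card_pos_iff.1 (by omega)
  rcases riNumber_add_le_or_exists_isCover G with hle | ⟨I, K, h⟩
  · exact hle
  by_cases hr : ∃ r, r ∉ I ∧ r ∉ K
  swap
  · push Not at hr
    obtain ⟨f, hf, hfI⟩ := h.exists_isKRiDF
    obtain ⟨g, hg, hgK⟩ := h.compl.exists_isKRiDF
    exact h.riNumber_add_le hf hfI hg hgK
      (.inr (.inr (.inr fun r hrI hrK => absurd (hr r hrI) hrK)))
  obtain ⟨r, hrI, hrK⟩ := hr
  by_cases hs : ∀ s ∉ I, s ∉ K → s = r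
  · exact h.riNumber_add_le_of_unique hnc hrI hrK hs
  push Not at hs
  obtain ⟨s, hsI, hsK, hsr⟩ := hs
  rcases h.riNumber_add_le_or with hle | hR | hR
  · exact hle
  · exact h.riNumber_add_le_of_clique hR hrI hrK hsI hsK hsr.symm
  · have := h.compl.riNumber_add_le_of_clique
      (fun x hxK hxI y hyK hyI hxy => ⟨hxy, hR x hxI hxK y hyI hyK⟩) hrK hrI hsK hsI hsr.symm
    rw [compl_compl] at this
    omega
end

section
/- Let G be a graph of order n ≥ 3 that is not isomorphic to the 5-cycle C_5. Then 5 ≤ γ_ri2(G) + γ_ri2(Ḡ) ≤ n + 2, where Ḡ is the complement of G. -/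
open scoped Classical

namespace RainbowPair

variable {V : Type*} {G : SimpleGraph V}

/-- The two colour classes of a `2`-rainbow independent dominating function. -/
structure IsDomPair (G : SimpleGraph V) (A B : Finset V) : Prop where
  disj : ∀ v ∈ A, v ∉ B
  left : ∀ a ∈ A, ∀ b ∈ A, ¬ G.Adj a b
  right : ∀ a ∈ B, ∀ b ∈ B, ¬ G.Adj a b
  dom : ∀ v, v ∉ A → v ∉ B → (∃ a ∈ A, G.Adj v a) ∧ ∃ b ∈ B, G.Adj v b

/-- The colour classes of a `2`-rainbow independent dominating function of the complement,
described inside the graph itself. -/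
structure IsCliquePair (G : SimpleGraph V) (C D : Finset V) : Prop where
  disj : ∀ v ∈ C, v ∉ D
  left : ∀ a ∈ C, ∀ b ∈ C, a ≠ b → G.Adj a b
  right : ∀ a ∈ D, ∀ b ∈ D, a ≠ b → G.Adj a b
  dom : ∀ v, v ∉ C → v ∉ D → (∃ c ∈ C, ¬ G.Adj v c) ∧ ∃ d ∈ D, ¬ G.Adj v d

lemma IsCliquePair.isDomPair_compl {C D : Finset V} (h : IsCliquePair G C D) :
    IsDomPair Gᶜ C D where
  disj := h.disj
  left a ha b hb := by
    have := h.left a ha b hb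
    rw [SimpleGraph.compl_adj]; tauto
  right a ha b hb := by
    have := h.right a ha b hb
    rw [SimpleGraph.compl_adj]; tauto
  dom v hC hD := by
    obtain ⟨⟨c, hc, hvc⟩, d, hd, hvd⟩ := h.dom v hC hD
    exact ⟨⟨c, hc, (G.compl_adj _ _).2 ⟨fun e => hC (e ▸ hc), hvc⟩⟩,
      d, hd, (G.compl_adj _ _).2 ⟨fun e => hD (e ▸ hd), hvd⟩⟩

lemma IsDomPair.isCliquePair {C D : Finset V} (h : IsDomPair Gᶜ C D) :
    IsCliquePair G C D where
  disj := h.disj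
  left a ha b hb hab := by
    have := h.left a ha b hb
    rw [SimpleGraph.compl_adj] at this; tauto
  right a ha b hb hab := by
    have := h.right a ha b hb
    rw [SimpleGraph.compl_adj] at this; tauto
  dom v hC hD := by
    obtain ⟨⟨c, hc, hvc⟩, d, hd, hvd⟩ := h.dom v hC hD
    exact ⟨⟨c, hc, ((G.compl_adj _ _).1 hvc).2⟩, d, hd, ((G.compl_adj _ _).1 hvd).2⟩

lemma card_inter_le_one {A C : Finset V} (hA : ∀ a ∈ A, ∀ b ∈ A, ¬ G.Adj a b)
    (hC : ∀ a ∈ C, ∀ b ∈ C, a ≠ b → G.Adj a b) : (A ∩ C).card ≤ 1 := by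
  rw [Finset.card_le_one]
  intro a ha b hb
  rw [Finset.mem_inter] at ha hb
  by_contra hab
  exact hA a ha.1 b hb.1 (hC a ha.2 b hb.2 hab)

section Extension

variable [Fintype V]

lemma exists_maximal_independent (G : SimpleGraph V) (S T : Finset V)
    (hd : ∀ v ∈ S, v ∉ T) (hS : ∀ a ∈ S, ∀ b ∈ S, ¬ G.Adj a b) :
    ∃ A, S ⊆ A ∧ (∀ v ∈ A, v ∉ T) ∧ (∀ a ∈ A, ∀ b ∈ A, ¬ G.Adj a b) ∧
      ∀ v, v ∉ A → v ∉ T → ∃ a ∈ A, G.Adj v a := by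
  obtain ⟨A, hSA, hA⟩ := Finite.exists_le_maximal (a := S)
    (p := fun A : Finset V => (∀ v ∈ A, v ∉ T) ∧ ∀ a ∈ A, ∀ b ∈ A, ¬ G.Adj a b) ⟨hd, hS⟩
  refine ⟨A, hSA, hA.prop.1, hA.prop.2, fun v hv hvT => ?_⟩
  by_contra! hcon
  have hins : insert v A ≤ A := hA.2 (by
    refine ⟨by simpa [hvT] using hA.prop.1, ?_⟩
    simp only [Finset.mem_insert]
    rintro a (rfl | ha) b (rfl | hb)
    · exact G.irrefl
    · exact hcon b hb
    · exact fun h => hcon a ha h.symm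
    · exact hA.prop.2 a ha b hb) (Finset.subset_insert v A)
  exact hv (hins (Finset.mem_insert_self v A))

lemma exists_isDomPair (G : SimpleGraph V) (S T : Finset V)
    (hd : ∀ v ∈ S, v ∉ T) (hS : ∀ a ∈ S, ∀ b ∈ S, ¬ G.Adj a b)
    (hT : ∀ a ∈ T, ∀ b ∈ T, ¬ G.Adj a b) :
    ∃ A B, S ⊆ A ∧ T ⊆ B ∧ IsDomPair G A B := by
  obtain ⟨A, hSA, hAT, hA, hA'⟩ := exists_maximal_independent G S T hd hS
  obtain ⟨B, hTB, hBA, hB, hB'⟩ := exists_maximal_independent G T A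
    (fun v hv hvA => hAT v hvA hv) hT
  exact ⟨A, B, hSA, hTB, ⟨fun v hv hvB => hBA v hvB hv, hA, hB, fun v hvA hvB =>
    ⟨hA' v hvA fun h => hvB (hTB h), hB' v hvB hvA⟩⟩⟩

lemma exists_isCliquePair (G : SimpleGraph V) (P Q : Finset V)
    (hd : ∀ v ∈ P, v ∉ Q) (hP : ∀ a ∈ P, ∀ b ∈ P, a ≠ b → G.Adj a b)
    (hQ : ∀ a ∈ Q, ∀ b ∈ Q, a ≠ b → G.Adj a b) :
    ∃ C D, P ⊆ C ∧ Q ⊆ D ∧ IsCliquePair G C D := by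
  obtain ⟨C, D, hC, hD, h⟩ := exists_isDomPair Gᶜ P Q hd
    (fun a ha b hb => by have := hP a ha b hb; rw [SimpleGraph.compl_adj]; tauto)
    (fun a ha b hb => by have := hQ a ha b hb; rw [SimpleGraph.compl_adj]; tauto)
  exact ⟨C, D, hC, hD, h.isCliquePair⟩

end Extension

section Critical

variable [Fintype V]

/-- The numerical consequences of `γ_ri2(G) + γ_ri2(Gᶜ) ≥ n + 3`, in a form that is symmetric
under complementation. -/
structure IsCritical (G : SimpleGraph V) (z w : ℕ) : Prop where
  card : z + w + 3 = Fintype.card V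
  le_dom : ∀ A B, IsDomPair G A B → w + 3 ≤ A.card + B.card
  le_clique : ∀ C D, IsCliquePair G C D → z + 3 ≤ C.card + D.card

variable {z w : ℕ}

lemma IsCritical.compl (h : IsCritical G z w) : IsCritical Gᶜ w z where
  card := by have := h.card; omega
  le_dom C D hCD := h.le_clique C D hCD.isCliquePair
  le_clique A B hAB := h.le_dom A B (by simpa using hAB.isDomPair_compl)

/-- `X` is a set of vertices that are forced to have value `0` once the vertices of `S` have
value `1` and those of `T` have value `2`. -/
structure Forces (G : SimpleGraph V) (S T X : Finset V) : Prop where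
  disj : ∀ v ∈ S, v ∉ T
  left : ∀ a ∈ S, ∀ b ∈ S, ¬ G.Adj a b
  right : ∀ a ∈ T, ∀ b ∈ T, ¬ G.Adj a b
  dom_left : ∀ x ∈ X, ∃ s ∈ S, G.Adj x s
  dom_right : ∀ x ∈ X, ∃ t ∈ T, G.Adj x t
  notMem : ∀ x ∈ X, x ∉ S ∧ x ∉ T

lemma Forces.exists_isDomPair {S T X : Finset V} (h : Forces G S T X) :
    ∃ A B, IsDomPair G A B ∧ ∀ x ∈ X, x ∉ A ∧ x ∉ B := by
  obtain ⟨A, B, hA, hB, hAB⟩ := RainbowPair.exists_isDomPair G S T h.disj h.left h.right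
  refine ⟨A, B, hAB, fun x hx => ⟨fun hxA => ?_, fun hxB => ?_⟩⟩
  · obtain ⟨s, hs, hxs⟩ := h.dom_left x hx
    exact hAB.left x hxA s (hA hs) hxs
  · obtain ⟨t, ht, hxt⟩ := h.dom_right x hx
    exact hAB.right x hxB t (hB ht) hxt

lemma card_add_card_add_card_le {A B X : Finset V} (hd : ∀ v ∈ A, v ∉ B)
    (hX : ∀ x ∈ X, x ∉ A ∧ x ∉ B) : A.card + B.card + X.card ≤ Fintype.card V := by
  have h1 : Disjoint A B := Finset.disjoint_left.2 hd
  have h2 : Disjoint (A ∪ B) X := by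
    rw [Finset.disjoint_right]
    intro x hx
    simpa using hX x hx
  rw [← Finset.card_union_of_disjoint h1, ← Finset.card_union_of_disjoint h2]
  exact Finset.card_le_univ _

lemma IsCritical.card_le (h : IsCritical G z w) {S T X : Finset V} (hf : Forces G S T X) :
    X.card ≤ z := by
  obtain ⟨A, B, hAB, hX⟩ := hf.exists_isDomPair
  have h1 := card_add_card_add_card_le hAB.disj hX
  have h2 := h.le_dom A B hAB
  have h3 := h.card
  omega

lemma card_add_le_of_isDomPair_of_isCliquePair {A B C D X : Finset V} (hAB : IsDomPair G A B)
    (hCD : IsCliquePair G C D) (h1 : ∀ x ∈ X, x ∉ A ∧ x ∉ B) (h2 : ∀ x ∈ X, x ∉ C ∧ x ∉ D) :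
    A.card + B.card + C.card + D.card + X.card ≤ Fintype.card V + 4 := by
  have hAB' : (A ∪ B).card = A.card + B.card :=
    Finset.card_union_of_disjoint (Finset.disjoint_left.2 hAB.disj)
  have hCD' : (C ∪ D).card = C.card + D.card :=
    Finset.card_union_of_disjoint (Finset.disjoint_left.2 hCD.disj)
  have hcap : ((A ∪ B) ∩ (C ∪ D)).card ≤ 4 := by
    have e : (A ∪ B) ∩ (C ∪ D) = ((A ∩ C) ∪ (A ∩ D)) ∪ ((B ∩ C) ∪ (B ∩ D)) := by
      ext; simp; tauto
    have := card_inter_le_one hAB.left hCD.left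
    have := card_inter_le_one hAB.left hCD.right
    have := card_inter_le_one hAB.right hCD.left
    have := card_inter_le_one hAB.right hCD.right
    have := Finset.card_union_le (A ∩ C) (A ∩ D)
    have := Finset.card_union_le (B ∩ C) (B ∩ D)
    have := Finset.card_union_le ((A ∩ C) ∪ (A ∩ D)) ((B ∩ C) ∪ (B ∩ D))
    rw [e]; omega
  have hcup := Finset.card_union_add_card_inter (A ∪ B) (C ∪ D)
  have hX : Disjoint ((A ∪ B) ∪ (C ∪ D)) X := by
    rw [Finset.disjoint_right]
    intro x hx
    have := h1 x hx
    have := h2 x hx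
    simp; tauto
  have := Finset.card_le_univ (((A ∪ B) ∪ (C ∪ D)) ∪ X)
  rw [Finset.card_union_of_disjoint hX] at this
  omega

lemma IsCritical.card_add_card_le (h : IsCritical G z w) {S T X C D : Finset V}
    (hf : Forces G S T X) (hCD : IsCliquePair G C D) (hX : ∀ x ∈ X, x ∉ C ∧ x ∉ D) :
    C.card + D.card + X.card ≤ z + 4 := by
  obtain ⟨A, B, hAB, hX'⟩ := hf.exists_isDomPair
  have := card_add_le_of_isDomPair_of_isCliquePair hAB hCD hX' hX
  have := h.le_dom A B hAB
  have := h.card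
  omega

lemma IsCritical.card_le_one (h : IsCritical G z w) {S T X C D : Finset V}
    (hf : Forces G S T X) (hCD : IsCliquePair G C D) (hX : ∀ x ∈ X, x ∉ C ∧ x ∉ D) :
    X.card ≤ 1 := by
  have := h.card_add_card_le hf hCD hX
  have := h.le_clique C D hCD
  omega

/-- Two vertices outside a clique pair have at most one common neighbour. -/
lemma IsCritical.eq_of_common (h : IsCritical G z w) {C D : Finset V}
    (hCD : IsCliquePair G C D) {x y s t : V} (hx : x ∉ C ∧ x ∉ D) (hy : y ∉ C ∧ y ∉ D)
    (hxy : x ≠ y) (hxs : G.Adj x s) (hxt : G.Adj x t) (hys : G.Adj y s) (hyt : G.Adj y t) :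
    s = t := by
  by_contra hst
  have hf : Forces G {s} {t} {x, y} := by
    constructor <;> simp [hxs, hxt, hys, hyt, hst, hxs.ne, hxt.ne, hys.ne, hyt.ne]
  have := h.card_le_one hf hCD (by simp [hx, hy])
  rw [Finset.card_pair hxy] at this
  omega

/-- Two vertices cannot be forced to be `0` both by independent sets and by cliques. -/
lemma IsCritical.eq_of_forces (h : IsCritical G z w) {a b s t x y : V} (hst : s ≠ t) (hab : a ≠ b)
    (hxs : G.Adj x s) (hxt : G.Adj x t) (hys : G.Adj y s) (hyt : G.Adj y t)
    (hxa : ¬ G.Adj x a) (hxb : ¬ G.Adj x b) (hya : ¬ G.Adj y a) (hyb : ¬ G.Adj y b)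
    (hne : x ≠ a ∧ x ≠ b ∧ y ≠ a ∧ y ≠ b) : x = y := by
  by_contra hxy
  obtain ⟨C, D, hC, hD, hCD⟩ := exists_isCliquePair G {a} {b} (by simpa using hab)
    (by simp) (by simp)
  simp only [Finset.singleton_subset_iff] at hC hD
  have key : ∀ v, ¬ G.Adj v a → ¬ G.Adj v b → v ≠ a → v ≠ b → v ∉ C ∧ v ∉ D :=
    fun v h1 h2 h3 h4 => ⟨fun hv => h1 (hCD.left v hv a hC h3),
      fun hv => h2 (hCD.right v hv b hD h4)⟩
  exact hst (h.eq_of_common hCD (key x hxa hxb hne.1 hne.2.1) (key y hya hyb hne.2.2.1 hne.2.2.2)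
    hxy hxs hxt hys hyt)

/-- Any two vertices have at least `z + 1` neighbours between them. -/
lemma IsCritical.lt_card_nbrs (h : IsCritical G z w) {u v : V} (huv : u ≠ v) {N : Finset V}
    (hN : ∀ x, x ≠ u → x ≠ v → G.Adj u x ∨ G.Adj v x → x ∈ N) : z + 1 ≤ N.card := by
  have hf : Forces Gᶜ {u} {v} ({u, v} ∪ N)ᶜ := by
    constructor
    · simpa using huv
    · simp
    · simp
    all_goals
      intro x hx
      simp only [Finset.mem_compl, Finset.mem_union, Finset.mem_insert, Finset.mem_singleton,
        not_or] at hx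
      have := hN x hx.1.1 hx.1.2
      have := G.adj_comm u x
      have := G.adj_comm v x
      simp [SimpleGraph.compl_adj]
      tauto
  have h1 := h.compl.card_le hf
  have h2 := Finset.card_union_le {u, v} N
  rw [Finset.card_compl] at h1
  rw [Finset.card_pair huv] at h2
  have := h.card
  omega

end Critical

section Pentagon

/-- `x, a, t, s, b` are the consecutive vertices of a cycle that is all of `G`. -/
structure IsPentagon (G : SimpleGraph V) (x a t s b : V) : Prop where
  mem : ∀ v, v = x ∨ v = a ∨ v = t ∨ v = s ∨ v = b
  xa : G.Adj x a
  at' : G.Adj a t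
  ts : G.Adj t s
  sb : G.Adj s b
  bx : G.Adj b x
  xt : x ≠ t ∧ ¬ G.Adj x t
  xs : x ≠ s ∧ ¬ G.Adj x s
  as' : a ≠ s ∧ ¬ G.Adj a s
  ab : a ≠ b ∧ ¬ G.Adj a b
  tb : t ≠ b ∧ ¬ G.Adj t b

lemma IsPentagon.of_compl {x a t s b : V} (h : IsPentagon Gᶜ x a t s b) :
    IsPentagon G x t b a s := by
  obtain ⟨h1, h2, h3, h4, h5, h6, h7, h8, h9, h10, h11⟩ := h
  simp only [SimpleGraph.compl_adj] at *
  refine ⟨fun v => ?_, ?_, ?_, ?_, ?_, ?_, ?_, ?_, ?_, ?_, ?_⟩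
  · have := h1 v
    tauto
  all_goals grind [SimpleGraph.adj_comm]

lemma IsPentagon.nonempty_iso {x a t s b : V} (h : IsPentagon G x a t s b) :
    Nonempty (G ≃g SimpleGraph.cycleGraph 5) := by
  obtain ⟨h1, h2, h3, h4, h5, h6, h7, h8, h9, h10, h11⟩ := h
  have hbij : Function.Bijective ![x, a, t, s, b] := by
    constructor
    · intro i j hij
      have := h2.ne
      have := h3.ne
      have := h4.ne
      have := h5.ne
      have := h6.ne
      fin_cases i <;> fin_cases j <;> simp at hij ⊢ <;> grind
    · intro v
      rcases h1 v with rfl | rfl | rfl | rfl | rfl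
      exacts [⟨0, rfl⟩, ⟨1, rfl⟩, ⟨2, rfl⟩, ⟨3, rfl⟩, ⟨4, rfl⟩]
  refine ⟨SimpleGraph.Iso.symm ⟨Equiv.ofBijective _ hbij, fun {i j} => ?_⟩⟩
  have := G.adj_comm
  fin_cases i <;> fin_cases j <;>
    simp [SimpleGraph.cycleGraph_adj, h2, h3, h4, h5, h6, h7, h8, h9, h10, h11, h2.symm, h3.symm,
      h4.symm, h5.symm, h6.symm] <;> grind

variable [Fintype V] {z w : ℕ}

lemma IsCritical.zero_lt_left (h : IsCritical G z w) : 0 < z := by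
  by_contra! hz
  obtain rfl : z = 0 := by omega
  have h3 : 3 ≤ Fintype.card V := by have := h.card; omega
  have hdeg : ∀ {u p q : V}, G.Adj u p → G.Adj u q → p = q := by
    intro u p q hp hq
    by_contra hpq
    have hf : Forces G {p} {q} {u} := by
      constructor <;> simp [hp, hq, hpq, hp.ne, hq.ne]
    simpa using h.card_le hf
  have hpair : ∀ u v : V, u ≠ v → ∃ x, x ≠ u ∧ x ≠ v ∧ (G.Adj x u ∨ G.Adj x v) := by
    intro u v huv
    by_contra! hcon
    have := h.le_clique {u} {v} ⟨by simpa using huv, by simp, by simp, fun x hx hy => by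
      simp at hx hy ⊢
      exact hcon x hx hy⟩
    simp at this
  obtain ⟨u, v, -, huv, -, -⟩ := Fintype.two_lt_card_iff.1 (show 2 < Fintype.card V by omega)
  obtain ⟨x, -, -, hx⟩ := hpair u v huv
  obtain ⟨p, q, hpq⟩ : ∃ p q, G.Adj p q := by
    rcases hx with hx | hx
    exacts [⟨_, _, hx⟩, ⟨_, _, hx⟩]
  obtain ⟨y, hyp, hyq, hy | hy⟩ := hpair p q hpq.ne
  · exact hyq (hdeg hy.symm hpq)
  · exact hyp (hdeg hy.symm hpq.symm)

lemma IsCritical.exists_nbr (h : IsCritical G z w) {u v : V} (huv : u ≠ v) (c : V) :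
    ∃ s, s ≠ u ∧ s ≠ v ∧ s ≠ c ∧ (G.Adj u s ∨ G.Adj v s) := by
  by_contra! hcon
  have := h.lt_card_nbrs huv (N := {c}) (by
    intro x hxu hxv hx
    by_contra hxc
    have := hcon x hxu hxv (by simpa using hxc)
    tauto)
  have := h.zero_lt_left
  rw [Finset.card_singleton] at *
  omega

lemma IsCritical.eq_of_adj (h : IsCritical G 1 w) {u v p q : V} (huv : u ≠ v)
    (hup : G.Adj u p) (huq : G.Adj u q) (hvp : G.Adj v p) (hvq : G.Adj v q) : p = q := by
  have hf : Forces G {u} {v} {p, q} := by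
    constructor <;> simp [huv, hup.symm, huq.symm, hvp.symm, hvq.symm, hup.ne', huq.ne', hvp.ne',
      hvq.ne']
  have := h.card_le hf
  by_contra hpq
  rw [Finset.card_pair hpq] at this
  omega

lemma IsCritical.eq_of_forces_one (h : IsCritical G 1 w) {S T : Finset V} {x y : V}
    (hf : Forces G S T {x, y}) : x = y := by
  have := h.card_le hf
  by_contra hxy
  rw [Finset.card_pair hxy] at this
  omega

lemma IsCritical.not_triangle (h : IsCritical G 1 w) {a b c : V} (hab : G.Adj a b)
    (hbc : G.Adj b c) (hac : G.Adj a c) : False := by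
  have core : ∀ {a b c s t : V}, G.Adj a b → G.Adj b c → G.Adj a c → G.Adj a s → G.Adj b t →
      s ≠ b → s ≠ c → t ≠ a → t ≠ c → False := by
    intro a b c s t hab hbc hac has hbt hsb hsc hta htc
    have e1 : ¬ G.Adj b s := fun hbs => hsc (h.eq_of_adj hab.ne has hac hbs hbc)
    have e2 : ¬ G.Adj s t := fun hst => hta
      (h.eq_of_adj hsb hst has.symm hbt hab.symm)
    refine hab.ne (h.eq_of_forces_one (S := {c}) (T := {s, t}) ?_)
    have := has.ne
    have := hbt.ne
    constructor <;> simp <;> grind [SimpleGraph.adj_comm, SimpleGraph.Adj.ne]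
  obtain ⟨s, hsa, hsb, hsc, hs⟩ := h.exists_nbr hab.ne c
  wlog has : G.Adj a s generalizing a b
  · exact this hab.symm hac hbc hsb hsa hs.symm (by tauto)
  obtain ⟨t, htb, htc, hta, ht | ht⟩ := h.exists_nbr hbc.ne a
  · exact core hab hbc hac has ht hsb hsc hta htc
  · exact core hac hbc.symm hab has ht hsc hsb hta htb

lemma IsCritical.exists_isPentagon (h : IsCritical G 1 w) :
    ∃ x a t s b, IsPentagon G x a t s b := by
  have h5 : 4 ≤ Fintype.card V := by have := h.card; omega
  have hsymm : ∀ {u v}, G.Adj u v ↔ G.Adj v u := fun {u v} => G.adj_comm u v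
  have tri : ∀ {a b c}, G.Adj a b → G.Adj b c → ¬ G.Adj a c :=
    fun h1 h2 h3 => h.not_triangle h1 h2 h3
  -- a vertex with two neighbours
  obtain ⟨x, a, b, hxa, hxb, hab⟩ : ∃ x a b, G.Adj x a ∧ G.Adj x b ∧ a ≠ b := by
    obtain ⟨u, v, -, huv, -, -⟩ := Fintype.two_lt_card_iff.1 (show 2 < Fintype.card V by omega)
    obtain ⟨s, hsu, hsv, -, hs⟩ := h.exists_nbr huv u
    obtain ⟨p, q, hpq⟩ : ∃ p q, G.Adj p q := by
      rcases hs with hx | hx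
      exacts [⟨_, _, hx⟩, ⟨_, _, hx⟩]
    obtain ⟨s, hsp, hsq, -, hs | hs⟩ := h.exists_nbr hpq.ne p
    · exact ⟨p, q, s, hpq, hs, hsq.symm⟩
    · exact ⟨q, p, s, hpq.symm, hs, hsp.symm⟩
  have hne : ∀ {a b}, G.Adj x a → G.Adj x b → a ≠ b → ∃ t, t ≠ x ∧ G.Adj a t := by
    intro a b hxa hxb hab
    by_contra! hcon
    have := h.le_clique {a} {x, b} ⟨by simp [hab, hxa.ne'], by simp, by
      simp [hxb, hxb.symm], fun v hva hvx => by
        simp at hva hvx ⊢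
        refine ⟨fun hh => hcon v hvx.1 hh.symm, ?_⟩
        have := tri (a := v) (b := x) (c := b)
        tauto⟩
    have h2 := Finset.card_le_two (a := x) (b := b)
    simp only [Finset.card_singleton] at this
    omega
  obtain ⟨t, htx, hat⟩ := hne hxa hxb hab
  obtain ⟨s, hsx, hbs⟩ := hne hxb hxa hab.symm
  have hab' : ¬ G.Adj a b := tri hxa.symm hxb
  have htb : ¬ G.Adj t b := fun hh => htx (h.eq_of_adj hab hat hxa.symm hh.symm hxb.symm)
  have hsa : ¬ G.Adj s a := fun hh => hsx (h.eq_of_adj hab hh.symm hxa.symm hbs hxb.symm)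
  have hts' : t ≠ s := by rintro rfl; exact htb hbs.symm
  have hts : G.Adj t s := by
    by_contra hts
    refine hab (h.eq_of_forces_one (S := {x}) (T := {t, s}) ?_)
    constructor <;> simp <;> grind [SimpleGraph.adj_comm, SimpleGraph.Adj.ne]
  have hxt : ¬ G.Adj x t := tri hxa hat
  have hxs : ¬ G.Adj x s := tri hxb hbs
  -- no vertex outside the cycle is adjacent to it
  have hout : ∀ {x a t s b v : V}, G.Adj x a → G.Adj a t → G.Adj t s → G.Adj s b → G.Adj b x →
      a ≠ b → x ≠ t → x ≠ s → t ≠ b → a ≠ s →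
      v ≠ x → v ≠ a → v ≠ t → v ≠ s → v ≠ b → ¬ G.Adj x v := by
    intro x a t s b v h1 h2 h3 h4 h5 n1 n2 n3 n4 n5 m1 m2 m3 m4 m5 hv
    have e1 : ¬ G.Adj v t := fun hh => m2 (h.eq_of_adj n2 hv h1 hh.symm h2.symm)
    have e2 := tri h5 h1
    have e3 : ¬ G.Adj x s := tri h5.symm h4.symm
    have e4 := tri h5 hv
    have e5 := tri h3 h4
    refine n3 (h.eq_of_forces_one (S := {v, t}) (T := {b}) ?_)
    constructor <;> simp <;> grind [SimpleGraph.adj_comm, SimpleGraph.Adj.ne]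
  refine ⟨x, a, t, s, b, ⟨fun v => ?_, hxa, hat, hts, hbs.symm, hxb.symm, ⟨htx.symm, hxt⟩,
    ⟨hsx.symm, hxs⟩, ⟨?_, fun hh => hsa hh.symm⟩, ⟨hab, hab'⟩, ⟨?_, htb⟩⟩⟩
  · by_contra! hv
    have nas : a ≠ s := by rintro rfl; exact hab' hbs.symm
    have ntb : t ≠ b := by rintro rfl; exact hab' hat
    have hN : ∀ v, v ≠ x → v ≠ a → v ≠ t → v ≠ s → v ≠ b →
        ¬ G.Adj x v ∧ ¬ G.Adj a v ∧ ¬ G.Adj b v ∧ ¬ G.Adj t v ∧ ¬ G.Adj s v := by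
      intro v m1 m2 m3 m4 m5
      refine ⟨hout hxa hat hts hbs.symm hxb.symm hab htx.symm hsx.symm ntb nas m1 m2 m3 m4 m5,
        hout hat hts hbs.symm hxb.symm hxa htx nas hab hsx ntb m2 m3 m4 m5 m1,
        hout hxb.symm hxa hat hts hbs.symm hsx.symm hab.symm ntb.symm nas htx.symm m5 m1 m2 m3 m4,
        hout hts hbs.symm hxb.symm hxa hat nas.symm ntb htx hab.symm hsx m3 m4 m5 m1 m2,
        hout hbs.symm hxb.symm hxa hat hts ntb.symm hsx nas.symm htx.symm hab.symm
          m4 m5 m1 m2 m3⟩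
    obtain ⟨p, hpv, -, hp⟩ : ∃ p, p ≠ v ∧ p ≠ v ∧ G.Adj v p := by
      by_contra! hcon
      have := h.le_clique {v} {x, a} ⟨by simp [hv], by simp, by
        simp [hxa, hxa.symm], fun u hu1 hu2 => by
          simp at hu1 hu2 ⊢
          refine ⟨fun hh => hcon u hu1 hu1 hh.symm, ?_⟩
          have := tri (a := u) (b := x) (c := a)
          tauto⟩
      have h2 := Finset.card_le_two (a := x) (b := a)
      simp only [Finset.card_singleton] at this
      omega
    have hout' : ∀ {v p}, G.Adj v p → v ≠ x ∧ v ≠ a ∧ v ≠ t ∧ v ≠ s ∧ v ≠ b →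
        p ≠ x ∧ p ≠ a ∧ p ≠ t ∧ p ≠ s ∧ p ≠ b := by
      rintro v p hp ⟨m1, m2, m3, m4, m5⟩
      have := hN v m1 m2 m3 m4 m5
      grind [SimpleGraph.adj_comm]
    obtain ⟨p, q, r, hp, hpq, hpr, hqr⟩ : ∃ p q r, (p ≠ x ∧ p ≠ a ∧ p ≠ t ∧ p ≠ s ∧ p ≠ b) ∧
        G.Adj p q ∧ G.Adj p r ∧ q ≠ r := by
      obtain ⟨s, hsv, hsp, -, hs | hs⟩ := h.exists_nbr hp.ne p
      · exact ⟨v, p, s, hv, hp, hs, hsp.symm⟩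
      · exact ⟨p, v, s, hout' hp hv, hp.symm, hs, hsv.symm⟩
    have hq := hout' hpq hp
    have hr := hout' hpr hp
    have k1 := hN q hq.1 hq.2.1 hq.2.2.1 hq.2.2.2.1 hq.2.2.2.2
    have k2 := hN r hr.1 hr.2.1 hr.2.2.1 hr.2.2.2.1 hr.2.2.2.2
    have hqr' := tri hpq.symm hpr
    refine hp.1.symm (h.eq_of_forces_one (S := {a, q}) (T := {b, r}) ?_)
    constructor <;> simp <;> grind [SimpleGraph.adj_comm, SimpleGraph.Adj.ne]
  · rintro rfl; exact hab' hbs.symm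
  · rintro rfl; exact hab' hat

end Pentagon

section Exact

variable [Fintype V] {z w : ℕ}

lemma IsCritical.card_common_le (h : IsCritical G z w) {u v : V} (huv : u ≠ v) {N : Finset V}
    (hN : ∀ x ∈ N, G.Adj u x ∧ G.Adj v x) : N.card ≤ z := by
  refine h.card_le (S := {u}) (T := {v}) ⟨by simpa using huv, by simp, by simp, ?_, ?_, ?_⟩
  · intro x hx
    simpa using (hN x hx).1.symm
  · intro x hx
    simpa using (hN x hx).2.symm
  · intro x hx
    simpa using ⟨(hN x hx).1.ne', (hN x hx).2.ne'⟩

lemma IsCritical.not_subsingleton_nbrs (h : IsCritical G 2 2) {y : V}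
    (hy : ∀ s t, G.Adj y s → G.Adj y t → s = t) : False := by
  have h7 : Fintype.card V = 7 := by have := h.card; omega
  obtain ⟨x, hxy, hx⟩ : ∃ x, x ≠ y ∧ ∀ c, G.Adj y c → c = x := by
    by_cases hh : ∃ x, G.Adj y x
    · obtain ⟨x, hx⟩ := hh
      exact ⟨x, hx.ne', fun c hc => hy c x hc hx⟩
    · have : Nontrivial V := Fintype.one_lt_card_iff_nontrivial.1 (by omega)
      obtain ⟨x, hx⟩ := exists_ne y
      exact ⟨x, hx, fun c hc => (hh ⟨c, hc⟩).elim⟩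
  obtain ⟨C, D, hC, hD, hCD⟩ := exists_isCliquePair G {y} {x} (by simpa using hxy.symm)
    (by simp) (by simp)
  simp only [Finset.singleton_subset_iff] at hC hD
  obtain rfl : C = {y} := by
    refine Finset.eq_singleton_iff_unique_mem.2 ⟨hC, fun c hc => ?_⟩
    by_contra hcy
    have := hx c (hCD.left y hC c hc (Ne.symm hcy))
    exact hCD.disj c hc (this ▸ hD)
  have hyD : y ∉ D := hCD.disj y hC
  have hcl := hCD.right
  have h4 : 4 ≤ D.card := by
    have := h.le_clique _ _ hCD
    rw [Finset.card_singleton] at this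
    omega
  have hcom : ∀ u ∈ D, ∀ v ∈ D, u ≠ v → ∀ p, p ∉ D → G.Adj p u → ¬ G.Adj p v := by
    intro u hu v hv huv p hp hpu hpv
    have := h.card_common_le huv (N := insert p ((D.erase u).erase v)) (by
      intro x hx
      simp only [Finset.mem_insert, Finset.mem_erase] at hx
      rcases hx with rfl | hx
      · exact ⟨hpu.symm, hpv.symm⟩
      · exact ⟨hcl u hu x hx.2.2 hx.2.1.symm, hcl v hv x hx.2.2 hx.1.symm⟩)
    rw [Finset.card_insert_of_notMem (by simp [hp]),
      Finset.card_erase_of_mem (by simp [hv, huv.symm]),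
      Finset.card_erase_of_mem hu] at this
    omega
  have h4' : D.card = 4 := by
    obtain ⟨u, hu⟩ : (D.erase x).Nonempty := by
      rw [← Finset.card_pos, Finset.card_erase_of_mem hD]; omega
    rw [Finset.mem_erase] at hu
    have := h.card_common_le hu.1 (N := (D.erase u).erase x) (by
      intro v hv
      simp only [Finset.mem_erase] at hv
      exact ⟨hcl u hu.2 v hv.2.2 hv.2.1.symm, hcl x hD v hv.2.2 hv.1.symm⟩)
    rw [Finset.card_erase_of_mem (by simp [hD, hu.1.symm]),
      Finset.card_erase_of_mem hu.2] at this
    omega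
  have hrest : ((insert y D)ᶜ).card = 2 := by
    rw [Finset.card_compl, Finset.card_insert_of_notMem hyD]
    omega
  obtain ⟨p, q, hpq, hrest⟩ := Finset.card_eq_two.1 hrest
  have hmem : ∀ v, v = y ∨ v ∈ D ∨ v = p ∨ v = q := by
    intro v
    have : v ∈ (insert y D)ᶜ ↔ v = p ∨ v = q := by rw [hrest]; simp
    simp at this
    tauto
  have hp : p ≠ y ∧ p ∉ D := by
    have : p ∈ (insert y D)ᶜ := by rw [hrest]; simp
    simpa using this
  have hq : q ≠ y ∧ q ∉ D := by
    have : q ∈ (insert y D)ᶜ := by rw [hrest]; simp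
    simpa using this
  have hstep : ∀ p q, p ≠ y → p ∉ D → (∀ v, v = y ∨ v ∈ D ∨ v = p ∨ v = q) →
      G.Adj p q ∧ G.Adj y x ∧ ∃ u ∈ D, u ≠ x ∧ G.Adj p u := by
    intro p q hpy hpD hmem
    by_contra hcon
    obtain ⟨u, hu⟩ : ∃ u, ∀ v ∈ D, G.Adj p v → v = u := by
      by_cases hh : ∃ u ∈ D, G.Adj p u
      · obtain ⟨u, hu, hpu⟩ := hh
        refine ⟨u, fun v hv hpv => ?_⟩
        by_contra hvu
        exact hcom u hu v hv (Ne.symm hvu) p hpD hpu hpv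
      · exact ⟨y, fun v hv hpv => (hh ⟨v, hv, hpv⟩).elim⟩
    have hsub : ∃ r s, ∀ v, v ≠ y → v ≠ p → G.Adj y v ∨ G.Adj p v → v = r ∨ v = s := by
      have h1 : ∀ v, v ≠ y → v ≠ p → G.Adj y v ∨ G.Adj p v → v = x ∨ v = q ∨ v = u := by
        intro v h1 h2 h3
        have := hx v
        have := hmem v
        have := hu v
        tauto
      by_cases k1 : G.Adj p q
      · by_cases k2 : G.Adj y x
        · by_cases k3 : u ∈ D ∧ u ≠ x ∧ G.Adj p u
          · exact (hcon ⟨k1, k2, u, k3.1, k3.2.1, k3.2.2⟩).elim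
          · refine ⟨x, q, fun v v1 v2 v3 => ?_⟩
            grind
        · exact ⟨u, q, fun v v1 v2 v3 => by grind⟩
      · exact ⟨u, x, fun v v1 v2 v3 => by grind⟩
    obtain ⟨r, s, hrs⟩ := hsub
    have := h.lt_card_nbrs hpy.symm (N := {r, s}) (by simpa using hrs)
    have := Finset.card_le_two (a := r) (b := s)
    omega
  obtain ⟨hpq', hyx, u, huD, hux, hpu⟩ := hstep p q hp.1 hp.2 hmem
  obtain ⟨-, -, v, hvD, hvx, hqv⟩ := hstep q p hq.1 hq.2 (fun v => by have := hmem v; tauto)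
  have hyu : ∀ v ∈ D, v ≠ x → ¬ G.Adj y v := fun v _ hvx hv => hvx (hx v hv)
  by_cases huv : u = v
  · subst huv
    have : ((D.erase x).erase u).card = 2 := by
      rw [Finset.card_erase_of_mem (by simp [huD, hux]), Finset.card_erase_of_mem hD]
      omega
    obtain ⟨a, b, hab, hab'⟩ := Finset.card_eq_two.1 this
    have ha : a ≠ u ∧ a ≠ x ∧ a ∈ D := by
      have : a ∈ (D.erase x).erase u := by rw [hab']; simp
      simpa using this
    have hb : b ≠ u ∧ b ≠ x ∧ b ∈ D := by
      have : b ∈ (D.erase x).erase u := by rw [hab']; simp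
      simpa using this
    have hf : Forces G {y, u} {p, a} {x, b, q} := by
      have := hcom u huD a ha.2.2 ha.1.symm p hp.2 hpu
      constructor <;> simp <;> grind [SimpleGraph.adj_comm, SimpleGraph.Adj.ne]
    have := h.card_le hf
    rw [Finset.card_eq_three.2 ⟨x, b, q, hb.2.1.symm, fun e => hq.2 (e ▸ hD),
      fun e => hq.2 (e ▸ hb.2.2), rfl⟩] at this
    omega
  · have := h.le_clique {p, q} {x, y} ⟨by
      simp; grind, by simp [hpq', hpq'.symm], by simp [hyx, hyx.symm], fun t ht1 ht2 => by
        have h1 := hmem t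
        have h2 := hcom u huD t
        have h3 := hcom v hvD t
        simp at ht1 ht2 ⊢
        grind [SimpleGraph.adj_comm]⟩
    have := Finset.card_le_two (a := p) (b := q)
    have := Finset.card_le_two (a := x) (b := y)
    omega

lemma IsCritical.card_add_card_eq (h : IsCritical G z w) (hz : 2 ≤ z)
    (hw : 3 ≤ w ∨ z = 2 ∧ w = 2) {C D : Finset V} (hCD : IsCliquePair G C D) :
    C.card + D.card = z + 3 := by
  by_contra hne
  have h1 := h.le_clique C D hCD
  have h2 : C.card + D.card ≤ z + 4 := by
    simpa using h.card_add_card_le (S := ∅) (T := ∅) (X := ∅) (by constructor <;> simp) hCD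
      (by simp)
  have hdeg : ∀ y, y ∉ C → y ∉ D → ∀ s t, G.Adj y s → G.Adj y t → s = t := by
    intro y hyC hyD s t hs ht
    by_contra hst
    have := h.card_add_card_le (S := {s}) (T := {t}) (X := {y})
      (by constructor <;> simp [hs, ht, hst, hs.ne, ht.ne]) hCD (by simp [hyC, hyD])
    rw [Finset.card_singleton] at this
    omega
  have hY : (C ∪ D)ᶜ.card = w - 1 := by
    rw [Finset.card_compl, Finset.card_union_of_disjoint (Finset.disjoint_left.2 hCD.disj)]
    have := h.card
    omega
  have hmem : ∀ y ∈ (C ∪ D)ᶜ, ∀ s t, G.Adj y s → G.Adj y t → s = t := by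
    intro y hy
    simp at hy
    exact hdeg y hy.1 hy.2
  rcases hw with hw | ⟨rfl, rfl⟩
  · obtain ⟨y, hy, y', hy', hyy⟩ := Finset.one_lt_card.1 (show 1 < (C ∪ D)ᶜ.card by omega)
    have := h.lt_card_nbrs hyy (N := G.neighborFinset y ∪ G.neighborFinset y') (by simp)
    have h3 := Finset.card_union_le (G.neighborFinset y) (G.neighborFinset y')
    have h4 : ∀ y ∈ (C ∪ D)ᶜ, (G.neighborFinset y).card ≤ 1 := fun y hy =>
      Finset.card_le_one.2 fun s hs t ht => hmem y hy s t (by simpa using hs) (by simpa using ht)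
    have := h4 y hy
    have := h4 y' hy'
    omega
  · obtain ⟨y, hy⟩ : (C ∪ D)ᶜ.Nonempty := by rw [← Finset.card_pos]; omega
    exact h.not_subsingleton_nbrs (hmem y hy)

end Exact

section LargeGap

variable [Fintype V] {z w : ℕ} {C : Finset V}

/-- A maximum clique of a critical graph whose clique pairs all have the least possible size. -/
structure IsSetting (G : SimpleGraph V) (z w : ℕ) (C : Finset V) : Prop where
  crit : IsCritical G z w
  card_add : ∀ P Q, IsCliquePair G P Q → P.card + Q.card = z + 3
  clique : ∀ a ∈ C, ∀ b ∈ C, a ≠ b → G.Adj a b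
  max : ∀ R : Finset V, (∀ a ∈ R, ∀ b ∈ R, a ≠ b → G.Adj a b) → R.card ≤ C.card

lemma exists_isSetting (h : IsCritical G z w)
    (hex : ∀ P Q, IsCliquePair G P Q → P.card + Q.card = z + 3) : ∃ C, IsSetting G z w C := by
  obtain ⟨C, hC, hmax⟩ := Finset.exists_max_image
    (Finset.univ.filter fun R : Finset V => ∀ a ∈ R, ∀ b ∈ R, a ≠ b → G.Adj a b)
    Finset.card ⟨∅, by simp⟩
  simp only [Finset.mem_filter, Finset.mem_univ, true_and] at hC hmax
  exact ⟨C, h, hex, hC, hmax⟩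

namespace IsSetting

lemma extend (h : IsSetting G z w C) {R : Finset V} (hCR : ∀ r ∈ R, r ∉ C)
    (hR : ∀ a ∈ R, ∀ b ∈ R, a ≠ b → G.Adj a b) : ∃ Q, R ⊆ Q ∧ IsCliquePair G C Q := by
  obtain ⟨C', Q, hC, hQ, hCQ⟩ := exists_isCliquePair G C R (fun v hv hvR => hCR v hvR hv)
    h.clique hR
  obtain rfl := Finset.eq_of_subset_of_card_le hC (h.max C' hCQ.left)
  exact ⟨Q, hQ, hCQ⟩

lemma card_add_le (h : IsSetting G z w C) {R : Finset V} (hCR : ∀ r ∈ R, r ∉ C)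
    (hR : ∀ a ∈ R, ∀ b ∈ R, a ≠ b → G.Adj a b) : C.card + R.card ≤ z + 3 := by
  obtain ⟨Q, hRQ, hCQ⟩ := h.extend hCR hR
  have := Finset.card_le_card hRQ
  have := h.card_add _ _ hCQ
  omega

lemma card_le (h : IsSetting G z w C) (hz : 2 ≤ z) (hw : 2 ≤ w) : C.card ≤ z + 1 := by
  by_contra! hcon
  have hn := h.crit.card
  have hcompl : Cᶜ.card = z + w + 3 - C.card := by rw [Finset.card_compl, hn]
  have hle : C.card ≤ z + 3 := by simpa using h.card_add_le (R := ∅) (by simp) (by simp)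
  have hle' : C.card ≤ z + 2 := by
    obtain ⟨v, hv⟩ : Cᶜ.Nonempty := by rw [← Finset.card_pos]; omega
    have := h.card_add_le (R := {v}) (by simpa using hv) (by simp)
    rw [Finset.card_singleton] at this
    omega
  obtain ⟨u, hu, v, hv, huv⟩ := Finset.one_lt_card.1 (show 1 < Cᶜ.card by omega)
  rw [Finset.mem_compl] at hu hv
  have hind : ∀ u, u ∉ C → ∀ v, v ∉ C → ¬ G.Adj u v := by
    intro u hu v hv huv
    have := h.card_add_le (R := {u, v}) (by simp [hu, hv]) (by simp [huv, huv.symm])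
    rw [Finset.card_pair huv.ne] at this
    omega
  have hone : ∀ v, v ∉ C → (G.neighborFinset v).card ≤ 1 := by
    intro v hv
    refine Finset.card_le_one.2 fun s hs t ht => ?_
    rw [SimpleGraph.mem_neighborFinset] at hs ht
    by_contra hst
    have hsC : s ∈ C := by by_contra hsC; exact hind v hv s hsC hs
    have htC : t ∈ C := by by_contra htC; exact hind v hv t htC ht
    have := h.crit.card_common_le hst (N := insert v ((C.erase s).erase t)) (by
      intro x hx
      simp only [Finset.mem_insert, Finset.mem_erase] at hx
      rcases hx with rfl | ⟨h1, h2, h3⟩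
      · exact ⟨hs.symm, ht.symm⟩
      · exact ⟨h.clique s hsC x h3 h2.symm, h.clique t htC x h3 h1.symm⟩)
    rw [Finset.card_insert_of_notMem (by simp [hv]),
      Finset.card_erase_of_mem (by simp [htC, Ne.symm hst]), Finset.card_erase_of_mem hsC] at this
    omega
  have h1 := h.crit.lt_card_nbrs huv (N := G.neighborFinset u ∪ G.neighborFinset v) (by simp)
  have h2 := Finset.card_union_le (G.neighborFinset u) (G.neighborFinset v)
  have h3 := hone u hu
  have h4 := hone v hv
  omega

end IsSetting

/-- No three mutually adjacent vertices lie outside a clique pair. -/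
lemma IsCritical.not_triangle_of_isCliquePair (h : IsCritical G z w) (hz : 3 ≤ z)
    {D : Finset V} (hCD : IsCliquePair G C D) {x y t : V} (hx : x ∉ C ∧ x ∉ D)
    (hy : y ∉ C ∧ y ∉ D) (ht : t ∉ C ∧ t ∉ D) (hxy : G.Adj x y) (hyt : G.Adj y t)
    (hxt : G.Adj x t) : False := by
  have hcom : ∀ {x y s t : V}, x ∉ C ∧ x ∉ D → y ∉ C ∧ y ∉ D → x ≠ y →
      G.Adj x s → G.Adj x t → G.Adj y s → G.Adj y t → s = t :=
    fun hx hy hxy h1 h2 h3 h4 => h.eq_of_common hCD hx hy hxy h1 h2 h3 h4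
  have hadj : ∀ {x y t p q : V}, x ∉ C ∧ x ∉ D → y ∉ C ∧ y ∉ D → t ∉ C ∧ t ∉ D →
      G.Adj x y → G.Adj y t → G.Adj x t → G.Adj x p → G.Adj y q →
      p ≠ y → p ≠ t → q ≠ x → q ≠ t → G.Adj p q := by
    intro x y t p q hx hy ht hxy hyt hxt hp hq p1 p2 q1 q2
    by_contra hpq
    have h1 := hcom hx ht hxt.ne hp hxy
    have h2 := hcom hy ht hyt.ne hq hxy.symm
    have := h.card_le_one (S := {t}) (T := {p, q}) (X := {x, y}) (by
      constructor <;> simp <;> grind [SimpleGraph.adj_comm, SimpleGraph.Adj.ne]) hCD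
      (by simp [hx, hy])
    rw [Finset.card_pair hxy.ne] at this
    omega
  have hcore : ∀ {x y t p q : V}, x ∉ C ∧ x ∉ D → y ∉ C ∧ y ∉ D → t ∉ C ∧ t ∉ D →
      G.Adj x y → G.Adj y t → G.Adj x t → G.Adj x p → G.Adj x q →
      p ≠ y → p ≠ t → q ≠ y → q ≠ t → p = q := by
    intro x y t p q hx hy ht hxy hyt hxt hp hq p1 p2 q1 q2
    have hcard := h.lt_card_nbrs hyt.ne
      (N := insert x (((G.neighborFinset y ∪ G.neighborFinset t) \ {x, y, t}))) (by
        intro v v1 v2 v3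
        simp
        tauto)
    have h1 := Finset.card_insert_le x ((G.neighborFinset y ∪ G.neighborFinset t) \ {x, y, t})
    obtain ⟨r, hr, s, hs, hrs⟩ := Finset.one_lt_card.1
      (show 1 < ((G.neighborFinset y ∪ G.neighborFinset t) \ {x, y, t}).card by omega)
    have hall : ∀ r ∈ (G.neighborFinset y ∪ G.neighborFinset t) \ {x, y, t},
        G.Adj p r ∧ G.Adj q r := by
      intro r hr
      simp at hr
      obtain ⟨hr | hr, r1, r2, r3⟩ := hr
      · exact ⟨hadj hx hy ht hxy hyt hxt hp hr p1 p2 r1 r3,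
          hadj hx hy ht hxy hyt hxt hq hr q1 q2 r1 r3⟩
      · exact ⟨hadj hx ht hy hxt hyt.symm hxy hp hr p2 p1 r1 r2,
          hadj hx ht hy hxt hyt.symm hxy hq hr q2 q1 r1 r2⟩
    have hno : ∀ p, G.Adj x p → p ≠ y → p ≠ t → ¬ G.Adj p y ∧ ¬ G.Adj p t := by
      intro p hp p1 p2
      exact ⟨fun hpy => p2 (hcom hx hy hxy.ne hp hxt hpy.symm hyt),
        fun hpt => p1 (hcom hx ht hxt.ne hp hxy hpt.symm hyt.symm)⟩
    exact h.eq_of_forces hrs hyt.ne (hall r hr).1 (hall s hs).1 (hall r hr).2 (hall s hs).2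
      (hno p hp p1 p2).1 (hno p hp p1 p2).2 (hno q hq q1 q2).1 (hno q hq q1 q2).2
      ⟨p1, p2, q1, q2⟩
  have h1 : (G.neighborFinset x \ {y, t}).card ≤ 1 := Finset.card_le_one.2 fun p hp q hq => by
    simp at hp hq
    exact hcore hx hy ht hxy hyt hxt hp.1 hq.1 hp.2.1 hp.2.2 hq.2.1 hq.2.2
  have h2 : (G.neighborFinset y \ {x, t}).card ≤ 1 := Finset.card_le_one.2 fun p hp q hq => by
    simp at hp hq
    exact hcore hy hx ht hxy.symm hxt hyt hp.1 hq.1 hp.2.1 hp.2.2 hq.2.1 hq.2.2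
  have h3 := h.lt_card_nbrs hxy.ne
    (N := insert t ((G.neighborFinset x \ {y, t}) ∪ (G.neighborFinset y \ {x, t}))) (by
      intro v v1 v2 v3
      simp
      tauto)
  have h4 := Finset.card_insert_le t ((G.neighborFinset x \ {y, t}) ∪ (G.neighborFinset y \ {x, t}))
  have h5 := Finset.card_union_le (G.neighborFinset x \ {y, t}) (G.neighborFinset y \ {x, t})
  omega

lemma IsSetting.card_eq (h : IsSetting G z w C) (hz : 2 ≤ z) (hw : 2 ≤ w) : C.card = z + 1 := by
  by_contra hne
  have hle := h.card_le hz hw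
  obtain ⟨D, -, hCD⟩ := h.extend (R := ∅) (by simp) (by simp)
  have hsum := h.card_add C D hCD
  have hDC := h.max D hCD.right
  set K := C.filter fun c => ∀ d ∈ D, G.Adj c d with hK
  have hmK : ∀ c, c ∈ K ↔ c ∈ C ∧ ∀ d ∈ D, G.Adj c d := by simp [hK]
  have hDK : Disjoint D K := Finset.disjoint_left.2 fun d hd hdK =>
    hCD.disj d ((hmK d).1 hdK).1 hd
  have hDKcl : ∀ a ∈ D ∪ K, ∀ b ∈ D ∪ K, a ≠ b → G.Adj a b := by
    intro a ha b hb hab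
    have h1 := h.clique a
    have h2 := hCD.right a
    simp only [Finset.mem_union, hmK] at ha hb
    grind [SimpleGraph.adj_comm]
  have hKle : D.card + K.card ≤ C.card := by
    rw [← Finset.card_union_of_disjoint hDK]
    exact h.max _ hDKcl
  have hcom : ∀ {x y s t : V}, x ∉ C ∧ x ∉ D → y ∉ C ∧ y ∉ D → x ≠ y →
      G.Adj x s → G.Adj x t → G.Adj y s → G.Adj y t → s = t :=
    fun hx hy hxy h1 h2 h3 h4 => h.crit.eq_of_common hCD hx hy hxy h1 h2 h3 h4
  have hind : ∀ {x y : V}, x ∉ C ∧ x ∉ D → y ∉ C ∧ y ∉ D → ¬ G.Adj x y := by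
    intro x y hx hy hxy
    obtain ⟨Q, hQ, hCQ⟩ := h.extend (R := {x, y}) (by simp [hx, hy]) (by simp [hxy, hxy.symm])
    have hsumQ := h.card_add C Q hCQ
    have hxQ : x ∈ Q := hQ (by simp)
    have hyQ : y ∈ Q := hQ (by simp)
    have hcard : ((Q.erase x).erase y).card = Q.card - 2 := by
      rw [Finset.card_erase_of_mem (by simp [hyQ, hxy.ne']), Finset.card_erase_of_mem hxQ]
      omega
    have hle1 : ((Q.erase x).erase y).card ≤ 1 := Finset.card_le_one.2 fun p hp q hq => by
      simp at hp hq
      have k := hCQ.right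
      exact hcom hx hy hxy.ne (k x hxQ p hp.2.2 (Ne.symm hp.2.1))
        (k x hxQ q hq.2.2 (Ne.symm hq.2.1))
        (k y hyQ p hp.2.2 (Ne.symm hp.1)) (k y hyQ q hq.2.2 (Ne.symm hq.1))
    obtain ⟨u, hu⟩ : ((Q.erase x).erase y).Nonempty := by rw [← Finset.card_pos]; omega
    simp at hu
    have hxu := hCQ.right x hxQ u hu.2.2 (Ne.symm hu.2.1)
    have hyu := hCQ.right y hyQ u hu.2.2 (Ne.symm hu.1)
    have huC : u ∉ C := fun huC => hCQ.disj u huC hu.2.2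
    by_cases huD : u ∈ D
    · have hpair : IsCliquePair G {x, y} (D ∪ K) := by
        refine ⟨?_, by simp [hxy, hxy.symm], hDKcl, ?_⟩
        · intro v hv
          simp only [Finset.mem_union, hmK]
          simp at hv
          grind
        · intro v hv1 hv2
          simp only [Finset.mem_union, hmK] at hv2
          simp only [Finset.mem_insert, Finset.mem_singleton, not_or] at hv1
          constructor
          · by_contra! hcon
            have := hcom hx hy hxy.ne hxu (hcon x (by simp)).symm hyu (hcon y (by simp)).symm
            subst this
            exact hv2 (.inl huD)
          · have hvD : v ∉ D := fun hh => hv2 (.inl hh)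
            obtain ⟨d, hd, hvd⟩ : ∃ d ∈ D, ¬ G.Adj v d := by
              by_cases hvC : v ∈ C
              · by_contra! hcon
                exact hv2 (.inr ⟨hvC, hcon⟩)
              · exact (hCD.dom v hvC hvD).2
            exact ⟨d, Finset.mem_union_left _ hd, hvd⟩
      have := h.card_add _ _ hpair
      rw [Finset.card_pair hxy.ne, Finset.card_union_of_disjoint hDK] at this
      omega
    · exact h.crit.not_triangle_of_isCliquePair (by omega) hCD hx hy ⟨huC, huD⟩ hxy hyu hxu
  have hY : (C ∪ D)ᶜ.card = w := by
    rw [Finset.card_compl, Finset.card_union_of_disjoint (Finset.disjoint_left.2 hCD.disj)]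
    have := h.crit.card
    omega
  obtain ⟨x, hx, y, hy, hxy⟩ := Finset.one_lt_card.1 (show 1 < (C ∪ D)ᶜ.card by omega)
  simp only [Finset.mem_compl, Finset.mem_union, not_or] at hx hy
  have hND : ∀ y, y ∉ C ∧ y ∉ D → D.card - 1 ≤ (D.filter (G.Adj y)).card := by
    intro y hy
    obtain ⟨Q, hQ, hCQ⟩ := h.extend (R := {y}) (by simp [hy]) (by simp)
    have hsumQ := h.card_add C Q hCQ
    have hyQ : y ∈ Q := hQ (by simp)
    have : (Q.erase y).card ≤ (D.filter (G.Adj y)).card := by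
      refine Finset.card_le_card fun v hv => ?_
      simp at hv ⊢
      have hyv := hCQ.right y hyQ v hv.2 (Ne.symm hv.1)
      refine ⟨?_, hyv⟩
      by_contra hvD
      exact hind hy ⟨fun hvC => hCQ.disj v hvC hv.2, hvD⟩ hyv
    rw [Finset.card_erase_of_mem hyQ] at this
    omega
  have hinter : (D.filter (G.Adj x) ∩ D.filter (G.Adj y)).card ≤ 1 :=
    Finset.card_le_one.2 fun p hp q hq => by
      simp at hp hq
      exact hcom hx hy hxy hp.1.2 hq.1.2 hp.2.2 hq.2.2
  have hunion := Finset.card_union_add_card_inter (D.filter (G.Adj x)) (D.filter (G.Adj y))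
  have hunion' : (D.filter (G.Adj x) ∪ D.filter (G.Adj y)).card ≤ D.card :=
    Finset.card_le_card (by intro v; simp; tauto)
  have hxD := hND x hx
  have hyD := hND y hy
  have hNK : ∀ y, y ∉ C ∧ y ∉ D → (C.filter (G.Adj y) ∪ K).card = C.card - 1 := by
    intro y hy
    have hpair : IsCliquePair G (insert y (C.filter (G.Adj y))) (D ∪ (K \ C.filter (G.Adj y))) := by
      refine ⟨?_, ?_, fun a ha b hb => hDKcl a ?_ b ?_, ?_⟩
      · intro v hv
        have := hCD.disj v
        simp [hmK] at hv ⊢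
        grind
      · intro a ha b hb hab
        have := h.clique a
        simp at ha hb
        grind [SimpleGraph.adj_comm]
      · simp at ha ⊢
        tauto
      · simp at hb ⊢
        tauto
      · intro v hv1 hv2
        simp only [Finset.mem_insert, Finset.mem_filter, Finset.mem_union, Finset.mem_sdiff, hmK,
          not_or] at hv1 hv2
        have hvy : ¬ G.Adj v y := by
          intro hvy
          by_cases hvC : v ∈ C
          · exact hv1.2 ⟨hvC, hvy.symm⟩
          · exact hind hy ⟨hvC, hv2.1⟩ hvy.symm
        refine ⟨⟨y, by simp, hvy⟩, ?_⟩
        obtain ⟨d, hd, hvd⟩ : ∃ d ∈ D, ¬ G.Adj v d := by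
          by_cases hvC : v ∈ C
          · by_contra! hcon
            exact hv2.2 ⟨⟨hvC, hcon⟩, hv1.2⟩
          · exact (hCD.dom v hvC hv2.1).2
        exact ⟨d, Finset.mem_union_left _ hd, hvd⟩
    have := h.card_add _ _ hpair
    rw [Finset.card_insert_of_notMem (by simp [hy]), Finset.card_union_of_disjoint
      (Finset.disjoint_of_subset_right Finset.sdiff_subset hDK)] at this
    rw [← Finset.union_sdiff_self_eq_union, Finset.card_union_of_disjoint Finset.disjoint_sdiff]
    omega
  have hKK : (C.filter (G.Adj x) ∪ K) ∩ (C.filter (G.Adj y) ∪ K) ⊆ K := by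
    intro v hv
    by_contra hvK
    simp [hvK] at hv
    obtain ⟨d, hd⟩ : (D.filter (G.Adj x) ∩ D.filter (G.Adj y)).Nonempty := by
      rw [← Finset.card_pos]; omega
    simp at hd
    have := hcom hx hy hxy hv.1.2 hd.1.2 hv.2.2 hd.2.2
    subst this
    exact hCD.disj _ hv.1.1 hd.1.1
  have h1 := Finset.card_le_card hKK
  have h2 := Finset.card_union_add_card_inter (C.filter (G.Adj x) ∪ K) (C.filter (G.Adj y) ∪ K)
  have h3 : ((C.filter (G.Adj x) ∪ K) ∪ (C.filter (G.Adj y) ∪ K)).card ≤ C.card := by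
    refine Finset.card_le_card fun v hv => ?_
    simp [hmK] at hv
    tauto
  have h4 := hNK x hx
  have h5 := hNK y hy
  omega

end LargeGap

section SmallGap

variable [Fintype V] {z w : ℕ} {C : Finset V}

namespace IsSetting

lemma not_triangle (h : IsSetting G z w C) (hC : C.card = z + 1) {x y t : V} (hx : x ∉ C)
    (hy : y ∉ C) (ht : t ∉ C) (hxy : G.Adj x y) (hyt : G.Adj y t) : ¬ G.Adj x t := by
  intro hxt
  have := h.card_add_le (R := {x, y, t}) (by simp [hx, hy, ht])
    (by simp [hxy, hyt, hxt, hxy.symm, hyt.symm, hxt.symm])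
  rw [Finset.card_eq_three.2 ⟨x, y, t, hxy.ne, hxt.ne, hyt.ne, rfl⟩] at this
  omega

lemma exists_adj (h : IsSetting G z w C) (hC : C.card = z + 1) {v : V} (hv : v ∉ C) :
    ∃ u, u ∉ C ∧ G.Adj v u := by
  obtain ⟨Q, hQ, hCQ⟩ := h.extend (R := {v}) (by simpa using hv) (by simp)
  have := h.card_add C Q hCQ
  obtain ⟨u, hu, huv⟩ := Finset.exists_mem_ne (show 1 < Q.card by omega) v
  exact ⟨u, fun huC => hCQ.disj u huC hu, hCQ.right v (hQ (by simp)) u hu huv.symm⟩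

lemma isCliquePair_pair (h : IsSetting G z w C) (hC : C.card = z + 1) {x y : V} (hx : x ∉ C)
    (hy : y ∉ C) (hxy : G.Adj x y) : IsCliquePair G C {x, y} := by
  obtain ⟨Q, hQ, hCQ⟩ := h.extend (R := {x, y}) (by simp [hx, hy]) (by simp [hxy, hxy.symm])
  have := h.card_add C Q hCQ
  rwa [Finset.eq_of_subset_of_card_le hQ (by rw [Finset.card_pair hxy.ne]; omega)]

lemma exists_not_adj (h : IsSetting G z w C) {v : V} (hv : v ∉ C) : ∃ c ∈ C, ¬ G.Adj v c := by
  by_contra! hcon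
  have := h.max (insert v C) (by
    intro a ha b hb hab
    have := h.clique a
    simp only [Finset.mem_insert] at ha hb
    grind [SimpleGraph.adj_comm])
  rw [Finset.card_insert_of_notMem hv] at this
  omega

lemma eq_of_adj_adj (h : IsSetting G z w C) (hC : C.card = z + 1) {s t u v : V} (hs : s ∈ C)
    (ht : t ∈ C) (hst : s ≠ t) (hu : u ∉ C) (hv : v ∉ C) (hus : G.Adj u s) (hut : G.Adj u t)
    (hvs : G.Adj v s) (hvt : G.Adj v t) : u = v := by
  by_contra huv
  have := h.crit.card_common_le hst (N := insert u (insert v ((C.erase s).erase t))) (by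
    intro x hx
    have := h.clique s hs x
    have := h.clique t ht x
    simp only [Finset.mem_insert, Finset.mem_erase] at hx
    grind [SimpleGraph.adj_comm])
  rw [Finset.card_insert_of_notMem (by simp [hu, huv]), Finset.card_insert_of_notMem (by simp [hv]),
    Finset.card_erase_of_mem (by simp [ht, hst.symm]), Finset.card_erase_of_mem hs] at this
  have : 1 < C.card := Finset.one_lt_card.2 ⟨s, hs, t, ht, hst⟩
  omega

/-- A vertex adjacent to the apex `k` of a triangle `k d d'` on an edge `d d'` avoiding the maximum
clique has no other neighbour in the clique, and none in the edge. -/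
lemma not_adj_of_apex (h : IsSetting G z w C) (hC : C.card = z + 1) {k d d' v : V} (hk : k ∈ C)
    (hd : d ∉ C) (hd' : d' ∉ C) (hdd : G.Adj d d') (hkd : G.Adj k d) (hkd' : G.Adj k d')
    (hv : v ∉ C) (hvd : v ≠ d) (hvd' : v ≠ d') (hvk : G.Adj v k) :
    (∀ c ∈ C, c ≠ k → ¬ G.Adj v c) ∧ ¬ G.Adj v d ∧ ¬ G.Adj v d' := by
  have hcore : ∀ {d d' c : V}, d ∉ C → d' ∉ C → G.Adj d d' → G.Adj k d → G.Adj k d' →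
      v ≠ d → v ≠ d' → c ∈ C → c ≠ k → ¬ G.Adj c d → (G.Adj v c ∨ G.Adj v d) → False := by
    intro d d' c hd hd' hdd hkd hkd' hvd hvd' hc hck hcd hvcd
    have hf : Forces G {k} {c, d} (insert d' (insert v ((C.erase k).erase c))) := by
      have h1 := h.clique k hk
      have h2 := h.clique c hc
      constructor
      · simp [hck.symm, hkd.ne]
      · simp
      · simp [hcd, G.adj_comm d c]
      · intro x hx
        have := h1 x
        simp only [Finset.mem_insert, Finset.mem_erase] at hx
        simp
        grind [SimpleGraph.adj_comm]
      · intro x hx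
        have := h2 x
        simp only [Finset.mem_insert, Finset.mem_erase] at hx
        simp
        grind [SimpleGraph.adj_comm]
      · intro x hx
        simp only [Finset.mem_insert, Finset.mem_erase] at hx
        simp
        grind [SimpleGraph.Adj.ne]
    have := h.crit.card_le hf
    rw [Finset.card_insert_of_notMem (by simp [hd', hvd'.symm]),
      Finset.card_insert_of_notMem (by simp [hv]),
      Finset.card_erase_of_mem (by simp [hc, hck]), Finset.card_erase_of_mem hk] at this
    have : 1 < C.card := Finset.one_lt_card.2 ⟨c, hc, k, hk, hck⟩
    omega
  refine ⟨fun c hc hck hvc => ?_, fun hh => ?_, fun hh => ?_⟩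
  · by_cases hcd : G.Adj c d
    · by_cases hcd' : G.Adj c d'
      · exact hdd.ne (h.eq_of_adj_adj hC hk hc hck.symm hd hd' hkd.symm hcd.symm hkd'.symm
          hcd'.symm)
      · exact hcore hd' hd hdd.symm hkd' hkd hvd' hvd hc hck hcd' (.inl hvc)
    · exact hcore hd hd' hdd hkd hkd' hvd hvd' hc hck hcd (.inl hvc)
  · obtain ⟨c, hc, hcd⟩ := h.exists_not_adj hd
    refine hcore hd hd' hdd hkd hkd' hvd hvd' hc ?_ (fun hcd' => hcd hcd'.symm) (.inr hh)
    rintro rfl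
    exact hcd hkd.symm
  · obtain ⟨c, hc, hcd⟩ := h.exists_not_adj hd'
    refine hcore hd' hd hdd.symm hkd' hkd hvd' hvd hc ?_ (fun hcd' => hcd hcd'.symm) (.inr hh)
    rintro rfl
    exact hcd hkd'.symm

lemma not_star (h : IsSetting G z w C) (hC : C.card = z + 1) (hz : 2 ≤ z) {a : V}
    {y : Fin 3 → V} (hinj : Function.Injective y) (ha : a ∉ C) (hy : ∀ i, y i ∉ C)
    (hay : ∀ i, G.Adj a (y i)) (hleaf : ∀ i v, v ∉ C → G.Adj (y i) v → v = a) : False := by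
  have hdisj : ∀ i j, i ≠ j → ∀ c ∈ C, G.Adj (y i) c → ¬ G.Adj (y j) c := by
    intro i j hij c hc h1 h2
    obtain ⟨k, hki, hkj⟩ := (by decide : ∀ i j : Fin 3, ∃ k, k ≠ i ∧ k ≠ j) i j
    have := h.crit.eq_of_common (h.isCliquePair_pair hC ha (hy k) (hay k))
      (x := y i) (y := y j) (s := a) (t := c)
      ⟨hy i, by simp [(hay i).ne', hinj.ne hki.symm]⟩
      ⟨hy j, by simp [(hay j).ne', hinj.ne hkj.symm]⟩
      (hinj.ne hij) (hay i).symm h1 (hay j).symm h2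
    exact ha (this ▸ hc)
  have hsum : ∀ i j, i ≠ j → (C.filter (G.Adj (y i))).card +
      (C.filter fun c => G.Adj (y j) c ∧ G.Adj a c).card = z := by
    intro i j hij
    have hpair : IsCliquePair G (insert (y i) (C.filter (G.Adj (y i))))
        (insert a (insert (y j) (C.filter fun c => G.Adj (y j) c ∧ G.Adj a c))) := by
      have h1 := hay i
      have h2 := hay j
      have h3 := hinj.ne hij
      have h4 := hdisj i j hij
      have h5 := hy i
      have h6 := hy j
      refine ⟨?_, ?_, ?_, ?_⟩
      · intro v hv
        simp only [Finset.mem_insert, Finset.mem_filter] at hv ⊢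
        grind [SimpleGraph.Adj.ne]
      · intro p hp q hq hpq
        have := h.clique p
        simp only [Finset.mem_insert, Finset.mem_filter] at hp hq
        grind [SimpleGraph.adj_comm]
      · intro p hp q hq hpq
        have := h.clique p
        simp only [Finset.mem_insert, Finset.mem_filter] at hp hq
        grind [SimpleGraph.adj_comm]
      · intro v hv1 hv2
        have h7 := hleaf i v
        have h8 := hleaf j v
        simp only [Finset.mem_insert, Finset.mem_filter, not_or, not_and] at hv1 hv2
        refine ⟨⟨y i, by simp, fun hh => ?_⟩, ?_⟩
        · have := hh.symm
          tauto
        · by_cases hvj : G.Adj v (y j)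
          · refine ⟨a, by simp, fun hva => ?_⟩
            have := hvj.symm
            have := hva.symm
            tauto
          · exact ⟨y j, by simp, hvj⟩
    have := h.card_add _ _ hpair
    rw [Finset.card_insert_of_notMem (by simp [hy i]),
      Finset.card_insert_of_notMem (by simp [ha, (hay j).ne]),
      Finset.card_insert_of_notMem (by simp [hy j])] at this
    omega
  have hle : ∀ i, (C.filter fun c => G.Adj (y i) c ∧ G.Adj a c).card ≤
      (C.filter (G.Adj (y i))).card :=
    fun i => Finset.card_le_card fun c hc => by simp at hc ⊢; tauto
  have htot : ∑ i, (C.filter (G.Adj (y i))).card ≤ C.card := by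
    rw [← Finset.card_biUnion]
    · exact Finset.card_le_card fun c hc => by simp at hc; tauto
    · intro i _ j _ hij
      refine Finset.disjoint_left.2 fun c hc hc' => ?_
      simp at hc hc'
      exact hdisj i j hij c hc.1 hc.2 hc'.2
  have htot' : ∑ i, (C.filter fun c => G.Adj (y i) c ∧ G.Adj a c).card ≤
      (C.filter (G.Adj a)).card := by
    rw [← Finset.card_biUnion]
    · exact Finset.card_le_card fun c hc => by simp at hc ⊢; tauto
    · intro i _ j _ hij
      refine Finset.disjoint_left.2 fun c hc hc' => ?_
      simp at hc hc'
      exact hdisj i j hij c hc.1 hc.2.1 hc'.2.1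
  have hlt : (C.filter (G.Adj a)).card < C.card := by
    obtain ⟨c, hc, hac⟩ := h.exists_not_adj ha
    exact Finset.card_lt_card (Finset.filter_ssubset.2 ⟨c, hc, hac⟩)
  rw [Fin.sum_univ_three] at htot htot'
  have h1 := hle 0
  have h2 := hle 1
  have h3 := hle 2
  have h4 := hsum 0 1 (by decide)
  have h5 := hsum 0 2 (by decide)
  have h6 := hsum 1 0 (by decide)
  have h7 := hsum 1 2 (by decide)
  have h8 := hsum 2 0 (by decide)
  have h9 := hsum 2 1 (by decide)
  omega

/-- There are two disjoint edges avoiding the maximum clique. -/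
lemma exists_disjoint_edges (h : IsSetting G z w C) (hC : C.card = z + 1) (hz : 2 ≤ z)
    (hw : 2 ≤ w) : ∃ y y' d d', y ∉ C ∧ y' ∉ C ∧ d ∉ C ∧ d' ∉ C ∧ G.Adj y y' ∧ G.Adj d d' ∧
      y ≠ d ∧ y ≠ d' ∧ y' ≠ d ∧ y' ≠ d' := by
  by_contra! hcon
  have hH : Cᶜ.card = w + 2 := by
    rw [Finset.card_compl]
    have := h.crit.card
    omega
  have hstar : ∀ a p q r, a ∉ C → p ∉ C → q ∉ C → r ∉ C → p ≠ q → p ≠ r → q ≠ r →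
      G.Adj a p → G.Adj a q → ¬ G.Adj a r := by
    intro a p q r ha hp hq hr hpq hpr hqr hap haq har
    have hleaf : ∀ p q r, p ∉ C → q ∉ C → r ∉ C → p ≠ q → p ≠ r → q ≠ r →
        G.Adj a p → G.Adj a q → G.Adj a r → ∀ v, v ∉ C → G.Adj p v → v = a := by
      intro p q r hp hq hr hpq hpr hqr hap haq har v hv hpv
      by_contra hva
      have h1 := hcon p v a q hp hv ha hq hpv haq hap.ne' hpq hva
      have h2 := hcon p v a r hp hv ha hr hpv har hap.ne' hpr hva
      exact hqr (h1.symm.trans h2)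
    refine h.not_star hC hz (a := a) (y := ![p, q, r]) ?_ ha ?_ ?_ ?_
    · intro i j hij
      fin_cases i <;> fin_cases j <;> simp at hij ⊢ <;> grind
    · intro i
      fin_cases i <;> simp [hp, hq, hr]
    · intro i
      fin_cases i <;> simp [hap, haq, har]
    · intro i
      fin_cases i
      · exact hleaf p q r hp hq hr hpq hpr hqr hap haq har
      · exact hleaf q p r hq hp hr hpq.symm hqr hpr haq hap har
      · exact hleaf r p q hr hp hq hpr.symm hqr.symm hpq har hap haq
  obtain ⟨p, hp⟩ : Cᶜ.Nonempty := by rw [← Finset.card_pos]; omega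
  rw [Finset.mem_compl] at hp
  obtain ⟨q, hq, hpq⟩ := h.exists_adj hC hp
  obtain ⟨r, hr, s, hs, hrs⟩ := Finset.one_lt_card.1 (show 1 < ((Cᶜ.erase p).erase q).card by
    rw [Finset.card_erase_of_mem (by simp [hq, hpq.ne']), Finset.card_erase_of_mem (by simp [hp])]
    omega)
  simp only [Finset.mem_erase, Finset.mem_compl] at hr hs
  have hor : ∀ r, r ≠ q ∧ r ≠ p ∧ r ∉ C → G.Adj p r ∨ G.Adj q r := by
    rintro r ⟨hrq, hrp, hr⟩
    obtain ⟨t, ht, hrt⟩ := h.exists_adj hC hr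
    have := hcon r t p q hr ht hp hq hrt hpq hrp hrq
    by_cases htp : t = p
    · exact .inl (htp ▸ hrt.symm)
    · exact .inr (this htp ▸ hrt.symm)
  have k1 := hstar p q r s hp hq hr.2.2 hs.2.2 (Ne.symm hr.1) (Ne.symm hs.1) hrs hpq
  have k2 := hstar q p r s hq hp hr.2.2 hs.2.2 (Ne.symm hr.2.1) (Ne.symm hs.2.1) hrs hpq.symm
  have k3 := hcon p r q s hp hr.2.2 hq hs.2.2
  have k4 := hcon q r p s hq hr.2.2 hp hs.2.2
  have := hor r hr
  have := hor s hs
  grind [SimpleGraph.Adj.ne]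

lemma card_apex_le (h : IsSetting G z w C) (hC : C.card = z + 1) {d d' : V}
    (hd : d ∉ C) (hd' : d' ∉ C) (hdd : G.Adj d d') :
    (C.filter fun c => G.Adj d c ∧ G.Adj d' c).card ≤ 1 := by
  refine Finset.card_le_one.2 fun s hs t ht => ?_
  simp only [Finset.mem_filter] at hs ht
  by_contra hst
  exact hdd.ne (h.eq_of_adj_adj hC hs.1 ht.1 hst hd hd' hs.2.1 ht.2.1 hs.2.2 ht.2.2)

lemma card_apex_union (h : IsSetting G z w C) (hC : C.card = z + 1) {y y' d d' : V}
    (hy : y ∉ C) (hy' : y' ∉ C) (hd : d ∉ C) (hd' : d' ∉ C) (hyy : G.Adj y y') (hdd : G.Adj d d')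
    (n1 : y ≠ d) (n2 : y ≠ d') (n3 : y' ≠ d) (n4 : y' ≠ d') :
    ((C.filter fun c => G.Adj y c ∧ G.Adj y' c) ∪
      (C.filter fun c => G.Adj d c ∧ G.Adj d' c)).card + 1 = z := by
  have hpair : IsCliquePair G (insert y (insert y' (C.filter fun c => G.Adj y c ∧ G.Adj y' c)))
      (insert d (insert d' ((C.filter fun c => G.Adj d c ∧ G.Adj d' c) \
        (C.filter fun c => G.Adj y c ∧ G.Adj y' c)))) := by
    refine ⟨?_, ?_, ?_, ?_⟩
    · intro v hv
      simp only [Finset.mem_insert, Finset.mem_filter, Finset.mem_sdiff] at hv ⊢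
      grind
    · intro p hp q hq hpq
      have := h.clique p
      simp only [Finset.mem_insert, Finset.mem_filter] at hp hq
      grind [SimpleGraph.adj_comm]
    · intro p hp q hq hpq
      have := h.clique p
      simp only [Finset.mem_insert, Finset.mem_filter, Finset.mem_sdiff] at hp hq
      grind [SimpleGraph.adj_comm]
    · intro v hv1 hv2
      have h1 := h.not_triangle hC (x := y) (y := y') (t := v) hy hy'
      have h2 := h.not_triangle hC (x := d) (y := d') (t := v) hd hd'
      simp only [Finset.mem_insert, Finset.mem_filter, Finset.mem_sdiff, not_or] at hv1 hv2
      constructor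
      · by_cases hv : G.Adj v y
        · refine ⟨y', by simp, ?_⟩
          grind [SimpleGraph.adj_comm]
        · exact ⟨y, by simp, hv⟩
      · by_cases hv : G.Adj v d
        · refine ⟨d', by simp, ?_⟩
          grind [SimpleGraph.adj_comm]
        · exact ⟨d, by simp, hv⟩
  have := h.card_add _ _ hpair
  rw [Finset.card_insert_of_notMem (by simp [hy, hyy.ne]),
    Finset.card_insert_of_notMem (by simp [hy']),
    Finset.card_insert_of_notMem (by simp [hd, hdd.ne]),
    Finset.card_insert_of_notMem (by simp [hd'])] at this
  rw [← Finset.union_sdiff_self_eq_union, Finset.card_union_of_disjoint Finset.disjoint_sdiff]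
  omega

end IsSetting

end SmallGap

section Three

variable [Fintype V] {w : ℕ} {C : Finset V}

namespace IsSetting

lemma adj_or_adj (h : IsSetting G 3 w C) (hC : C.card = 4) {s t a b : V} (hs : s ∈ C) (ht : t ∈ C)
    (hst : s ≠ t) (ha : a ∉ C) (hb : b ∉ C) (hab : a ≠ b) (h1 : ¬ G.Adj a s) (h2 : ¬ G.Adj b s)
    (h3 : ¬ G.Adj b t) : G.Adj a t := by
  by_contra h4
  rw [G.adj_comm] at h1 h2 h3 h4
  obtain ⟨p, hp, q, hq, hpq⟩ := Finset.one_lt_card.1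
    (show 1 < ((C.erase s).erase t).card by
      rw [Finset.card_erase_of_mem (by simp [ht, hst.symm]), Finset.card_erase_of_mem hs]
      omega)
  simp only [Finset.mem_erase] at hp hq
  exact hst (h.crit.eq_of_forces hpq hab (h.clique s hs p hp.2.2 (Ne.symm hp.2.1))
    (h.clique s hs q hq.2.2 (Ne.symm hq.2.1)) (h.clique t ht p hp.2.2 (Ne.symm hp.1))
    (h.clique t ht q hq.2.2 (Ne.symm hq.1)) h1 h2 h4 h3 (by grind))

lemma adj_of_adj_adj (h : IsSetting G 3 w C) {y y' d d' c c₁ c₂ : V} (hy : y ∉ C) (hy' : y' ∉ C)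
    (hd : d ∉ C) (hd' : d' ∉ C) (hyy : G.Adj y y') (hdd : G.Adj d d') (hy1 : G.Adj y' c₁)
    (hd2 : G.Adj d' c₂) (n1 : y ≠ d) (n3 : y ≠ d') (n4 : y' ≠ d) (h1 : c₁ ∈ C)
    (h2 : c₂ ∈ C) (h12 : c₁ ≠ c₂) (hc : c ∈ C) (hc1 : c ≠ c₁) (hc2 : c ≠ c₂) (hyc : G.Adj y c)
    (hdc : G.Adj d c) : G.Adj y' d' := by
  by_contra hcon
  have k1 := h.clique c₁ h1 c hc hc1.symm
  have k2 := h.clique c₂ h2 c hc hc2.symm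
  have hf : Forces G {c} {y', d'} {c₁, c₂, y, d} := by
    constructor <;> simp <;> grind [SimpleGraph.adj_comm, SimpleGraph.Adj.ne]
  have := h.crit.card_le hf
  rw [Finset.card_insert_of_notMem (by simp; grind), Finset.card_insert_of_notMem (by simp; grind),
    Finset.card_pair n1] at this
  omega

lemma not_three_of_adj (h : IsSetting G 3 w C) (hC : C.card = 4) {y y' d d' x c₁ c₂ c₃ c₄ : V}
    (hy : y ∉ C) (hy' : y' ∉ C) (hd : d ∉ C) (hd' : d' ∉ C) (hxC : x ∉ C) (hyy : G.Adj y y')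
    (hdd : G.Adj d d') (n1 : y ≠ d) (n2 : y ≠ d') (n3 : y' ≠ d) (n4 : y' ≠ d') (x1 : x ≠ y)
    (x2 : x ≠ y') (x3 : x ≠ d) (x4 : x ≠ d') (h1C : c₁ ∈ C) (h2C : c₂ ∈ C) (h3C : c₃ ∈ C)
    (h4C : c₄ ∈ C) (hc : c₁ ≠ c₂) (h31 : c₃ ≠ c₁) (h32 : c₃ ≠ c₂) (h41 : c₄ ≠ c₁) (h42 : c₄ ≠ c₂)
    (h34 : c₃ ≠ c₄) (hy1 : G.Adj y c₁) (hy1' : G.Adj y' c₁) (hd2 : G.Adj d c₂) (hd2' : G.Adj d' c₂)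
    (hy2 : ¬ G.Adj y c₂) (hy2' : ¬ G.Adj y' c₂) (hd1 : ¬ G.Adj d c₁) (hd1' : ¬ G.Adj d' c₁)
    (hy3 : G.Adj y c₃) (hd3 : G.Adj d c₃) : False := by
  have hey : ∀ c ∈ C, c ≠ c₁ → c ≠ c₂ → (¬ G.Adj y c ↔ G.Adj y' c) := by
    intro c hcC hc1 hc2
    refine ⟨fun hyc => h.adj_or_adj hC h2C hcC hc2.symm hy' hy hyy.ne' hy2' hy2 hyc,
      fun hyc' hyc => hyy.ne (h.eq_of_adj_adj hC h1C hcC hc1.symm hy hy' hy1 hyc hy1' hyc')⟩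
  have hed : ∀ c ∈ C, c ≠ c₁ → c ≠ c₂ → (¬ G.Adj d c ↔ G.Adj d' c) := by
    intro c hcC hc1 hc2
    refine ⟨fun hdc => h.adj_or_adj hC h1C hcC hc1.symm hd' hd hdd.ne' hd1' hd1 hdc,
      fun hdc' hdc => hdd.ne (h.eq_of_adj_adj hC h2C hcC hc2.symm hd hd' hd2 hdc hd2' hdc')⟩
  have hyd : G.Adj y' d' := h.adj_of_adj_adj hy hy' hd hd' hyy hdd hy1' hd2' n1 n2 n3 h1C h2C hc
    h3C h31 h32 hy3 hd3
  have ey4 := (hey c₄ h4C h41 h42).1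
  have ed4 := (hed c₄ h4C h41 h42).1
  by_cases hy4 : G.Adj y c₄
  · by_cases hd4 : G.Adj d c₄
    · exact n1 (h.eq_of_adj_adj hC h3C h4C h34 hy hd hy3 hy4 hd3 hd4)
    · have := h.adj_of_adj_adj hy hy' hd' hd hyy hdd.symm hy1' hd2 n2 n1 n4 h1C h2C hc h4C
        h41 h42 hy4 (ed4 hd4)
      exact h.not_triangle hC hy' hd' hd hyd hdd.symm this
  by_cases hd4 : G.Adj d c₄
  · have := h.adj_of_adj_adj hy' hy hd hd' hyy.symm hdd hy1 hd2' n3 n4 n1 h1C h2C hc h4C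
      h41 h42 (ey4 hy4) hd4
    exact h.not_triangle hC hy hy' hd' hyy hyd this
  have hyd2 : G.Adj y d := h.adj_of_adj_adj hy' hy hd' hd hyy.symm hdd.symm hy1 hd2 n4 n3 n2
    h1C h2C hc h4C h41 h42 (ey4 hy4) (ed4 hd4)
  have ky3 : ¬ G.Adj y' c₃ := fun hh => (hey c₃ h3C h31 h32).2 hh hy3
  have kd3 : ¬ G.Adj d' c₃ := fun hh => (hed c₃ h3C h31 h32).2 hh hd3
  have k1 : ¬ G.Adj x c₁ → G.Adj x c₄ := fun hh =>
    h.adj_or_adj hC h1C h4C h41.symm hxC hd x3 hh hd1 hd4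
  have k2 : ¬ G.Adj x c₁ → G.Adj x c₃ := fun hh =>
    h.adj_or_adj hC h1C h3C h31.symm hxC hd' x4 hh hd1' kd3
  have k3 : ¬ G.Adj x c₂ → G.Adj x c₃ := fun hh =>
    h.adj_or_adj hC h2C h3C h32.symm hxC hy' x2 hh hy2' ky3
  have k4 : ¬ G.Adj x c₂ → G.Adj x c₄ := fun hh =>
    h.adj_or_adj hC h2C h4C h42.symm hxC hy x1 hh hy2 hy4
  have k5 : G.Adj x c₁ → ¬ G.Adj x c₂ := fun hh =>
    (h.not_adj_of_apex hC h1C hy hy' hyy hy1.symm hy1'.symm hxC x1 x2 hh).1 c₂ h2C hc.symm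
  have k6 : G.Adj x c₃ → ¬ G.Adj x c₄ := fun hh =>
    (h.not_adj_of_apex hC h3C hy hd hyd2 hy3.symm hd3.symm hxC x1 x3 hh).1 c₄ h4C h34.symm
  by_cases k : G.Adj x c₁
  · exact k6 (k3 (k5 k)) (k4 (k5 k))
  · exact k6 (k2 k) (k1 k)

lemma not_three (h : IsSetting G 3 w C) (hC : C.card = 4) (hw : 3 ≤ w) : False := by
  obtain ⟨y, y', d, d', hy, hy', hd, hd', hyy, hdd, n1, n2, n3, n4⟩ :=
    h.exists_disjoint_edges hC (by omega) (by omega)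
  have hu := h.card_apex_union hC hy hy' hd hd' hyy hdd n1 n2 n3 n4
  have hu1 := h.card_apex_le hC hy hy' hyy
  have hu2 := h.card_apex_le hC hd hd' hdd
  obtain ⟨c₁, c₂, h1, h2, hc⟩ : ∃ c₁ c₂, (c₁ ∈ C ∧ G.Adj y c₁ ∧ G.Adj y' c₁) ∧
      (c₂ ∈ C ∧ G.Adj d c₂ ∧ G.Adj d' c₂) ∧ c₁ ≠ c₂ := by
    set P := C.filter fun c => G.Adj y c ∧ G.Adj y' c with hP
    set Q := C.filter fun c => G.Adj d c ∧ G.Adj d' c with hQ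
    have h3 := Finset.card_union_add_card_inter P Q
    obtain ⟨c₁, hc₁⟩ : P.Nonempty := by rw [← Finset.card_pos]; omega
    obtain ⟨c₂, hc₂⟩ : Q.Nonempty := by rw [← Finset.card_pos]; omega
    refine ⟨c₁, c₂, by simpa [hP] using hc₁, by simpa [hQ] using hc₂, ?_⟩
    rintro rfl
    have : 0 < (P ∩ Q).card := Finset.card_pos.2 ⟨c₁, by simp [hc₁, hc₂]⟩
    omega
  obtain ⟨h1C, hy1, hy1'⟩ := h1
  obtain ⟨h2C, hd2, hd2'⟩ := h2
  have hrest : ((C.erase c₁).erase c₂).card = 2 := by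
    rw [Finset.card_erase_of_mem (by simp [h2C, hc.symm]), Finset.card_erase_of_mem h1C]
    omega
  obtain ⟨c₃, c₄, h34, hrest⟩ := Finset.card_eq_two.1 hrest
  have h3 : c₃ ≠ c₂ ∧ c₃ ≠ c₁ ∧ c₃ ∈ C := by
    have : c₃ ∈ (C.erase c₁).erase c₂ := by rw [hrest]; simp
    simpa using this
  have h4 : c₄ ≠ c₂ ∧ c₄ ≠ c₁ ∧ c₄ ∈ C := by
    have : c₄ ∈ (C.erase c₁).erase c₂ := by rw [hrest]; simp
    simpa using this
  obtain ⟨h32, h31, h3C⟩ := h3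
  obtain ⟨h42, h41, h4C⟩ := h4
  obtain ⟨x, hx⟩ : (C ∪ {y, y', d, d'})ᶜ.Nonempty := by
    rw [← Finset.card_pos, Finset.card_compl]
    have := Finset.card_union_le C {y, y', d, d'}
    have := Finset.card_le_four (a := y) (b := y') (c := d) (d := d')
    have := h.crit.card
    omega
  simp only [Finset.mem_compl, Finset.mem_union, Finset.mem_insert, Finset.mem_singleton,
    not_or] at hx
  obtain ⟨hxC, x1, x2, x3, x4⟩ := hx
  have hFy : ∀ v, v ∉ C → v ≠ y → v ≠ y' → G.Adj v c₁ → ∀ c ∈ C, c ≠ c₁ → ¬ G.Adj v c :=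
    fun v hv v1 v2 hvc => (h.not_adj_of_apex hC h1C hy hy' hyy hy1.symm hy1'.symm hv v1 v2 hvc).1
  have hFd : ∀ v, v ∉ C → v ≠ d → v ≠ d' → G.Adj v c₂ → ∀ c ∈ C, c ≠ c₂ → ¬ G.Adj v c :=
    fun v hv v1 v2 hvc => (h.not_adj_of_apex hC h2C hd hd' hdd hd2.symm hd2'.symm hv v1 v2 hvc).1
  have hy2 : ¬ G.Adj y c₂ := fun hh => hFd y hy n1 n2 hh c₁ h1C hc hy1
  have hy2' : ¬ G.Adj y' c₂ := fun hh => hFd y' hy' n3 n4 hh c₁ h1C hc hy1'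
  have hd1 : ¬ G.Adj d c₁ := fun hh => hFy d hd n1.symm n3.symm hh c₂ h2C hc.symm hd2
  have hd1' : ¬ G.Adj d' c₁ := fun hh => hFy d' hd' n2.symm n4.symm hh c₂ h2C hc.symm hd2'
  have hor : ∀ {a b : V}, a ∉ C → b ∉ C → G.Adj a b → ∀ c ∈ C, c ≠ c₃ → ¬ G.Adj a c →
      ¬ G.Adj b c → G.Adj a c₃ ∨ G.Adj b c₃ := by
    intro a b ha hb hab c hcC hc3 hac hbc
    by_cases hbc3 : G.Adj b c₃
    · exact .inr hbc3
    · exact .inl (h.adj_or_adj hC hcC h3C hc3 ha hb hab.ne hac hbc hbc3)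
  rcases hor hy hy' hyy c₂ h2C h32.symm hy2 hy2' with hy3 | hy3 <;>
  rcases hor hd hd' hdd c₁ h1C h31.symm hd1 hd1' with hd3 | hd3
  · exact h.not_three_of_adj hC hy hy' hd hd' hxC hyy hdd n1 n2 n3 n4 x1 x2 x3 x4 h1C h2C h3C h4C
      hc h31 h32 h41 h42 h34 hy1 hy1' hd2 hd2' hy2 hy2' hd1 hd1' hy3 hd3
  · exact h.not_three_of_adj hC hy hy' hd' hd hxC hyy hdd.symm n2 n1 n4 n3 x1 x2 x4 x3 h1C h2C h3C
      h4C hc h31 h32 h41 h42 h34 hy1 hy1' hd2' hd2 hy2 hy2' hd1' hd1 hy3 hd3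
  · exact h.not_three_of_adj hC hy' hy hd hd' hxC hyy.symm hdd n3 n4 n1 n2 x2 x1 x3 x4 h1C h2C h3C
      h4C hc h31 h32 h41 h42 h34 hy1' hy1 hd2 hd2' hy2' hy2 hd1 hd1' hy3 hd3
  · exact h.not_three_of_adj hC hy' hy hd' hd hxC hyy.symm hdd.symm n4 n3 n2 n1 x2 x1 x4 x3 h1C h2C
      h3C h4C hc h31 h32 h41 h42 h34 hy1' hy1 hd2' hd2 hy2' hy2 hd1' hd1 hy3 hd3

end IsSetting

end Three

section Two

variable [Fintype V] {w : ℕ} {C : Finset V}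

lemma IsCritical.not_forces_triple (h : IsCritical G 2 w) {S T : Finset V} {a b c : V}
    (hab : a ≠ b) (hac : a ≠ c) (hbc : b ≠ c) : ¬ Forces G S T {a, b, c} := by
  intro hf
  have := h.card_le hf
  rw [Finset.card_eq_three.2 ⟨a, b, c, hab, hac, hbc, rfl⟩] at this
  omega

lemma IsCritical.not_common_triple (h : IsCritical G 2 w) {u v a b c : V} (huv : u ≠ v)
    (hab : a ≠ b) (hac : a ≠ c) (hbc : b ≠ c) (h1 : G.Adj u a) (h2 : G.Adj v a) (h3 : G.Adj u b)
    (h4 : G.Adj v b) (h5 : G.Adj u c) : ¬ G.Adj v c := by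
  intro h6
  have := h.card_common_le huv (N := {a, b, c}) (by simp [h1, h2, h3, h4, h5, h6])
  rw [Finset.card_eq_three.2 ⟨a, b, c, hab, hac, hbc, rfl⟩] at this
  omega

namespace IsSetting

/-- Any other clique of the same size is a maximum clique as well. -/
lemma of_card_eq (h : IsSetting G 2 w C) {R : Finset V}
    (hR : ∀ a ∈ R, ∀ b ∈ R, a ≠ b → G.Adj a b) (hCR : R.card = C.card) : IsSetting G 2 w R where
  crit := h.crit
  card_add := h.card_add
  clique := hR
  max := hCR ▸ h.max

/-- A small critical graph does not contain a triangle with a further triangle on each side. -/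
lemma not_sun {a b c p q r : V} (h : IsSetting G 2 w {a, b, c}) (hw : w ≤ 3)
    (habc : ({a, b, c} : Finset V).card = 3)
    (hp : p ∉ ({a, b, c} : Finset V)) (hq : q ∉ ({a, b, c} : Finset V))
    (hr : r ∉ ({a, b, c} : Finset V)) (hpb : G.Adj p b) (hpc : G.Adj p c) (hqa : G.Adj q a)
    (hqc : G.Adj q c) (hra : G.Adj r a) (hrb : G.Adj r b) (hpa : ¬ G.Adj p a) (hqb : ¬ G.Adj q b)
    (hrc : ¬ G.Adj r c) (hpq : p ≠ q) (hpr : p ≠ r) (hqr : q ≠ r) : False := by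
  have hcl := h.clique
  have hne : a ≠ b ∧ a ≠ c ∧ b ≠ c := by
    refine ⟨?_, ?_, ?_⟩ <;> rintro rfl
    · have := Finset.card_le_two (a := a) (b := c)
      simp at habc
      omega
    · have := Finset.card_le_two (a := b) (b := a)
      simp at habc
      omega
    · have := Finset.card_le_two (a := a) (b := b)
      simp at habc
      omega
  obtain ⟨nab, nac, nbc⟩ := hne
  have hab : G.Adj a b := hcl a (by simp) b (by simp) nab
  have hac : G.Adj a c := hcl a (by simp) c (by simp) nac
  have hbc : G.Adj b c := hcl b (by simp) c (by simp) nbc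
  have hp' : p ≠ a ∧ p ≠ b ∧ p ≠ c := by simpa using hp
  have hq' : q ≠ a ∧ q ≠ b ∧ q ≠ c := by simpa using hq
  have hr' : r ≠ a ∧ r ≠ b ∧ r ≠ c := by simpa using hr
  have npq : ¬ G.Adj p q := fun hh => h.crit.not_common_triple hp'.1.symm nbc hq'.2.1.symm
    hq'.2.2.symm hab hpb hac hpc hqa.symm hh
  have npr : ¬ G.Adj p r := fun hh => h.crit.not_common_triple hp'.1.symm nbc hr'.2.1.symm
    hr'.2.2.symm hab hpb hac hpc hra.symm hh
  have nqr : ¬ G.Adj q r := fun hh => h.crit.not_common_triple hq'.2.1.symm nac hr'.1.symm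
    hr'.2.2.symm hab.symm hqa hbc hqc hrb.symm hh
  -- no vertex is adjacent to two of the three tips
  have key : ∀ {a b c p q r v : V}, G.Adj a b → G.Adj a c → G.Adj b c → G.Adj p b → G.Adj p c →
      G.Adj q a → G.Adj q c → G.Adj r a → G.Adj r b → ¬ G.Adj p a → ¬ G.Adj q b → ¬ G.Adj r c →
      p ≠ a → q ≠ b → r ≠ c → ¬ G.Adj p q → ¬ G.Adj p r → ¬ G.Adj q r →
      p ≠ q → p ≠ r → q ≠ r → v ≠ a → v ≠ b → v ≠ c → v ≠ r → G.Adj p v → ¬ G.Adj q v := by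
    intro a b c p q r v hab hac hbc hpb hpc hqa hqc hra hrb hpa hqb hrc pa qb rc npq npr nqr
      hpq hpr hqr va vb vc vr hpv hqv
    refine h.crit.not_forces_triple (S := {p, a}) (T := {q, b}) vc vr rc.symm ?_
    constructor <;> simp <;> grind [SimpleGraph.adj_comm, SimpleGraph.Adj.ne]
  obtain ⟨u, hu, hpu⟩ := h.exists_adj habc hp
  obtain ⟨v, hv, hqv⟩ := h.exists_adj habc hq
  obtain ⟨t, ht, hrt⟩ := h.exists_adj habc hr
  have hu' : u ≠ a ∧ u ≠ b ∧ u ≠ c := by simpa using hu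
  have hv' : v ≠ a ∧ v ≠ b ∧ v ≠ c := by simpa using hv
  have ht' : t ≠ a ∧ t ≠ b ∧ t ≠ c := by simpa using ht
  have hur : u ≠ r := fun hh => npr (hh ▸ hpu)
  have hvp : v ≠ p := fun hh => npq (hh ▸ hqv).symm
  have htq : t ≠ q := fun hh => nqr (hh ▸ hrt).symm
  have huv : u ≠ v := by
    rintro rfl
    exact key hab hac hbc hpb hpc hqa hqc hra hrb hpa hqb hrc hp'.1 hq'.2.1 hr'.2.2 npq npr nqr
      hpq hpr hqr hu'.1 hu'.2.1 hu'.2.2 hur hpu hqv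
  have hut : u ≠ t := by
    rintro rfl
    exact key hac hab hbc.symm hpc hpb hra hrb hqa hqc hpa hrc hqb hp'.1 hr'.2.2 hq'.2.1 npr npq
      (fun hh => nqr hh.symm) hpr hpq hqr.symm hu'.1 hu'.2.2 hu'.2.1 htq hpu hrt
  have hvt : v ≠ t := by
    rintro rfl
    exact key hbc hab.symm hac.symm hqc hqa hrb hra hpb hpc hqb hrc hpa hq'.2.1 hr'.2.2 hp'.1 nqr
      (fun hh => npq hh.symm) (fun hh => npr hh.symm) hqr hpq.symm hpr.symm hv'.2.1 hv'.2.2 hv'.1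
      hvp hqv hrt
  have hcard : ({a, b, c, p, q, r, u, v, t} : Finset V).card = 9 := by
    have := hpu.ne
    have := hqv.ne
    have := hrt.ne
    have huq : u ≠ q := fun hh => npq (hh ▸ hpu)
    have hvr : v ≠ r := fun hh => nqr (hh ▸ hqv)
    have htp : t ≠ p := fun hh => npr (hh ▸ hrt).symm
    repeat rw [Finset.card_insert_of_notMem (by simp; grind)]
    simp
  have := Finset.card_le_univ ({a, b, c, p, q, r, u, v, t} : Finset V)
  have := h.crit.card
  omega

end IsSetting

end Two

section Apex

variable [Fintype V] {w : ℕ} {C : Finset V} {k d d' : V}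

namespace IsSetting

lemma exists_adj_ne (h : IsSetting G 2 w C) (hC : C.card = 3) {x y : V} (hxy : x ≠ y) :
    ∃ p, p ≠ y ∧ G.Adj x p := by
  obtain ⟨P, Q, hP, hQ, hPQ⟩ := exists_isCliquePair G {x} {y} (by simpa using hxy)
    (by simp) (by simp)
  rw [Finset.singleton_subset_iff] at hP hQ
  have := h.card_add P Q hPQ
  have := h.max Q hPQ.right
  obtain ⟨p, hp, hpx⟩ := Finset.exists_mem_ne (show 1 < P.card by omega) x
  exact ⟨p, fun hpy => hPQ.disj p hp (hpy ▸ hQ), hPQ.left x hP p hp hpx.symm⟩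

lemma not_adj_apex (h : IsSetting G 2 w C) (hC : C.card = 3) (hk : k ∈ C) (hd : d ∉ C)
    (hd' : d' ∉ C) (hdd : G.Adj d d') (hkd : G.Adj k d) (hkd' : G.Adj k d') {v v' : V}
    (hv : v ∉ C) (hv' : v' ∉ C) (hvv : G.Adj v v') (n1 : v ≠ d) (n2 : v ≠ d') (n3 : v' ≠ d)
    (n4 : v' ≠ d') (hvk : G.Adj v k) : ¬ G.Adj v' k := by
  intro hvk'
  obtain ⟨h1, h2, h3⟩ := h.not_adj_of_apex hC hk hd hd' hdd hkd hkd' hv n1 n2 hvk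
  obtain ⟨h4, h5, h6⟩ := h.not_adj_of_apex hC hk hd hd' hdd hkd hkd' hv' n3 n4 hvk'
  obtain ⟨h7, -, -⟩ := h.not_adj_of_apex hC hk hv hv' hvv hvk.symm hvk'.symm hd' n2.symm n4.symm
    hkd'.symm
  obtain ⟨s, hs, t, ht, hst⟩ := Finset.one_lt_card.1
    (show 1 < (C.erase k).card by rw [Finset.card_erase_of_mem hk]; omega)
  simp only [Finset.mem_erase] at hs ht
  have a1 := h4 s hs.2 hs.1
  have a2 := h7 s hs.2 hs.1
  have a3 := h.clique s hs.2 t ht.2 hst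
  have a4 := h.clique k hk t ht.2 (Ne.symm ht.1)
  refine h.crit.not_forces_triple (S := {k}) (T := {v', d', s}) (a := v) (b := d) (c := t) n1
    (fun hh => hv (hh ▸ ht.2)) (fun hh => hd (hh ▸ ht.2)) ?_
  constructor <;> simp <;> grind [SimpleGraph.adj_comm, SimpleGraph.Adj.ne]

lemma isSetting_apex (h : IsSetting G 2 w C) (hC : C.card = 3) (hdd : G.Adj d d')
    (hkd : G.Adj k d) (hkd' : G.Adj k d') : IsSetting G 2 w {k, d, d'} :=
  h.of_card_eq (by simp [hdd, hkd, hkd', hdd.symm, hkd.symm, hkd'.symm])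
    (by rw [hC, Finset.card_eq_three.2 ⟨k, d, d', hkd.ne, hkd'.ne, hdd.ne, rfl⟩])

lemma not_adj_of_disjoint (h : IsSetting G 2 w C) (hC : C.card = 3) (hk : k ∈ C) (hd : d ∉ C)
    (hd' : d' ∉ C) (hdd : G.Adj d d') (hkd : G.Adj k d) (hkd' : G.Adj k d') {v v' x : V}
    (hv : v ∉ C) (hv' : v' ∉ C) (hvv : G.Adj v v') (n1 : v ≠ d) (n2 : v ≠ d') (n3 : v' ≠ d)
    (n4 : v' ≠ d') (hvx : G.Adj x v) : ¬ G.Adj x v' := by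
  intro hvx'
  by_cases hx : x ∈ C
  · by_cases hxk : x = k
    · subst hxk
      exact h.not_adj_apex hC hx hd hd' hdd hkd hkd' hv hv' hvv n1 n2 n3 n4 hvx.symm hvx'.symm
    · have hu := h.card_apex_union hC hv hv' hd hd' hvv hdd n1 n2 n3 n4
      have := Finset.card_le_card (show {x, k} ⊆ (C.filter fun c => G.Adj v c ∧ G.Adj v' c) ∪
        (C.filter fun c => G.Adj d c ∧ G.Adj d' c) by
          simp [Finset.insert_subset_iff, hx, hk, hvx.symm, hvx'.symm, hkd.symm, hkd'.symm])
      rw [Finset.card_pair hxk] at this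
      omega
  · exact h.not_triangle hC hx hv hv' hvx hvv hvx'

lemma exists_apex_pair (h : IsSetting G 2 w C) (hC : C.card = 3) (hk : k ∈ C) (hd : d ∉ C)
    (hd' : d' ∉ C) (hdd : G.Adj d d') (hkd : G.Adj k d) (hkd' : G.Adj k d') {v p q : V}
    (hv : v ∉ C) (hvd : v ≠ d) (hvd' : v ≠ d') (hp : G.Adj v p) (hq : G.Adj v q)
    (hpq : G.Adj p q) :
    ∃ c ∈ C, c ≠ k ∧ ∃ e, (e = d ∨ e = d') ∧ G.Adj v c ∧ G.Adj v e ∧ G.Adj c e := by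
  have h' := h.isSetting_apex hC hdd hkd hkd'
  have hC' : ({k, d, d'} : Finset V).card = 3 :=
    Finset.card_eq_three.2 ⟨k, d, d', hkd.ne, hkd'.ne, hdd.ne, rfl⟩
  have hmix : ∀ {p q}, p ∈ C → q ∉ C → G.Adj v p → G.Adj v q → G.Adj p q →
      p ≠ k ∧ (q = d ∨ q = d') := by
    intro p q hpC hqC hp hq hpq
    have hpk : p ≠ k := by
      rintro rfl
      obtain ⟨-, k1, k2⟩ := h.not_adj_of_apex hC hpC hd hd' hdd hkd hkd' hv hvd hvd' hp
      exact h.not_adj_apex hC hpC hd hd' hdd hkd hkd' hv hqC hq hvd hvd'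
        (fun hh => k1 (hh ▸ hq)) (fun hh => k2 (hh ▸ hq)) hp hpq.symm
    refine ⟨hpk, ?_⟩
    by_contra! hqd
    exact h'.not_triangle hC' (x := v) (y := p) (t := q) (by simp; grind) (by simp; grind)
      (by simp; grind) hp hpq hq
  by_cases hpC : p ∈ C <;> by_cases hqC : q ∈ C
  · have hne : ∀ {p q}, p ∈ C → q ∈ C → G.Adj v p → G.Adj v q → G.Adj p q → p ≠ k := by
      rintro p q hpC hqC hp hq hpq rfl
      exact (h.not_adj_of_apex hC hpC hd hd' hdd hkd hkd' hv hvd hvd' hp).1 q hqC hpq.ne' hq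
    have h1 := hne hpC hqC hp hq hpq
    have h2 := hne hqC hpC hq hp hpq.symm
    exact (h'.not_triangle hC' (x := v) (y := p) (t := q) (by simp; grind) (by simp; grind)
      (by simp; grind) hp hpq hq).elim
  · obtain ⟨h1, h2⟩ := hmix hpC hqC hp hq hpq
    exact ⟨p, hpC, h1, q, h2, hp, hq, hpq⟩
  · obtain ⟨h1, h2⟩ := hmix hqC hpC hq hp hpq.symm
    exact ⟨q, hqC, h1, p, h2, hq, hp, hpq.symm⟩
  · exact (h.not_triangle hC hv hpC hqC hp hpq hq).elim

lemma exists_triangle (h : IsSetting G 2 w C) (hC : C.card = 3) {y y' : V} (hyy : G.Adj y y')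
    (hcom : ∀ x, G.Adj x y → ¬ G.Adj x y') :
    ∃ x p q, (x = y ∨ x = y') ∧ G.Adj x p ∧ G.Adj x q ∧ G.Adj p q := by
  by_contra! hcon
  obtain ⟨p, hpy, hp⟩ := h.exists_adj_ne hC hyy.ne
  obtain ⟨p', hpy', hp'⟩ := h.exists_adj_ne hC hyy.ne'
  have hpp : p ≠ p' := fun hh => hcom p hp.symm (hh ▸ hp'.symm)
  have hCD : IsCliquePair G {y, p} {y', p'} := by
    refine ⟨?_, by simp [hp, hp.symm], by simp [hp', hp'.symm], fun v hv hv' => ?_⟩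
    · simp [hyy.ne, hpp, hpy, hpy'.symm]
    · have h1 := hcon y v p (.inl rfl)
      have h2 := hcon y' v p' (.inr rfl)
      simp
      grind [SimpleGraph.adj_comm]
  have := h.card_add _ _ hCD
  rw [Finset.card_pair hp.ne, Finset.card_pair hp'.ne] at this
  omega

lemma exists_triangle_of_disjoint (h : IsSetting G 2 w C) {y y' x : V}
    (hyy : G.Adj y y') (hcom : ∀ x, G.Adj x y → ¬ G.Adj x y') (hxy : x ≠ y) (hxy' : x ≠ y') :
    ∃ p q, G.Adj x p ∧ G.Adj x q ∧ G.Adj p q := by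
  obtain ⟨P, Q, hP, hQ, hPQ⟩ := exists_isCliquePair G {y, y'} {x} (by simp [hxy.symm, hxy'.symm])
    (by simp [hyy, hyy.symm]) (by simp)
  have hP' : P ⊆ {y, y'} := by
    intro v hv
    by_contra hvy
    simp only [Finset.mem_insert, Finset.mem_singleton, not_or] at hvy
    exact hcom v (hPQ.left v hv y (hP (by simp)) hvy.1) (hPQ.left v hv y' (hP (by simp)) hvy.2)
  have hsum := h.card_add P Q hPQ
  have hPc := Finset.card_le_card hP'
  rw [Finset.card_pair hyy.ne] at hPc
  have hxQ : x ∈ Q := hQ (by simp)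
  obtain ⟨p, hp, q, hq, hpq⟩ := Finset.one_lt_card.1
    (show 1 < (Q.erase x).card by rw [Finset.card_erase_of_mem hxQ]; omega)
  rw [Finset.mem_erase] at hp hq
  exact ⟨p, q, hPQ.right x hxQ p hp.2 hp.1.symm, hPQ.right x hxQ q hq.2 hq.1.symm,
    hPQ.right p hp.2 q hq.2 hpq⟩

/-- Two different vertices cannot both have an apex pair. -/
lemma eq_of_apex_pair (h : IsSetting G 2 w C) (hC : C.card = 3) (hk : k ∈ C) (hd : d ∉ C)
    (hd' : d' ∉ C) (hdd : G.Adj d d') (hkd : G.Adj k d) (hkd' : G.Adj k d') {x x' c c' e e' : V}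
    (hx : x ∉ C) (hx' : x' ∉ C) (hc : c ∈ C) (hck : c ≠ k) (he : e = d ∨ e = d')
    (hxc : G.Adj x c) (hxe : G.Adj x e) (hce : G.Adj c e) (hc' : c' ∈ C) (hck' : c' ≠ k)
    (he' : e' = d ∨ e' = d') (hxc' : G.Adj x' c') (hxe' : G.Adj x' e') (hce' : G.Adj c' e') :
    x = x' := by
  have hkc := h.clique k hk c hc hck.symm
  have hkc' := h.clique k hk c' hc' hck'.symm
  have heC : e ∉ C := by grind
  have heC' : e' ∉ C := by grind
  have hke : G.Adj k e := by grind
  have hke' : G.Adj k e' := by grind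
  by_contra hxx
  by_cases hcc : c = c'
  · subst hcc
    by_cases hee : e = e'
    · subst hee
      exact h.crit.not_common_triple hce.ne (a := k) (b := x) (c := x') (fun hh => hx (hh ▸ hk))
        (fun hh => hx' (hh ▸ hk)) hxx hkc.symm hke.symm hxc.symm hxe.symm hxc'.symm hxe'.symm
    · exact hee (h.eq_of_adj_adj hC hk hc hck.symm heC heC' hke.symm hce.symm hke'.symm hce'.symm)
  · have hcc' := h.clique c hc c' hc' hcc
    by_cases hee : e = e'
    · subst hee
      obtain ⟨s, hs, hes⟩ := h.exists_not_adj heC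
      have : ({k, c, c', s} : Finset V) ⊆ C := by simp [Finset.insert_subset_iff, *]
      have := Finset.card_le_card this
      have n : s ≠ k ∧ s ≠ c ∧ s ≠ c' := by
        refine ⟨?_, ?_, ?_⟩ <;> rintro rfl <;> simp_all [SimpleGraph.adj_comm]
      rw [Finset.card_insert_of_notMem (by simp; grind),
        Finset.card_insert_of_notMem (by simp; grind), Finset.card_pair n.2.2.symm] at this
      omega
    · have hee' : G.Adj e e' := by grind [SimpleGraph.adj_comm]
      exact h.crit.not_common_triple (u := c) (v := e') (fun hh => heC' (hh ▸ hc)) (a := k)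
        (b := e) (c := c') hke.ne hck'.symm (fun hh => heC (hh ▸ hc')) hkc.symm hke'.symm hce
        hee'.symm hcc' hce'.symm

lemma not_apex_pair (h : IsSetting G 2 w C) (hC : C.card = 3) (hw : w ≤ 3) (hk : k ∈ C)
    (hd : d ∉ C) (hd' : d' ∉ C) (hdd : G.Adj d d') (hkd : G.Adj k d) (hkd' : G.Adj k d')
    {x c : V} (hx : x ∉ C) (hxd : x ≠ d) (hxd' : x ≠ d') (hc : c ∈ C) (hck : c ≠ k)
    (hxc : G.Adj x c) (hxd_adj : G.Adj x d) : ¬ G.Adj c d := by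
  intro hcd
  obtain ⟨t, ht⟩ := Finset.card_pos.1 (show 0 < ((C.erase k).erase c).card by
    rw [Finset.card_erase_of_mem (by simp [hc, hck]), Finset.card_erase_of_mem hk]; omega)
  simp only [Finset.mem_erase] at ht
  obtain ⟨htc, htk, htC⟩ := ht
  have hkc := h.clique k hk c hc hck.symm
  have hkt := h.clique k hk t htC htk.symm
  have hct := h.clique c hc t htC htc.symm
  have hcard : ({k, c, d} : Finset V).card = 3 :=
    Finset.card_eq_three.2 ⟨k, c, d, hkc.ne, hkd.ne, hcd.ne, rfl⟩
  have h' : IsSetting G 2 w {k, c, d} := h.isSetting_apex hC hcd hkc hkd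
  have htd : ¬ G.Adj t d := by
    intro hh
    obtain ⟨s, hs, hds⟩ := h.exists_not_adj hd
    have : ({k, c, t, s} : Finset V) ⊆ C := by simp [Finset.insert_subset_iff, *]
    have := Finset.card_le_card this
    have n : s ≠ k ∧ s ≠ c ∧ s ≠ t := by
      refine ⟨?_, ?_, ?_⟩ <;> rintro rfl <;> simp_all [SimpleGraph.adj_comm]
    rw [Finset.card_insert_of_notMem (by simp; grind),
      Finset.card_insert_of_notMem (by simp; grind), Finset.card_pair n.2.2.symm] at this
    omega
  refine h'.not_sun hw hcard (p := x) (q := d') (r := t) (by simp; grind)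
    (by simp; grind [SimpleGraph.Adj.ne]) (by simp; grind) hxc hxd_adj hkd'.symm hdd.symm
    hkt.symm hct.symm (fun hh => ?_) (fun hh => ?_) htd hxd' (fun hh => hx (hh ▸ htC))
    (fun hh => hd' (hh ▸ htC))
  · exact (h.not_adj_of_apex hC hk hd hd' hdd hkd hkd' hx hxd hxd' hh).2.1 hxd_adj
  · exact hdd.ne (h.eq_of_adj_adj hC hk hc hck.symm hd hd' hkd.symm hcd.symm hkd'.symm hh)

lemma not_two_of_apex (h : IsSetting G 2 w C) (hC : C.card = 3) {y y' : V} (hk : k ∈ C)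
    (hy : y ∉ C) (hy' : y' ∉ C) (hd : d ∉ C) (hd' : d' ∉ C) (hyy : G.Adj y y') (hdd : G.Adj d d')
    (n1 : y ≠ d) (n2 : y ≠ d') (n3 : y' ≠ d) (n4 : y' ≠ d') (hkd : G.Adj k d)
    (hkd' : G.Adj k d') : False := by
  have hcom : ∀ x, G.Adj x y → ¬ G.Adj x y' := fun x =>
    h.not_adj_of_disjoint hC hk hd hd' hdd hkd hkd' hy hy' hyy n1 n2 n3 n4
  have hw : w ≤ 3 := by
    have hR : ((C ∪ {y, y', d, d'})ᶜ).card ≤ 1 := by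
      refine Finset.card_le_one.2 fun x hx x' hx' => ?_
      simp only [Finset.mem_compl, Finset.mem_union, Finset.mem_insert, Finset.mem_singleton,
        not_or] at hx hx'
      obtain ⟨hxC, x1, x2, x3, x4⟩ := hx
      obtain ⟨hxC', x1', x2', x3', x4'⟩ := hx'
      obtain ⟨p, q, hp, hq, hpq⟩ := h.exists_triangle_of_disjoint hyy hcom x1 x2
      obtain ⟨p', q', hp', hq', hpq'⟩ := h.exists_triangle_of_disjoint hyy hcom x1' x2'
      obtain ⟨c, hc, hck, e, he, hxc, hxe, hce⟩ :=
        h.exists_apex_pair hC hk hd hd' hdd hkd hkd' hxC x3 x4 hp hq hpq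
      obtain ⟨c', hc', hck', e', he', hxc', hxe', hce'⟩ :=
        h.exists_apex_pair hC hk hd hd' hdd hkd hkd' hxC' x3' x4' hp' hq' hpq'
      exact h.eq_of_apex_pair hC hk hd hd' hdd hkd hkd' hxC hxC' hc hck he hxc hxe hce hc' hck' he'
        hxc' hxe' hce'
    rw [Finset.card_compl] at hR
    have := Finset.card_union_le C {y, y', d, d'}
    have := Finset.card_le_four (a := y) (b := y') (c := d) (d := d')
    have := h.crit.card
    omega
  obtain ⟨x, p, q, hx, hp, hq, hpq⟩ := h.exists_triangle hC hyy hcom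
  have hxC : x ∉ C := by grind
  have hxd : x ≠ d := by grind
  have hxd' : x ≠ d' := by grind
  obtain ⟨c, hc, hck, e, rfl | rfl, hxc, hxe, hce⟩ :=
    h.exists_apex_pair hC hk hd hd' hdd hkd hkd' hxC hxd hxd' hp hq hpq
  · exact h.not_apex_pair hC hw hk hd hd' hdd hkd hkd' hxC hxd hxd' hc hck hxc hxe hce
  · exact h.not_apex_pair hC hw hk hd' hd hdd.symm hkd' hkd hxC hxd' hxd hc hck hxc hxe hce

lemma not_two (h : IsSetting G 2 w C) (hC : C.card = 3) (hw : 2 ≤ w) : False := by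
  obtain ⟨y, y', d, d', hy, hy', hd, hd', hyy, hdd, n1, n2, n3, n4⟩ :=
    h.exists_disjoint_edges hC le_rfl hw
  have hu := h.card_apex_union hC hy hy' hd hd' hyy hdd n1 n2 n3 n4
  obtain ⟨k, hk⟩ := Finset.card_pos.1 (show 0 < ((C.filter fun c => G.Adj y c ∧ G.Adj y' c) ∪
    (C.filter fun c => G.Adj d c ∧ G.Adj d' c)).card by omega)
  simp only [Finset.mem_union, Finset.mem_filter] at hk
  rcases hk with ⟨hk, h1, h2⟩ | ⟨hk, h1, h2⟩
  · exact h.not_two_of_apex hC hk hd hd' hy hy' hdd hyy n1.symm n3.symm n2.symm n4.symm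
      h1.symm h2.symm
  · exact h.not_two_of_apex hC hk hy hy' hd hd' hyy hdd n1 n2 n3 n4 h1.symm h2.symm

end IsSetting

end Apex

section RiNumber

variable [Fintype V] {z w : ℕ}

lemma IsCritical.false_of_le (h : IsCritical G z w) (hz : 2 ≤ z) (hw : 2 ≤ w)
    (hzw : 3 ≤ w ∨ z = 2 ∧ w = 2) : False := by
  obtain ⟨C, hS⟩ := exists_isSetting h fun P Q hPQ => h.card_add_card_eq hz hzw hPQ
  have hC := hS.card_eq hz hw
  obtain ⟨y, y', d, d', hy, hy', hd, hd', hyy, hdd, n1, n2, n3, n4⟩ :=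
    hS.exists_disjoint_edges hC hz hw
  have hu := hS.card_apex_union hC hy hy' hd hd' hyy hdd n1 n2 n3 n4
  have hu1 := hS.card_apex_le hC hy hy' hyy
  have hu2 := hS.card_apex_le hC hd hd' hdd
  have hu3 := Finset.card_union_le (C.filter fun c => G.Adj y c ∧ G.Adj y' c)
    (C.filter fun c => G.Adj d c ∧ G.Adj d' c)
  obtain rfl | rfl : z = 2 ∨ z = 3 := by omega
  · exact hS.not_two hC hw
  · exact hS.not_three hC (by omega)

lemma IsCritical.nonempty_iso (h : IsCritical G z w) :
    Nonempty (G ≃g SimpleGraph.cycleGraph 5) := by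
  have hz := h.zero_lt_left
  have hw := h.compl.zero_lt_left
  obtain rfl | hz := (show 1 ≤ z from hz).eq_or_lt
  · obtain ⟨x, a, t, s, b, hp⟩ := h.exists_isPentagon
    exact hp.nonempty_iso
  obtain rfl | hw := (show 1 ≤ w from hw).eq_or_lt
  · obtain ⟨x, a, t, s, b, hp⟩ := h.compl.exists_isPentagon
    exact hp.of_compl.nonempty_iso
  by_cases hzw : 3 ≤ w ∨ z = 2 ∧ w = 2
  · exact (h.false_of_le hz hw hzw).elim
  · exact (h.compl.false_of_le hw hz (by omega)).elim

lemma IsDomPair.exists_isKRiDF {A B : Finset V} (h : IsDomPair G A B) :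
    ∃ f, IsKRiDF G 2 f ∧ riWeight f = A.card + B.card := by
  have hAB : ∀ v ∈ B, v ∉ A := fun v hB hA => h.disj v hA hB
  refine ⟨fun v => if v ∈ A then 1 else if v ∈ B then 2 else 0, ⟨?_, ?_, ?_⟩, ?_⟩
  · intro v
    dsimp only
    split_ifs <;> omega
  · intro i hi hi' u v hu hv
    dsimp only at hu hv
    by_cases huA : u ∈ A <;> by_cases hvA : v ∈ A
    · exact h.left u huA v hvA
    · grind
    · grind
    · exact h.right u (by grind) v (by grind)
  · intro v hv i hi hi'
    dsimp only at hv
    obtain ⟨⟨a, ha, hva⟩, b, hb, hvb⟩ := h.dom v (by grind) (by grind)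
    obtain rfl | rfl : i = 1 ∨ i = 2 := by omega
    · exact ⟨a, hva, by simp [ha]⟩
    · exact ⟨b, hvb, by simp [hb, hAB b hb]⟩
  · rw [riWeight, ← Finset.card_union_of_disjoint (Finset.disjoint_left.2 h.disj)]
    congr 1
    ext v
    simp only [Finset.mem_filter, Finset.mem_univ, true_and, Finset.mem_union]
    grind

lemma IsDomPair.riNumber_le {A B : Finset V} (h : IsDomPair G A B) :
    riNumber G 2 ≤ A.card + B.card :=
  Nat.sInf_le h.exists_isKRiDF

lemma exists_isDomPair_card_eq_riNumber (G : SimpleGraph V) :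
    ∃ A B, IsDomPair G A B ∧ A.card + B.card = riNumber G 2 := by
  have hne : {w | ∃ f, IsKRiDF G 2 f ∧ riWeight f = w}.Nonempty := by
    obtain ⟨A, B, -, -, h⟩ := exists_isDomPair G ∅ ∅ (by simp) (by simp) (by simp)
    exact ⟨_, h.exists_isKRiDF⟩
  obtain ⟨f, ⟨hf, hind, hdom⟩, hw⟩ := Nat.sInf_mem hne
  have hdisj : ∀ v ∈ Finset.univ.filter fun v => f v = 1,
      v ∉ Finset.univ.filter fun v => f v = 2 := by
    intro v
    simp only [Finset.mem_filter, Finset.mem_univ, true_and]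
    omega
  refine ⟨Finset.univ.filter fun v => f v = 1, Finset.univ.filter fun v => f v = 2,
    ⟨hdisj, ?_, ?_, ?_⟩, ?_⟩
  · intro a ha b hb
    exact hind 1 le_rfl (by omega) a b (by simpa using ha) (by simpa using hb)
  · intro a ha b hb
    exact hind 2 (by omega) le_rfl a b (by simpa using ha) (by simpa using hb)
  · intro v h1 h2
    simp only [Finset.mem_filter, Finset.mem_univ, true_and] at h1 h2 ⊢
    have h0 : f v = 0 := by have := hf v; omega
    obtain ⟨a, ha, ha'⟩ := hdom v h0 1 le_rfl (by omega)
    obtain ⟨b, hb, hb'⟩ := hdom v h0 2 (by omega) le_rfl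
    exact ⟨⟨a, ha', ha⟩, b, hb', hb⟩
  · rw [riNumber, ← hw, riWeight, ← Finset.card_union_of_disjoint (Finset.disjoint_left.2 hdisj)]
    congr 1
    ext v
    have := hf v
    simp only [Finset.mem_filter, Finset.mem_univ, true_and, Finset.mem_union]
    omega

lemma riNumber_le_card (G : SimpleGraph V) : riNumber G 2 ≤ Fintype.card V := by
  obtain ⟨A, B, -, -, h⟩ := exists_isDomPair G ∅ ∅ (by simp) (by simp) (by simp)
  have := card_add_card_add_card_le (X := ∅) h.disj (by simp)
  have := h.riNumber_le
  rw [Finset.card_empty] at *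
  omega

lemma IsDomPair.two_le_card {A B : Finset V} (h : IsDomPair G A B) (hn : 3 ≤ Fintype.card V) :
    2 ≤ A.card + B.card ∧ (A.card + B.card = 2 → ∃ a b, a ≠ b ∧
      ∀ v, v ≠ a → v ≠ b → G.Adj v a ∧ G.Adj v b) := by
  have hle := Finset.card_union_le A B
  by_cases huniv : A ∪ B = Finset.univ
  · rw [huniv, Finset.card_univ] at hle
    exact ⟨by omega, fun _ => by omega⟩
  · obtain ⟨v, hv⟩ : ∃ v, v ∉ A ∪ B := by
      by_contra! hcon
      exact huniv (Finset.eq_univ_of_forall hcon)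
    rw [Finset.mem_union, not_or] at hv
    obtain ⟨⟨a, ha, -⟩, b, hb, -⟩ := h.dom v hv.1 hv.2
    have hA := Finset.card_pos.2 ⟨a, ha⟩
    have hB := Finset.card_pos.2 ⟨b, hb⟩
    refine ⟨by omega, fun h2 => ?_⟩
    obtain ⟨a, rfl⟩ := Finset.card_eq_one.1 (show A.card = 1 by omega)
    obtain ⟨b, rfl⟩ := Finset.card_eq_one.1 (show B.card = 1 by omega)
    refine ⟨a, b, by simpa using h.disj, fun v hva hvb => ?_⟩
    simpa using h.dom v (by simpa using hva) (by simpa using hvb)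

lemma five_le_riNumber_add (G : SimpleGraph V) (hn : 3 ≤ Fintype.card V) :
    5 ≤ riNumber G 2 + riNumber Gᶜ 2 := by
  obtain ⟨A, B, hAB, h1⟩ := exists_isDomPair_card_eq_riNumber G
  obtain ⟨C, D, hCD, h2⟩ := exists_isDomPair_card_eq_riNumber Gᶜ
  obtain ⟨h3, h4⟩ := hAB.two_le_card hn
  obtain ⟨h5, h6⟩ := hCD.two_le_card hn
  by_contra hlt
  obtain ⟨a, b, hab, h7⟩ := h4 (by omega)
  obtain ⟨c, d, hcd, h8⟩ := h6 (by omega)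
  simp only [SimpleGraph.compl_adj] at h8
  obtain ⟨v, hv⟩ : (({a, b} : Finset V)ᶜ).Nonempty := by
    rw [← Finset.card_pos, Finset.card_compl, Finset.card_pair hab]
    omega
  simp only [Finset.mem_compl, Finset.mem_insert, Finset.mem_singleton, not_or] at hv
  clear h4 h6
  have hmem : ∀ u, u = a ∨ u = b → u = c ∨ u = d := by
    intro u hu
    by_contra! huc
    have := h8 u huc.1 huc.2
    have := h7 c
    have := h7 d
    by_cases hca : c = a <;> by_cases hcb : c = b <;> by_cases hda : d = a <;>
      by_cases hdb : d = b <;> grind [SimpleGraph.adj_comm]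
  have h9 := h7 v hv.1 hv.2
  have ha := hmem a (.inl rfl)
  have hb := hmem b (.inr rfl)
  have h10 := h8 v (by grind) (by grind)
  grind

lemma riNumber_add_le (G : SimpleGraph V)
    (hG : ¬ Nonempty (G ≃g SimpleGraph.cycleGraph 5)) :
    riNumber G 2 + riNumber Gᶜ 2 ≤ Fintype.card V + 2 := by
  by_contra! hlt
  have h1 := riNumber_le_card G
  have h2 := riNumber_le_card Gᶜ
  refine hG (IsCritical.nonempty_iso (z := riNumber Gᶜ 2 - 3)
    (w := Fintype.card V - riNumber Gᶜ 2) ⟨by omega, fun A B hAB => ?_, fun C D hCD => ?_⟩)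
  · have := hAB.riNumber_le
    omega
  · have := hCD.isDomPair_compl.riNumber_le
    omega

end RiNumber

end RainbowPair

theorem stmt_10 {V : Type*} [Fintype V] (G : SimpleGraph V) (n : ℕ)
    (hcard : Fintype.card V = n) (hn : 3 ≤ n)
    (hnc : ¬ Nonempty (G ≃g SimpleGraph.cycleGraph 5)) :
    5 ≤ riNumber G 2 + riNumber Gᶜ 2 ∧ riNumber G 2 + riNumber Gᶜ 2 ≤ n + 2 := by
  subst hcard
  exact ⟨RainbowPair.five_le_riNumber_add G hn, RainbowPair.riNumber_add_le G hnc⟩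
end

section
/- Let k ≥ 2, let G be a bipartite graph of order N, and let G' be the graph obtained from G by attaching to each vertex v of G exactly k − 1 new pendant vertices, each adjacent only to v. If G' has a k-rainbow independent dominating function of weight (k−1)N + ℓ, then G has a dominating set of size ℓ. -/
open scoped Classical

/-- The graph obtained from `G` by attaching `m` new pendant vertices to each
vertex of `G`; the pendant `(v, i)` is adjacent only to `v`. -/
def attachPendants {V : Type*} (G : SimpleGraph V) (m : ℕ) :
    SimpleGraph (V ⊕ (V × Fin m)) :=
  SimpleGraph.fromRel (fun a b =>
    match a, b with
    | Sum.inl u, Sum.inl v => G.Adj u v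
    | Sum.inl u, Sum.inr p => p.1 = u
    | Sum.inr _, _ => False)

section AttachPendants

variable {V : Type*} {G : SimpleGraph V} {m : ℕ}

@[simp]
theorem attachPendants_adj_inl_inl {u v : V} :
    (attachPendants G m).Adj (Sum.inl u) (Sum.inl v) ↔ G.Adj u v := by
  simp only [attachPendants, SimpleGraph.fromRel_adj, G.adj_comm v u, or_self, ne_eq,
    Sum.inl.injEq, and_iff_right_iff_imp]
  exact fun h => h.ne

@[simp]
theorem attachPendants_adj_inr_inl {p : V × Fin m} {v : V} :
    (attachPendants G m).Adj (Sum.inr p) (Sum.inl v) ↔ p.1 = v := by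
  simp [attachPendants]

@[simp]
theorem attachPendants_adj_inl_inr {p : V × Fin m} {v : V} :
    (attachPendants G m).Adj (Sum.inl v) (Sum.inr p) ↔ p.1 = v := by
  simp [attachPendants]

@[simp]
theorem attachPendants_not_adj_inr_inr {p q : V × Fin m} :
    ¬ (attachPendants G m).Adj (Sum.inr p) (Sum.inr q) := by
  simp [attachPendants]

variable {k : ℕ} {f : V ⊕ (V × Fin m) → ℕ}

/-- A pendant vertex has a single neighbor, so it cannot see two different colours. -/
theorem IsKRiDF.attachPendants_inr_ne_zero (hf : IsKRiDF (attachPendants G m) k f)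
    (hk : 2 ≤ k) (p : V × Fin m) : f (Sum.inr p) ≠ 0 := by
  intro h0
  have key : ∀ i, 1 ≤ i → i ≤ k → f (Sum.inl p.1) = i := by
    intro i hi hik
    obtain ⟨u | q, hadj, hu⟩ := hf.2.2 _ h0 i hi hik
    · rwa [attachPendants_adj_inr_inl.mp hadj]
    · exact absurd hadj attachPendants_not_adj_inr_inr
  have h1 := key 1 le_rfl (by lia)
  have h2 := key 2 (by lia) hk
  lia

/-- Fewer than `k` pendants cannot show all `k` colours to an uncoloured vertex. -/
theorem IsKRiDF.exists_adj_attachPendants_inl_ne_zero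
    (hf : IsKRiDF (attachPendants G m) k f) (hm : m < k) {v : V} (hv : f (Sum.inl v) = 0) :
    ∃ d, f (Sum.inl d) ≠ 0 ∧ G.Adj v d := by
  by_contra! hno
  have hsub : Finset.Icc 1 k ⊆ Finset.univ.image fun j : Fin m => f (Sum.inr (v, j)) := by
    intro i hi
    obtain ⟨hi, hik⟩ := Finset.mem_Icc.mp hi
    obtain ⟨u | ⟨w, j⟩, hadj, hu⟩ := hf.2.2 _ hv i hi hik
    · exact absurd (attachPendants_adj_inl_inl.mp hadj) (hno u (by lia))
    · obtain rfl : w = v := attachPendants_adj_inl_inr.mp hadj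
      exact Finset.mem_image.mpr ⟨j, Finset.mem_univ j, hu⟩
  have hcard := (Finset.card_le_card hsub).trans Finset.card_image_le
  simp only [Nat.card_Icc, Finset.card_univ, Fintype.card_fin] at hcard
  lia

end AttachPendants

theorem riWeight_sum {α β : Type*} [Fintype α] [Fintype β] (f : α ⊕ β → ℕ) :
    riWeight f = riWeight (f ∘ Sum.inl) + riWeight (f ∘ Sum.inr) := by
  simp only [riWeight, Finset.card_filter, Fintype.sum_sum_type, Function.comp_apply]

theorem riWeight_eq_card {α : Type*} [Fintype α] {f : α → ℕ} (hf : ∀ a, f a ≠ 0) :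
    riWeight f = Fintype.card α := by
  simp [riWeight, hf]

theorem stmt_11 {V : Type*} [Fintype V] (G : SimpleGraph V) (k ℓ : ℕ)
    (hk : 2 ≤ k) (hbip : G.Colorable 2)
    (f : V ⊕ (V × Fin (k - 1)) → ℕ)
    (hf : IsKRiDF (attachPendants G (k - 1)) k f)
    (hw : riWeight f = (k - 1) * Fintype.card V + ℓ) :
    ∃ D : Finset V, D.card = ℓ ∧ ∀ v : V, v ∈ D ∨ ∃ d ∈ D, G.Adj v d := by
  have hpend := riWeight_eq_card (hf.attachPendants_inr_ne_zero hk)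
  refine ⟨Finset.univ.filter fun v => f (Sum.inl v) ≠ 0, ?_, fun v => ?_⟩
  · have hsum := riWeight_sum f
    rw [hw, show riWeight (f ∘ Sum.inr) = _ from hpend, Fintype.card_prod, Fintype.card_fin,
      mul_comm, add_comm] at hsum
    exact (Nat.add_right_cancel hsum).symm
  · by_cases hv : f (Sum.inl v) = 0
    · obtain ⟨d, hd, hadj⟩ := hf.exists_adj_attachPendants_inl_ne_zero (by lia) hv
      exact Or.inr ⟨d, by simpa using hd, hadj⟩
    · exact Or.inl (by simpa using hv)
end
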